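/- Let R be an unramified hypersurface and let M be a nonzero finitely generated R-module. Then Ext_R^i(M,M) ≠ 0 for all i with 0 ≤ i ≤ grade(M). -/

import Mathlib

open CategoryTheory IsLocalRing

universe u

/-- `extMod S n A B` is the `n`-th Ext module `Ext_S^n(A, B)` of `S`-modules `A` and `B`,
realized as an object of `ModuleCat S`. -/
noncomputable def extMod (S : Type u) [CommRing S] (n : ℕ)
    (A : Type u) [AddCommGroup A] [Module S A] (B : Type u) [AddCommGroup B] [Module S B] :
    ModuleCat.{u} S :=
  ((Ext S (ModuleCat.{u} S) n).obj (Opposite.op (ModuleCat.of S A))).obj (ModuleCat.of S B)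

/-- `moduleGrade S M = inf { n | Ext_S^n(M, S) ≠ 0 }`. -/
noncomputable def moduleGrade (S : Type u) [CommRing S]
    (M : Type u) [AddCommGroup M] [Module S M] : ℕ :=
  sInf {n : ℕ | ¬ Subsingleton (extMod S n M S)}

/-- A Noetherian local ring is regular if its maximal ideal can be generated by
`dim R` many elements. -/
def IsRegularLocal (R : Type u) [CommRing R] [IsLocalRing R] : Prop :=
  IsNoetherianRing R ∧ ∃ s : Finset R, Ideal.span (s : Set R) = maximalIdeal R ∧
    ((s.card : ℕ∞) : WithBot ℕ∞) = ringKrullDim R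

/-- A local ring `(R, m, k)` is unramified if it is equicharacteristic
(`char R = char k`), or it has mixed characteristic (`char R ≠ char k`) and
`char k ∉ m²`. -/
def IsUnramifiedLocal (R : Type u) [CommRing R] [IsLocalRing R] : Prop :=
  ringChar R = ringChar (ResidueField R) ∨
    (ringChar R ≠ ringChar (ResidueField R) ∧
      ((ringChar (ResidueField R) : R) ∉ (maximalIdeal R) ^ 2))

/-- A presentation of the `m`-adic completion of a local ring `R` as `Q/(x)` with
`(Q, n)` a regular local ring and `x ∈ n²` a nonzerodivisor. -/
structure HypersurfacePresentation (R : Type u) [CommRing R] [IsLocalRing R] :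
    Type (u + 1) where
  Q : Type u
  [commRing : CommRing Q]
  [localRing : IsLocalRing Q]
  regular : IsRegularLocal Q
  x : Q
  mem_sq : x ∈ (maximalIdeal Q) ^ 2
  nonzerodivisor : x ∈ nonZeroDivisors Q
  equiv : AdicCompletion (maximalIdeal R) R ≃+* Q ⧸ Ideal.span {x}

/-- A local ring `R` is a hypersurface if it is not regular and its `m`-adic completion
is isomorphic to `Q/(x)` for a regular local ring `(Q, n)` and a nonzerodivisor `x ∈ n²`. -/
def IsHypersurface (R : Type u) [CommRing R] [IsLocalRing R] : Prop :=
  ¬ IsRegularLocal R ∧ Nonempty (HypersurfacePresentation R)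

set_option linter.unusedSectionVars false

open TensorProduct

/-- The middle cohomology of two composable linear maps. -/
abbrev MidHom {Λ : Type*} [CommRing Λ] {A B C : Type*} [AddCommGroup A] [AddCommGroup B]
    [AddCommGroup C] [Module Λ A] [Module Λ B] [Module Λ C] (f : A →ₗ[Λ] B) (g : B →ₗ[Λ] C) :
    Type _ :=
  (LinearMap.ker g) ⧸ (LinearMap.range f).comap (LinearMap.ker g).subtype


section MidHom
variable {Λ : Type*} [CommRing Λ] {A B C A' B' C' : Type*} [AddCommGroup A] [AddCommGroup B]
    [AddCommGroup C] [Module Λ A] [Module Λ B] [Module Λ C] [AddCommGroup A'] [AddCommGroup B']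
    [AddCommGroup C'] [Module Λ A'] [Module Λ B'] [Module Λ C']

lemma MidHom.congr (f : A →ₗ[Λ] B) (g : B →ₗ[Λ] C) (f' : A' →ₗ[Λ] B') (g' : B' →ₗ[Λ] C')
    (eA : A ≃ₗ[Λ] A') (eB : B ≃ₗ[Λ] B') (eC : C ≃ₗ[Λ] C')
    (hf : ∀ x, eB (f x) = f' (eA x)) (hg : ∀ x, eC (g x) = g' (eB x)) :
    Nonempty (MidHom f g ≃ₗ[Λ] MidHom f' g') := by
  have hk : (LinearMap.ker g).map (eB : B →ₗ[Λ] B') = LinearMap.ker g' := by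
    ext y
    obtain ⟨x, rfl⟩ := eB.surjective y
    simp [← hg]
  let e : LinearMap.ker g ≃ₗ[Λ] LinearMap.ker g' :=
    (eB.submoduleMap (LinearMap.ker g)).trans (LinearEquiv.ofEq _ _ hk)
  have he : ∀ x, (e x : B') = eB x := fun x => rfl
  refine ⟨Submodule.Quotient.equiv _ _ e ?_⟩
  ext y
  obtain ⟨y, rfl⟩ := e.surjective y
  simp only [Submodule.mem_map_equiv, LinearEquiv.symm_apply_apply, Submodule.mem_comap, Submodule.subtype_apply,
    LinearMap.mem_range, he]
  constructor
  · rintro ⟨x, hx⟩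
    exact ⟨eA x, by rw [← hf, hx]⟩
  · rintro ⟨x, hx⟩
    refine ⟨eA.symm x, eB.injective ?_⟩
    rw [hf, ← hx]; simp

lemma MidHom.subsingleton_iff {f : A →ₗ[Λ] B} {g : B →ₗ[Λ] C} :
    Subsingleton (MidHom f g) ↔ ∀ x, g x = 0 → ∃ y, f y = x := by
  rw [Submodule.Quotient.subsingleton_iff, Submodule.eq_top_iff']
  simp only [Submodule.mem_comap, Submodule.subtype_apply, LinearMap.mem_range, Subtype.forall, LinearMap.mem_ker]

end MidHom

lemma homology_equiv_midHom {R : Type u} [CommRing R] (S : ShortComplex (ModuleCat.{u} R)) :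
    Nonempty (S.homology ≃ₗ[R] MidHom S.f.hom S.g.hom) := by
  have h : LinearMap.range S.moduleCatToCycles =
      (LinearMap.range S.f.hom).comap (LinearMap.ker S.g.hom).subtype := ?_
  · let e : S.homology ≃ₗ[R] (LinearMap.ker S.g.hom ⧸ LinearMap.range S.moduleCatToCycles) :=
      S.moduleCatHomologyIso.toLinearEquiv
    exact ⟨e.trans (Submodule.quotEquivOfEq _ _ h)⟩
  ext x
  simp only [LinearMap.mem_range, Submodule.mem_comap, Submodule.subtype_apply]
  constructor
  · rintro ⟨y, rfl⟩
    exact ⟨y, rfl⟩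
  · rintro ⟨y, h⟩
    exact ⟨y, Subtype.ext h⟩

section
variable (R : Type u) [CommRing R] (P : ℕ → Type u) [∀ n, AddCommGroup (P n)]
  [∀ n, Module R (P n)]
  (d : ∀ n, P (n + 1) →ₗ[R] P n) (M : Type u) [AddCommGroup M] [Module R M] (ε : P 0 →ₗ[R] M)

/-- An exact sequence of projectives as a chain complex of objects. -/
noncomputable def resComplex (h : ∀ n, Function.Exact (d (n + 1)) (d n)) :
    ChainComplex (ModuleCat.{u} R) ℕ :=
  ChainComplex.of (fun n => ModuleCat.of R (P n)) (fun n => ModuleCat.ofHom (d n)) (fun n => by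
    ext x
    simpa using (h n).apply_apply_eq_zero x)

lemma resComplex_d (h : ∀ n, Function.Exact (d (n + 1)) (d n)) (n : ℕ) :
    (resComplex R P d h).d (n + 1) n = ModuleCat.ofHom (d n) := by
  delta resComplex
  exact ChainComplex.of_d (fun n => ModuleCat.of R (P n)) (fun n => ModuleCat.ofHom (d n)) n

/-- An exact sequence of projectives as a projective resolution. -/
noncomputable def projRes [∀ n, Module.Projective R (P n)] (h : ∀ n, Function.Exact (d (n + 1)) (d n)) (h0 : Function.Exact (d 0) ε)
    (hε : Function.Surjective ε) : ProjectiveResolution (ModuleCat.of R M) where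
  complex := resComplex R P d h
  projective n := by
    change Projective (ModuleCat.of R (P n))
    exact (IsProjective.iff_projective (R := R) (P n)).1 inferInstance
  hasHomology := inferInstance
  π := (ChainComplex.toSingle₀Equiv _ _).symm ⟨ModuleCat.ofHom ε, by
    have : (resComplex R P d h).d 1 0 = ModuleCat.ofHom (d 0) := resComplex_d ..
    rw [this]
    ext x
    exact h0.apply_apply_eq_zero x⟩
  quasiIso := ⟨fun n => by
    cases n with
    | zero =>
      rw [ChainComplex.quasiIsoAt₀_iff, ShortComplex.quasiIso_iff_of_zeros']
      · have h1 : (ShortComplex.mk (ModuleCat.ofHom (d 0)) (ModuleCat.ofHom ε) (by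
          ext x
          exact h0.apply_apply_eq_zero x)).Exact ∧ Epi (ModuleCat.ofHom ε) :=
          ⟨(ShortComplex.ShortExact.moduleCat_exact_iff_function_exact _).2 h0,
           (ModuleCat.epi_iff_surjective _).2 hε⟩
        refine (ShortComplex.exact_and_epi_g_iff_of_iso ?_).2 h1
        refine ShortComplex.isoMk (Iso.refl _) (Iso.refl _) (Iso.refl _) ?_ ?_
        · exact (Category.id_comp _).trans ((resComplex_d R P d h 0).symm.trans
            (Category.comp_id _).symm)
        · refine (Category.id_comp _).trans (Eq.trans ?_ (Category.comp_id _).symm)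
          exact (ChainComplex.toSingle₀Equiv_symm_apply_f_zero
            (C := resComplex R P d h) (X := ModuleCat.of R M) _ _).symm
      all_goals rfl
    | succ n =>
      rw [quasiIsoAt_iff_exactAt']
      · rw [HomologicalComplex.exactAt_iff' _ (n + 1 + 1) (n + 1) n (by simp) (by simp)]
        refine (ShortComplex.ShortExact.moduleCat_exact_iff_function_exact _).2 ?_
        have h1 : (resComplex R P d h).d (n+1+1) (n+1) = ModuleCat.ofHom (d (n+1)) := resComplex_d ..
        have h2 : (resComplex R P d h).d (n+1) (n) = ModuleCat.ofHom (d (n)) := resComplex_d ..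
        dsimp [HomologicalComplex.sc', HomologicalComplex.shortComplexFunctor']
        rw [h1, h2]
        exact h n
      · exact ChainComplex.exactAt_succ_single_obj _ _⟩
end


section
variable (R : Type u) [CommRing R] (P : ℕ → Type u) [∀ n, AddCommGroup (P n)]
  [∀ n, Module R (P n)]
  (d : ∀ n, P (n + 1) →ₗ[R] P n) (M : Type u) [AddCommGroup M] [Module R M] (ε : P 0 →ₗ[R] M)

/-- Positive-degree Ext computed by an exact sequence of projectives. -/
lemma extMod_succ_equiv [∀ n, Module.Projective R (P n)] (N : Type u) [AddCommGroup N] [Module R N]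
    (h : ∀ n, Function.Exact (d (n + 1)) (d n)) (h0 : Function.Exact (d 0) ε)
    (hε : Function.Surjective ε) (n : ℕ) :
    Nonempty (extMod R (n + 1) M N ≃ₗ[R]
      MidHom (LinearMap.lcomp R N (d n)) (LinearMap.lcomp R N (d (n + 1)))) := by
  let PR := projRes R P d M ε h h0 hε
  let K := PR.complex.linearYonedaObj R (ModuleCat.of R N)
  have e1 : extMod R (n+1) M N ≅ K.homology (n+1) := PR.isoExt (n+1) (ModuleCat.of R N)
  have e2 : K.homology (n+1) ≅ (K.sc' n (n+1) (n+2)).homology :=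
    ShortComplex.homologyMapIso (K.isoSc' n (n+1) (n+2) (by simp) (by simp))
  obtain ⟨e3⟩ := homology_equiv_midHom (K.sc' n (n+1) (n+2))
  have hd : ∀ m, K.d m (m+1) = ModuleCat.ofHom (Linear.leftComp R _ (PR.complex.d (m+1) m)) :=
    fun m => rfl
  have hd' : ∀ m, PR.complex.d (m+1) m = ModuleCat.ofHom (d m) := fun m => resComplex_d R P d h m
  let e4 : ∀ m, (PR.complex.X m ⟶ ModuleCat.of R N) ≃ₗ[R] (P m →ₗ[R] N) := fun m =>
    ModuleCat.homLinearEquiv (S := R) (M := ModuleCat.of R (P m)) (N := ModuleCat.of R N)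
  have key : ∀ m, ∀ x : (PR.complex.X m ⟶ ModuleCat.of R N),
      e4 (m+1) (PR.complex.d (m+1) m ≫ x) = LinearMap.lcomp R N (d m) (e4 m x) := by
    intro m x
    rw [hd']
    rfl
  obtain ⟨e5⟩ := MidHom.congr (K.sc' n (n+1) (n+2)).f.hom (K.sc' n (n+1) (n+2)).g.hom
    (LinearMap.lcomp R N (d n)) (LinearMap.lcomp R N (d (n + 1))) (e4 n) (e4 (n+1)) (e4 (n+2))
    (fun x => key n x) (fun x => key (n+1) x)
  exact ⟨(e1 ≪≫ e2).toLinearEquiv.trans (e3.trans e5)⟩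
end

section act
variable {R : Type*} [CommRing R] {ι κ : Type*} [Fintype ι] [Fintype κ]

/-- The action of a matrix on tuples of elements of a module. -/
def act (A : Matrix ι κ R) (N : Type*) [AddCommGroup N] [Module R N] : (κ → N) →ₗ[R] (ι → N) where
  toFun φ i := ∑ j, A i j • φ j
  map_add' φ ψ := by ext i; simp [Finset.sum_add_distrib]
  map_smul' r φ := by
    ext i
    simp only [Pi.smul_apply, RingHom.id_apply, Finset.smul_sum]
    exact Finset.sum_congr rfl fun j _ => smul_comm _ _ _

lemma act_apply (A : Matrix ι κ R) {N : Type*} [AddCommGroup N] [Module R N] (φ : κ → N) (i : ι) :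
    act A N φ i = ∑ j, A i j • φ j := rfl

lemma exact_of_isBaseChange {S : Type*} [CommRing S] [Algebra R S] [Module.Flat R S]
    {A B C A' B' C' : Type*} [AddCommGroup A] [AddCommGroup B] [AddCommGroup C]
    [AddCommGroup A'] [AddCommGroup B'] [AddCommGroup C'] [Module R A] [Module R B] [Module R C]
    [Module R A'] [Module R B'] [Module R C'] [Module S A'] [Module S B'] [Module S C']
    [IsScalarTower R S A'] [IsScalarTower R S B'] [IsScalarTower R S C']
    {ia : A →ₗ[R] A'} {ib : B →ₗ[R] B'} {ic : C →ₗ[R] C'} (ha : IsBaseChange S ia)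
    (hb : IsBaseChange S ib) (hc : IsBaseChange S ic) {f : A →ₗ[R] B} {g : B →ₗ[R] C}
    {f' : A' →ₗ[S] B'} {g' : B' →ₗ[S] C'} (hf : ∀ x, f' (ia x) = ib (f x))
    (hg : ∀ x, g' (ib x) = ic (g x)) (h : Function.Exact f g) : Function.Exact f' g' := by
  have h1 := Module.Flat.lTensor_exact S h
  change Function.Exact (f.baseChange S) (g.baseChange S) at h1
  refine Function.Exact.of_ladder_linearEquiv_of_exact (e₁ := ha.equiv) (e₂ := hb.equiv)
    (e₃ := hc.equiv) ?_ ?_ h1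
  · ext x; simp [hf, IsBaseChange.equiv_tmul]
  · ext x; simp [hg, IsBaseChange.equiv_tmul]

lemma surjective_of_isBaseChange {S : Type*} [CommRing S] [Algebra R S]
    {A B A' B' : Type*} [AddCommGroup A] [AddCommGroup B]
    [AddCommGroup A'] [AddCommGroup B']  [Module R A] [Module R B]
    [Module R A'] [Module R B']  [Module S A'] [Module S B']
    [IsScalarTower R S A'] [IsScalarTower R S B']
    {ia : A →ₗ[R] A'} {ib : B →ₗ[R] B'}  (ha : IsBaseChange S ia)
    (hb : IsBaseChange S ib) {f : A →ₗ[R] B}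
    {f' : A' →ₗ[S] B'}  (hf : ∀ x, f' (ia x) = ib (f x))
    (h : Function.Surjective f) : Function.Surjective f' := by
  have h1 : Function.Surjective (f.baseChange S) := LinearMap.lTensor_surjective S h
  have : f' ∘ₗ ha.equiv.toLinearMap = hb.equiv.toLinearMap ∘ₗ f.baseChange S := by
    ext x; simp [hf, IsBaseChange.equiv_tmul]
  have h2 : Function.Surjective (f' ∘ₗ ha.equiv.toLinearMap) := by
    rw [this]
    exact hb.equiv.surjective.comp h1
  exact Function.Surjective.of_comp h2

end act

/-- A resolution by finite free modules, given by matrices. -/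
structure FreeRes (R : Type u) [CommRing R] (M : Type u) [AddCommGroup M] [Module R M] where
  c : ℕ → ℕ
  A : ∀ n, Matrix (Fin (c n)) (Fin (c (n + 1))) R
  e : Fin (c 0) → M
  surj : Function.Surjective (Fintype.linearCombination R e)
  exact_zero : Function.Exact (act (A 0) R) (Fintype.linearCombination R e)
  exact_succ : ∀ n, Function.Exact (act (A (n + 1)) R) (act (A n) R)

section
variable {R : Type u} [CommRing R] {M : Type u} [AddCommGroup M] [Module R M]

lemma exists_act_exact [IsNoetherianRing R] {n : ℕ} {N : Type*} [AddCommGroup N] [Module R N]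
    (f : (Fin n → R) →ₗ[R] N) :
    ∃ (m : ℕ) (A : Matrix (Fin n) (Fin m) R), Function.Exact (act A R) f := by
  obtain ⟨m, v, hv⟩ := Submodule.fg_iff_exists_fin_generating_family.1
    (IsNoetherian.noetherian (LinearMap.ker f))
  refine ⟨m, Matrix.of fun i j => v j i, ?_⟩
  rw [LinearMap.exact_iff, ← hv, ← Fintype.range_linearCombination R]
  congr 1
  ext x i
  simp [act, Fintype.linearCombination_apply, mul_comm]

/-- The syzygy matrices of a resolution, built recursively. -/
noncomputable def syzygySeq [IsNoetherianRing R] {n₀ n₁ : ℕ} (A₀ : Matrix (Fin n₀) (Fin n₁) R) :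
    ℕ → Σ (a : ℕ) (b : ℕ), Matrix (Fin a) (Fin b) R
  | 0 => ⟨n₀, n₁, A₀⟩
  | k + 1 => ⟨(syzygySeq A₀ k).2.1, (exists_act_exact (act (syzygySeq A₀ k).2.2 R)).choose,
      (exists_act_exact (act (syzygySeq A₀ k).2.2 R)).choose_spec.choose⟩

lemma FreeRes.nonempty [IsNoetherianRing R] [Module.Finite R M] : Nonempty (FreeRes R M) := by
  obtain ⟨n, e, he⟩ := Module.Finite.exists_fin (R := R) (M := M)
  obtain ⟨m, A, hA⟩ := exists_act_exact (Fintype.linearCombination R e)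
  have hs : Function.Surjective (Fintype.linearCombination R e) := by
    rw [← LinearMap.range_eq_top, Fintype.range_linearCombination, he]
  refine ⟨⟨fun k => (syzygySeq A k).1, fun k => (syzygySeq A k).2.2, e, hs, hA, fun k => ?_⟩⟩
  · exact (exists_act_exact (act (syzygySeq A k).2.2 R)).choose_spec.choose_spec

variable {S : Type u} [CommRing S] [Algebra R S] [Module.Flat R S]
  {M' : Type u} [AddCommGroup M'] [Module R M'] [Module S M'] [IsScalarTower R S M']

lemma act_map {ι κ : Type*} [Fintype ι] [Fintype κ] (A : Matrix ι κ R)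
   {N N' : Type*} [AddCommGroup N] [Module R N] [AddCommGroup N'] [Module R N'] [Module S N']
   [IsScalarTower R S N'] (i : N →ₗ[R] N') (φ : κ → N) :
    act (A.map (algebraMap R S)) N' (i.compLeft κ φ) = i.compLeft ι (act A N φ) := by
  ext k
  simp [act_apply]

lemma exact_act_map {ι κ μ : Type*} [Fintype ι] [Fintype κ] [Fintype μ] {A : Matrix κ ι R}
    {B : Matrix μ κ R} {N N' : Type*} [AddCommGroup N] [Module R N] [AddCommGroup N'] [Module R N']
    [Module S N'] [IsScalarTower R S N'] {i : N →ₗ[R] N'} (hi : IsBaseChange S i)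
    (h : Function.Exact (act A N) (act B N)) :
    Function.Exact (act (A.map (algebraMap R S)) N') (act (B.map (algebraMap R S)) N') :=
  exact_of_isBaseChange (hi.finitePow ι) (hi.finitePow κ) (hi.finitePow μ)
    (fun x => act_map A i x) (fun x => act_map B i x) h

/-- Flat base change of a resolution. -/
noncomputable def FreeRes.baseChange (F : FreeRes R M) {i : M →ₗ[R] M'} (hi : IsBaseChange S i) :
    FreeRes S M' :=
  have hc : ∀ x, Fintype.linearCombination S (i ∘ F.e)
      ((Algebra.linearMap R S).compLeft (Fin (F.c 0)) x) =
      i (Fintype.linearCombination R F.e x) := fun x => by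
    simp [Fintype.linearCombination_apply]
  { c := F.c
    A n := (F.A n).map (algebraMap R S)
    e := i ∘ F.e
    surj := surjective_of_isBaseChange ((IsBaseChange.linearMap R S).finitePow _) hi hc F.surj
    exact_zero := exact_of_isBaseChange ((IsBaseChange.linearMap R S).finitePow _)
      ((IsBaseChange.linearMap R S).finitePow _) hi
      (fun x => act_map (F.A 0) (Algebra.linearMap R S) x) hc F.exact_zero
    exact_succ n := exact_act_map (IsBaseChange.linearMap R S) (F.exact_succ n) }

/-- The map on cochains induced by a matrix. -/
abbrev FreeRes.δ (F : FreeRes R M) (N : Type*) [AddCommGroup N] [Module R N] (n : ℕ) :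
    (Fin (F.c n) → N) →ₗ[R] (Fin (F.c (n + 1)) → N) := act (F.A n).transpose N

lemma act_transpose_comp {ι κ μ : Type*} [Fintype ι] [Fintype κ] [Fintype μ] {A : Matrix ι κ R}
    {B : Matrix κ μ R} (h : ∀ x, act A R (act B R x) = 0) {N : Type*} [AddCommGroup N]
    [Module R N] (φ : ι → N) : act B.transpose N (act A.transpose N φ) = 0 := by
  classical
  have hAB : A * B = 0 := by
    ext i k
    have := congrFun (h (Pi.single k 1)) i
    simpa [act_apply, Pi.single_apply, Matrix.mul_apply] using this
  ext k
  simp only [act_apply, Finset.smul_sum, Matrix.transpose_apply, smul_smul]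
  rw [Finset.sum_comm]
  refine Finset.sum_eq_zero fun i _ => ?_
  rw [← Finset.sum_smul]
  have : ∑ j, B j k * A i j = (A * B) i k := by
    simp [Matrix.mul_apply, mul_comm]
  rw [this, hAB]; simp

lemma FreeRes.δ_comp (F : FreeRes R M) (N : Type*) [AddCommGroup N] [Module R N] (n : ℕ)
    (φ : Fin (F.c n) → N) : F.δ N (n + 1) (F.δ N n φ) = 0 :=
  act_transpose_comp (fun x => (F.exact_succ n).apply_apply_eq_zero x) φ

lemma FreeRes.extMod_succ_equiv (F : FreeRes R M) (N : Type u) [AddCommGroup N] [Module R N]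
    (n : ℕ) : Nonempty (extMod R (n + 1) M N ≃ₗ[R] MidHom (F.δ N n) (F.δ N (n + 1))) := by
  obtain ⟨e⟩ := _root_.extMod_succ_equiv R (fun n => Fin (F.c n) → R) (fun n => act (F.A n) R) M
    (Fintype.linearCombination R F.e) N F.exact_succ F.exact_zero F.surj n
  let E : ∀ m, ((Fin (F.c m) → R) →ₗ[R] N) ≃ₗ[R] (Fin (F.c m) → N) := fun m =>
    ((Pi.basisFun R (Fin (F.c m))).constr R).symm
  have hE : ∀ m φ k, E m φ k = φ (Pi.single k 1) := fun m φ k => by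
    simp [E, Module.Basis.constr]
  have key : ∀ m φ, E (m+1) (LinearMap.lcomp R N (act (F.A m) R) φ) = F.δ N m (E m φ) := by
    intro m φ
    ext k
    have : act (F.A m) R (Pi.single k 1) = ∑ j, F.A m j k • Pi.single j 1 := by
      ext i
      simp [act_apply, Pi.single_apply, Finset.sum_apply]
    simp only [hE, LinearMap.lcomp_apply, this, map_sum, map_smul, act_apply, Matrix.transpose_apply]
  obtain ⟨e'⟩ := MidHom.congr _ _ (F.δ N n) (F.δ N (n+1)) (E n) (E (n+1)) (E (n+2)) (key n) (key (n+1))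
  exact ⟨e.trans e'⟩

/-- Vanishing of Ext over a flat extension. -/
lemma extMod_succ_subsingleton_baseChange [IsNoetherianRing R] [Module.Finite R M]
    {N N' : Type u} [AddCommGroup N] [Module R N] [AddCommGroup N'] [Module R N'] [Module S N']
    [IsScalarTower R S N'] {i : M →ₗ[R] M'} (hi : IsBaseChange S i) {j : N →ₗ[R] N'}
    (hj : IsBaseChange S j) (n : ℕ) (h : Subsingleton (extMod R (n + 1) M N)) :
    Subsingleton (extMod S (n + 1) M' N') := by
  obtain ⟨F⟩ := FreeRes.nonempty (R := R) (M := M)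
  obtain ⟨e⟩ := F.extMod_succ_equiv N n
  obtain ⟨e'⟩ := (F.baseChange hi).extMod_succ_equiv N' n
  have h1 := e.symm.toEquiv.subsingleton
  refine e'.toEquiv.subsingleton_congr.2 ?_
  rw [MidHom.subsingleton_iff] at h1 ⊢
  have h2 : Function.Exact (F.δ N n) (F.δ N (n + 1)) := fun x => ⟨fun hx => h1 x hx, by
    rintro ⟨y, rfl⟩
    exact F.δ_comp N n y⟩
  exact fun x hx => (exact_act_map hj h2 x).1 hx
end

section MidHom
variable {Λ : Type*} [CommRing Λ] {A B C A' B' C' : Type*} [AddCommGroup A] [AddCommGroup B]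
    [AddCommGroup C] [Module Λ A] [Module Λ B] [Module Λ C] [AddCommGroup A'] [AddCommGroup B']
    [AddCommGroup C'] [Module Λ A'] [Module Λ B'] [Module Λ C']
    {f : A →ₗ[Λ] B} {g : B →ₗ[Λ] C} {f' : A' →ₗ[Λ] B'} {g' : B' →ₗ[Λ] C'}

/-- The class of a cocycle. -/
def MidHom.mk (f : A →ₗ[Λ] B) (g : B →ₗ[Λ] C) (b : B) (hb : g b = 0) : MidHom f g :=
  Submodule.Quotient.mk ⟨b, hb⟩

lemma MidHom.exists_mk (x : MidHom f g) : ∃ b hb, MidHom.mk f g b hb = x := by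
  obtain ⟨⟨b, hb⟩, rfl⟩ := Submodule.Quotient.mk_surjective _ x
  exact ⟨b, hb, rfl⟩

lemma MidHom.mk_eq_zero {b : B} {hb : g b = 0} : MidHom.mk f g b hb = 0 ↔ ∃ a, f a = b := by
  unfold MidHom.mk
  rw [Submodule.Quotient.mk_eq_zero]; rfl

lemma MidHom.mk_sub {b c : B} (hb : g b = 0) (hc : g c = 0) :
    MidHom.mk f g b hb - MidHom.mk f g c hc =
      MidHom.mk f g (b - c) (by rw [map_sub, hb, hc, sub_zero]) := rfl

lemma MidHom.mk_eq_mk {b c : B} {hb : g b = 0} {hc : g c = 0} :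
    MidHom.mk f g b hb = MidHom.mk f g c hc ↔ ∃ a, f a = b - c := by
  rw [← sub_eq_zero, MidHom.mk_sub, MidHom.mk_eq_zero]

lemma MidHom.smul_mk (r : Λ) {b : B} (hb : g b = 0) :
    r • MidHom.mk f g b hb = MidHom.mk f g (r • b) (by rw [map_smul, hb, smul_zero]) := rfl

/-- Functoriality of the middle cohomology. -/
def MidHom.map (φ : B →ₗ[Λ] B') (h1 : ∀ b, g b = 0 → g' (φ b) = 0)
    (h2 : ∀ a, ∃ a', f' a' = φ (f a)) : MidHom f g →ₗ[Λ] MidHom f' g' :=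
  Submodule.mapQ _ _ (φ.restrict (p := LinearMap.ker g) (q := LinearMap.ker g') h1) (by
    rintro ⟨x, hx⟩ ⟨a, ha⟩
    obtain ⟨a', ha'⟩ := h2 a
    refine ⟨a', ?_⟩
    rw [ha', ha]; rfl)

lemma MidHom.map_mk (φ : B →ₗ[Λ] B') (h1 : ∀ b, g b = 0 → g' (φ b) = 0)
    (h2 : ∀ a, ∃ a', f' a' = φ (f a)) (b : B) (hb : g b = 0) :
    MidHom.map φ h1 h2 (MidHom.mk f g b hb) = MidHom.mk f' g' (φ b) (h1 b hb) := rfl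

end MidHom

lemma length_ker_add_range (K : Type*) {Λ V W : Type*} [CommRing K] [CommRing Λ] [Algebra K Λ]
    [AddCommGroup V] [AddCommGroup W] [Module Λ V] [Module Λ W] [Module K V] [Module K W]
    [IsScalarTower K Λ V] [IsScalarTower K Λ W] (φ : V →ₗ[Λ] W) :
    Module.length K (LinearMap.ker φ) + Module.length K (LinearMap.range φ) =
      Module.length K V := by
  rw [Module.length_eq_add_of_exact ((LinearMap.ker φ).subtype.restrictScalars K)
    (φ.rangeRestrict.restrictScalars K) (Submodule.subtype_injective _)
    φ.surjective_rangeRestrict]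
  change Function.Exact (LinearMap.ker φ).subtype φ.rangeRestrict
  rw [LinearMap.exact_iff, LinearMap.ker_rangeRestrict, Submodule.range_subtype]

section Tot
variable {Λ : Type*} [CommRing Λ] {E : ℕ → Type*}
  [∀ n, AddCommGroup (E n)] [∀ n, Module Λ (E n)]
  (δ : ∀ n, E n →ₗ[Λ] E (n + 1)) (τ : ∀ n, E n →ₗ[Λ] E (n + 2))

/-- The differential of the total complex attached to a degree-two self map. -/
def totD (n : ℕ) : E (n + 1) × E n →ₗ[Λ] E (n + 2) × E (n + 1) :=
  LinearMap.prod ((δ (n + 1)).coprod (τ n)) (- (δ n) ∘ₗ LinearMap.snd Λ _ _)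

lemma totD_apply (n : ℕ) (a : E (n + 1)) (b : E n) :
    totD δ τ n (a, b) = (δ (n + 1) a + τ n b, - δ n b) := by
  simp [totD]

/-- The map in cohomology induced by a degree-two self map. -/
def chi (hc : ∀ n x, δ (n + 2) (τ n x) = τ (n + 1) (δ n x)) (n : ℕ) :
    MidHom (δ n) (δ (n + 1)) →ₗ[Λ] MidHom (δ (n + 2)) (δ (n + 3)) :=
  MidHom.map (τ (n + 1)) (fun b hb => by rw [hc, hb, map_zero])
    (fun a => ⟨τ n a, by rw [hc]⟩)

lemma length_tot (K : Type*) [CommRing K] [Algebra K Λ] [∀ n, Module K (E n)]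
    [∀ n, IsScalarTower K Λ (E n)]
    (hc : ∀ n x, δ (n + 2) (τ n x) = τ (n + 1) (δ n x)) (m : ℕ) :
    Module.length K (MidHom (totD δ τ (m + 1)) (totD δ τ (m + 2))) +
      Module.length K (LinearMap.range (chi δ τ hc m)) +
      Module.length K (LinearMap.range (chi δ τ hc (m + 1))) =
    Module.length K (MidHom (δ (m + 2)) (δ (m + 3))) +
      Module.length K (MidHom (δ (m + 1)) (δ (m + 2))) := by
  let α : MidHom (δ (m + 2)) (δ (m + 3)) →ₗ[Λ] MidHom (totD δ τ (m + 1)) (totD δ τ (m + 2)) :=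
    MidHom.map (LinearMap.inl Λ _ _)
      (fun b hb => by simp [totD_apply, hb])
      (fun a => ⟨(a, 0), by simp [totD_apply]⟩)
  let β : MidHom (totD δ τ (m + 1)) (totD δ τ (m + 2)) →ₗ[Λ] MidHom (δ (m + 1)) (δ (m + 2)) :=
    MidHom.map (LinearMap.snd Λ _ _)
      (fun b hb => by
        obtain ⟨a, b⟩ := b
        rw [totD_apply, Prod.mk_eq_zero, neg_eq_zero] at hb
        exact hb.2)
      (fun a => ⟨-a.2, by
        obtain ⟨a, b⟩ := a
        simp [totD_apply]⟩)
  have h1 : LinearMap.range β = LinearMap.ker (chi δ τ hc (m + 1)) := by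
    ext x
    obtain ⟨b, hb, rfl⟩ := x.exists_mk
    rw [LinearMap.mem_ker, chi, MidHom.map_mk, MidHom.mk_eq_zero]
    constructor
    · rintro ⟨y, hy⟩
      obtain ⟨⟨a, b'⟩, hy', rfl⟩ := y.exists_mk
      have hz := hy'
      rw [totD_apply, Prod.mk_eq_zero] at hz
      change MidHom.mk _ _ b' _ = _ at hy
      obtain ⟨w, hw⟩ := MidHom.mk_eq_mk.1 hy
      refine ⟨-a - τ (m + 1) w, ?_⟩
      rw [map_sub, map_neg, hc, hw, map_sub, eq_neg_of_add_eq_zero_left hz.1]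
      abel
    · rintro ⟨a, ha⟩
      refine ⟨MidHom.mk _ _ (-a, b) ?_, rfl⟩
      rw [totD_apply, hb, map_neg, ha]
      simp
  have h2 : LinearMap.range α = LinearMap.ker β := by
    ext x
    obtain ⟨⟨a, b⟩, hb, rfl⟩ := x.exists_mk
    rw [totD_apply, Prod.mk_eq_zero, neg_eq_zero] at hb
    refine Iff.trans ?_ (MidHom.mk_eq_zero (hb := hb.2)).symm
    constructor
    · rintro ⟨y, hy⟩
      obtain ⟨c, hc', rfl⟩ := y.exists_mk
      change MidHom.mk _ _ (c, 0) _ = _ at hy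
      obtain ⟨⟨u, v⟩, hw⟩ := MidHom.mk_eq_mk.1 hy
      rw [totD_apply, Prod.mk_sub_mk, Prod.mk.injEq] at hw
      refine ⟨v, ?_⟩
      have := hw.2
      rw [zero_sub, neg_inj] at this
      exact this
    · rintro ⟨v, rfl⟩
      refine ⟨MidHom.mk _ _ (a + τ _ v) ?_, ?_⟩
      · rw [map_add, hc]; exact hb.1
      · change MidHom.mk _ _ (_, 0) _ = _
        refine MidHom.mk_eq_mk.2 ⟨(0, v), ?_⟩
        simp [totD_apply]
  have h3 : LinearMap.ker α = LinearMap.range (chi δ τ hc m) := by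
    ext x
    obtain ⟨b, hb, rfl⟩ := x.exists_mk
    have hb' : totD δ τ (m + 2) (b, 0) = 0 := by simp [totD_apply, hb]
    refine Iff.trans (MidHom.mk_eq_zero (hb := hb')) ?_
    constructor
    · rintro ⟨⟨u, v⟩, hw⟩
      rw [totD_apply, Prod.mk.injEq, neg_eq_zero] at hw
      refine ⟨MidHom.mk _ _ v hw.2, ?_⟩
      change MidHom.mk _ _ (τ _ v) _ = _
      refine MidHom.mk_eq_mk.2 ⟨-u, ?_⟩
      rw [map_neg, ← hw.1]; abel
    · rintro ⟨y, hy⟩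
      obtain ⟨v, hv, rfl⟩ := y.exists_mk
      change MidHom.mk _ _ (τ _ v) _ = _ at hy
      obtain ⟨w, hw⟩ := MidHom.mk_eq_mk.1 hy
      refine ⟨(-w, v), ?_⟩
      rw [totD_apply, map_neg, hw, hv]
      simp
  have e1 := length_ker_add_range K β
  have e2 := length_ker_add_range K α
  have e3 := length_ker_add_range K (chi δ τ hc (m + 1))
  rw [h3] at e2
  rw [← h1] at e3
  rw [h2] at e2
  rw [← e1, ← e2, ← e3]
  abel
end Tot

section
variable {Λ : Type*} [CommRing Λ] {A B C : Type*} [AddCommGroup A]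
    [AddCommGroup B] [AddCommGroup C] [Module Λ A] [Module Λ B] [Module Λ C]

lemma MidHom.equiv_ker {f : A →ₗ[Λ] B} (g : B →ₗ[Λ] C) (hf : f = 0) :
    Nonempty (MidHom f g ≃ₗ[Λ] LinearMap.ker g) := by
  refine ⟨Submodule.quotEquivOfEqBot _ ?_⟩
  subst hf
  rw [LinearMap.range_zero, Submodule.comap_bot, Submodule.ker_subtype]

end

section
variable (R : Type u) [CommRing R] (P : ℕ → Type u) [∀ n, AddCommGroup (P n)]
  [∀ n, Module R (P n)]
  (d : ∀ n, P (n + 1) →ₗ[R] P n) (M : Type u) [AddCommGroup M] [Module R M] (ε : P 0 →ₗ[R] M)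

lemma ker_equiv_of_comm {A B A' B' : Type*} [AddCommGroup A]
    [AddCommGroup B] [AddCommGroup A'] [AddCommGroup B'] [Module R A] [Module R B] [Module R A']
    [Module R B'] (g : A →ₗ[R] B) (g' : A' →ₗ[R] B') (e : A ≃ₗ[R] A') (e' : B ≃ₗ[R] B')
    (h : ∀ x, e' (g x) = g' (e x)) :
    Nonempty (LinearMap.ker g ≃ₗ[R] LinearMap.ker g') := by
  refine ⟨e.ofSubmodules _ _ ?_⟩
  ext y
  obtain ⟨x, rfl⟩ := e.surjective y
  simp [← h]

/-- Degree-zero Ext computed by an exact sequence of projectives. -/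
lemma extMod_zero_equiv [∀ n, Module.Projective R (P n)] (N : Type u) [AddCommGroup N] [Module R N]
    (h : ∀ n, Function.Exact (d (n + 1)) (d n)) (h0 : Function.Exact (d 0) ε)
    (hε : Function.Surjective ε) :
    Nonempty (extMod R 0 M N ≃ₗ[R] LinearMap.ker (LinearMap.lcomp R N (d 0))) := by
  let PR := projRes R P d M ε h h0 hε
  let K := PR.complex.linearYonedaObj R (ModuleCat.of R N)
  have e1 : extMod R 0 M N ≅ K.homology 0 := PR.isoExt 0 (ModuleCat.of R N)
  have e2 : K.homology 0 ≅ (K.sc' 0 0 1).homology :=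
    ShortComplex.homologyMapIso (K.isoSc' 0 0 1 (by simp) (by simp))
  obtain ⟨e3⟩ := homology_equiv_midHom (K.sc' 0 0 1)
  have hf : (K.sc' 0 0 1).f.hom = 0 := by
    have : K.d 0 0 = 0 := K.shape _ _ (by simp)
    change (K.d 0 0).hom = 0
    rw [this]; rfl
  obtain ⟨e4⟩ := MidHom.equiv_ker (K.sc' 0 0 1).g.hom hf
  have hd' : ∀ m, PR.complex.d (m+1) m = ModuleCat.ofHom (d m) := fun m => resComplex_d R P d h m
  let e5 : ∀ m, (PR.complex.X m ⟶ ModuleCat.of R N) ≃ₗ[R] (P m →ₗ[R] N) := fun m =>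
    ModuleCat.homLinearEquiv (S := R) (M := ModuleCat.of R (P m)) (N := ModuleCat.of R N)
  have key : ∀ m, ∀ x : (PR.complex.X m ⟶ ModuleCat.of R N),
      e5 (m+1) (PR.complex.d (m+1) m ≫ x) = LinearMap.lcomp R N (d m) (e5 m x) := by
    intro m x
    rw [hd']
    rfl
  obtain ⟨e6⟩ := ker_equiv_of_comm R (K.sc' 0 0 1).g.hom (LinearMap.lcomp R N (d 0)) (e5 0) (e5 1)
    (fun x => key 0 x)
  exact ⟨(e1 ≪≫ e2).toLinearEquiv.trans (e3.trans (e4.trans e6))⟩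

lemma extMod_zero_equiv_hom [IsNoetherianRing R] [Module.Finite R M] (N : Type u) [AddCommGroup N]
    [Module R N] : Nonempty (extMod R 0 M N ≃ₗ[R] (M →ₗ[R] N)) := by
  obtain ⟨F⟩ := FreeRes.nonempty (R := R) (M := M)
  obtain ⟨e⟩ := extMod_zero_equiv R (fun n => Fin (F.c n) → R) (fun n => act (F.A n) R) M
    (Fintype.linearCombination R F.e) N F.exact_succ F.exact_zero F.surj
  have hinj : Function.Injective (LinearMap.lcomp R N (Fintype.linearCombination R F.e)) := by
    intro x y hxy
    ext m
    obtain ⟨m, rfl⟩ := F.surj m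
    exact LinearMap.congr_fun hxy m
  have hr : LinearMap.ker (LinearMap.lcomp R N (act (F.A 0) R)) =
      LinearMap.range (LinearMap.lcomp R N (Fintype.linearCombination R F.e)) := by
    ext φ
    rw [LinearMap.mem_ker, LinearMap.mem_range]
    constructor
    · intro h
      have hle : LinearMap.ker (Fintype.linearCombination R F.e) ≤ LinearMap.ker φ := by
        intro x hx
        obtain ⟨y, rfl⟩ := (F.exact_zero x).1 hx
        exact LinearMap.congr_fun h y
      let g := (LinearMap.ker (Fintype.linearCombination R F.e)).liftQ φ hle
      let q := (LinearMap.quotKerEquivOfSurjective _ F.surj)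
      refine ⟨g ∘ₗ q.symm.toLinearMap, ?_⟩
      apply LinearMap.ext
      intro x
      simp only [LinearMap.lcomp_apply, LinearMap.comp_apply, LinearEquiv.coe_coe]
      have : q.symm (Fintype.linearCombination R F.e x) = Submodule.Quotient.mk x := by
        rw [LinearEquiv.symm_apply_eq]; rfl
      rw [this]; rfl
    · rintro ⟨ψ, rfl⟩
      apply LinearMap.ext
      intro x
      change ψ (Fintype.linearCombination R F.e (act (F.A 0) R x)) = 0
      rw [F.exact_zero.apply_apply_eq_zero x, map_zero]
  exact ⟨e.trans ((LinearEquiv.ofEq _ _ hr).trans (LinearEquiv.ofInjective _ hinj).symm)⟩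
end

section
variable {R : Type u} [CommRing R]

/-- Coordinates of a linear map out of a finite free module. -/
noncomputable def homPi (n : ℕ) (N : Type*) [AddCommGroup N] [Module R N] :
    ((Fin n → R) →ₗ[R] N) ≃ₗ[R] (Fin n → N) :=
  ((Pi.basisFun R (Fin n)).constr R).symm

lemma homPi_apply {n : ℕ} {N : Type*} [AddCommGroup N] [Module R N] (φ : (Fin n → R) →ₗ[R] N)
    (k : Fin n) : homPi n N φ k = φ (Pi.single k 1) := by
  simp [homPi, Module.Basis.constr]

lemma act_single {m n : ℕ} (A : Matrix (Fin m) (Fin n) R) (k : Fin n) :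
    act A R (Pi.single k 1) = ∑ j, A j k • Pi.single j 1 := by
  ext i
  simp [act_apply, Pi.single_apply, Finset.sum_apply]

lemma homPi_comp {m n : ℕ} {N : Type*} [AddCommGroup N] [Module R N] (A : Matrix (Fin m) (Fin n) R)
    (φ : (Fin m → R) →ₗ[R] N) : homPi n N (φ ∘ₗ act A R) = act A.transpose N (homPi m N φ) := by
  ext k
  simp only [homPi_apply, LinearMap.comp_apply, act_single, map_sum, map_smul, act_apply,
    Matrix.transpose_apply]

/-- Shift of a sequence of ranks by one step. -/
def padC (c : ℕ → ℕ) : ℕ → ℕ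
  | 0 => 0
  | n + 1 => c n

/-- Shift of a sequence of matrices by one step. -/
def padA {c : ℕ → ℕ} (A : ∀ n, Matrix (Fin (c n)) (Fin (c (n + 1))) R) :
    ∀ n, Matrix (Fin (padC c n)) (Fin (padC c (n + 1))) R
  | 0 => 0
  | n + 1 => A n

/-- The cochain map attached to a sequence of matrices. -/
abbrev mδ {c : ℕ → ℕ} (A : ∀ n, Matrix (Fin (c n)) (Fin (c (n + 1))) R) (N : Type*)
    [AddCommGroup N] [Module R N] (n : ℕ) :
    (Fin (c n) → N) →ₗ[R] (Fin (c (n + 1)) → N) := act (A n).transpose N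

variable {M : Type u} [AddCommGroup M] [Module R M]

lemma FreeRes.extMod_equiv_pad (F : FreeRes R M) (N : Type u) [AddCommGroup N] [Module R N]
    (j : ℕ) : Nonempty (extMod R j M N ≃ₗ[R]
      MidHom (mδ (padA F.A) N j) (mδ (padA F.A) N (j + 1))) := by
  cases j with
  | zero =>
    obtain ⟨e⟩ := extMod_zero_equiv R (fun n => Fin (F.c n) → R) (fun n => act (F.A n) R) M
      (Fintype.linearCombination R F.e) N F.exact_succ F.exact_zero F.surj
    obtain ⟨e'⟩ := ker_equiv_of_comm R (LinearMap.lcomp R N (act (F.A 0) R)) (F.δ N 0)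
      (homPi _ N) (homPi _ N) (fun x => homPi_comp _ _)
    obtain ⟨e''⟩ := MidHom.equiv_ker (f := mδ (padA F.A) N 0) (mδ (padA F.A) N 1) (by
      apply LinearMap.ext
      intro x
      ext k
      simp only [act_apply, LinearMap.zero_apply, Pi.zero_apply]
      exact Finset.sum_eq_zero fun i _ => i.elim0)
    exact ⟨(e.trans e').trans e''.symm⟩
  | succ j => exact F.extMod_succ_equiv N j
end

section
variable {R : Type*} [CommRing R] {ι κ μ : Type*} [Fintype ι] [Fintype κ] [Fintype μ]
  {N : Type*} [AddCommGroup N] [Module R N]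

lemma act_mul (A : Matrix ι κ R) (B : Matrix κ μ R) (x : μ → N) :
    act (A * B) N x = act A N (act B N x) := by
  ext i
  simp only [act_apply, Matrix.mul_apply, Finset.smul_sum, Finset.sum_smul, smul_smul]
  exact Finset.sum_comm

lemma act_smul (r : R) (A : Matrix ι κ R) (x : κ → N) : act (r • A) N x = r • act A N x := by
  ext i
  simp [act_apply, Finset.smul_sum, mul_smul]

lemma act_neg (A : Matrix ι κ R) (x : κ → N) : act (-A) N x = - act A N x := by
  ext i
  simp [act_apply]

lemma act_map_same {S : Type*} [CommRing S] [Algebra S R] [Module S N] [IsScalarTower S R N]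
    (A : Matrix ι κ S) (x : κ → N) : act (A.map (algebraMap S R)) N x = act A N x := by
  ext i
  simp [act_apply]

lemma act_map_algebraMap {S : Type*} [CommRing S] [Algebra S R] (A : Matrix ι κ S) (z : κ → S) :
    act (A.map (algebraMap S R)) R (fun i => algebraMap S R (z i)) =
      fun i => algebraMap S R (act A S z i) := by
  ext i
  simp [act_apply]

lemma matrix_mul_eq_zero_of_act {A : Matrix ι κ R} {B : Matrix κ μ R}
    (h : ∀ x, act A R (act B R x) = 0) : A * B = 0 := by
  classical
  ext i k
  have := congrFun (h (Pi.single k 1)) i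
  simpa [act_apply, Pi.single_apply, Matrix.mul_apply] using this

lemma act_zero (x : κ → N) : act (0 : Matrix ι κ R) N x = 0 := by
  ext i
  simp [act_apply]
end

section
variable {S R : Type*} [CommRing S] [CommRing R] [Algebra S R] {f : S}
  (hs : Function.Surjective (algebraMap S R)) (hk : ∀ s, algebraMap S R s = 0 ↔ f ∣ s)

include hs in
lemma exists_lift_matrix {ι κ : Type*} (A : Matrix ι κ R) :
    ∃ B : Matrix ι κ S, B.map (algebraMap S R) = A := by
  choose g hg using hs
  exact ⟨A.map g, by ext; simp [hg]⟩

include hk in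
lemma exists_eq_smul_of_map_zero {ι κ : Type*} (A : Matrix ι κ S)
    (h : A.map (algebraMap S R) = 0) : ∃ B : Matrix ι κ S, A = f • B := by
  have : ∀ i j, ∃ b, A i j = f * b := fun i j => (hk _).1 (congrFun (congrFun h i) j)
  choose g hg using this
  exact ⟨Matrix.of g, by ext; simp [hg]⟩

include hs hk in
lemma exists_lift_of_exact {a b : ℕ} (At : Matrix (Fin a) (Fin b) S) {X : Type*} [AddCommGroup X]
    [Module R X] (g : (Fin a → R) →ₗ[R] X)
    (hex : Function.Exact (act (At.map (algebraMap S R)) R) g) (x : Fin a → S)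
    (hx : g (fun i => algebraMap S R (x i)) = 0) : ∃ z w, x = act At S z + f • w := by
  obtain ⟨z, hz⟩ := (hex _).1 hx
  choose l hl using hs
  have : ∀ i, ∃ b, x i - act At S (fun j => l (z j)) i = f * b := by
    intro i
    rw [← dvd_def, ← hk, map_sub, ← congrFun hz i, sub_eq_zero]
    simp [act_apply, hl]
  choose w hw using this
  refine ⟨fun j => l (z j), w, ?_⟩
  ext i
  rw [Pi.add_apply, Pi.smul_apply, smul_eq_mul, ← hw]
  ring
end

section
variable {S R : Type u} [CommRing S] [CommRing R] [Algebra S R] {f : S}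

/-- A free resolution over `S / f` yields one over `S`; its cochain complex is a total complex. -/
lemma exists_totD_aux (hs : Function.Surjective (algebraMap S R))
    (hk : ∀ s, algebraMap S R s = 0 ↔ f ∣ s) (hf : f ∈ nonZeroDivisors S) {M : Type u}
    [AddCommGroup M] [Module S M] [Module R M] [IsScalarTower S R M]
    (c : ℕ → ℕ) (A : ∀ n, Matrix (Fin (c n)) (Fin (c (n + 1))) R)
    (hAA : ∀ n, A n * A (n + 1) = 0) (c1 : c 1 = 0) (c2 : c 2 = 0) (v : Fin (c 3) → M)
    (hsurj : Function.Surjective (Fintype.linearCombination R v))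
    (hF0 : Function.Exact (act (A 3) R) (Fintype.linearCombination R v))
    (hF : ∀ n, Function.Exact (act (A (n + 4)) R) (act (A (n + 3)) R)) :
    ∃ (δ : ∀ n, (Fin (c n) → M) →ₗ[S] (Fin (c (n + 1)) → M))
      (τ : ∀ n, (Fin (c n) → M) →ₗ[S] (Fin (c (n + 2)) → M)),
      (∀ n x, δ n x = mδ A M n x) ∧
      (∀ n x, δ (n + 2) (τ n x) = τ (n + 1) (δ n x)) ∧
      ∀ j, Nonempty (extMod S j M M ≃ₗ[S] MidHom (totD δ τ (j + 1)) (totD δ τ (j + 2))) := by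
  have hf0 : ∀ x : S, f * x = 0 → x = 0 := fun x hx => by
    rw [mul_comm] at hx
    exact (mem_nonZeroDivisors_iff.1 hf).2 _ hx
  have c1' : IsEmpty (Fin (c 1)) := by rw [c1]; infer_instance
  have c2' : IsEmpty (Fin (c 2)) := by rw [c2]; infer_instance
  choose At hAt using fun n => exists_lift_matrix hs (A n)
  choose B hB using fun n => exists_eq_smul_of_map_zero hk (At n * At (n + 1)) (by
    rw [Matrix.map_mul, hAt, hAt, hAA])
  have hcan : ∀ {a b : ℕ} (X Y : Matrix (Fin a) (Fin b) S), f • X = f • Y → X = Y := by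
    intro a b X Y h
    ext i j
    have := congrFun (congrFun h i) j
    rw [← sub_eq_zero]
    refine hf0 _ ?_
    simp only [Matrix.smul_apply, smul_eq_mul] at this
    rw [mul_sub, this, sub_self]
  have hcom : ∀ n, At n * B (n + 1) = B n * At (n + 2) := fun n => hcan _ _ (by
    rw [← Matrix.mul_smul, ← hB, ← Matrix.smul_mul, ← hB, Matrix.mul_assoc])
  let δ : ∀ n, (Fin (c n) → M) →ₗ[S] (Fin (c (n + 1)) → M) := fun n => act (At n).transpose M
  let τ : ∀ n, (Fin (c n) → M) →ₗ[S] (Fin (c (n + 2)) → M) := fun n => act (-B n).transpose M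
  refine ⟨δ, τ, fun n x => ?_, fun n x => ?_, ?_⟩
  · change _ = act (A n).transpose M x
    rw [← hAt, ← Matrix.transpose_map, act_map_same]
  · change act _ M (act _ M x) = act _ M (act _ M x)
    rw [← act_mul, ← act_mul, ← Matrix.transpose_mul, ← Matrix.transpose_mul, Matrix.neg_mul,
      Matrix.mul_neg, hcom]
  let P : ℕ → Type u := fun n => (Fin (c (n + 3)) → S) × (Fin (c (n + 2)) → S)
  let d : ∀ n, P (n + 1) →ₗ[S] P n := fun n => LinearMap.prod
    ((act (At (n + 3)) S).coprod (f • LinearMap.id))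
    ((act (-B (n + 2)) S).coprod (-act (At (n + 2)) S))
  have hd : ∀ n x y, d n (x, y) = (act (At (n + 3)) S x + f • y,
      - act (B (n + 2)) S x - act (At (n + 2)) S y) := fun n x y => by
    change (act (At (n + 3)) S x + f • y, act (-B (n + 2)) S x + (-act (At (n + 2)) S) y) = _
    rw [act_neg, LinearMap.neg_apply, sub_eq_add_neg]
  let ε : P 0 →ₗ[S] M := (Fintype.linearCombination S v) ∘ₗ
    LinearMap.fst S (Fin (c 3) → S) (Fin (c 2) → S)
  have hεeq : ∀ x : Fin (c 3) → S, ∀ y : Fin (c 2) → S, ε (x, y) =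
      Fintype.linearCombination R v (fun i => algebraMap S R (x i)) := fun x y => by
    change Fintype.linearCombination S v x = _
    simp [Fintype.linearCombination_apply]
  have hε : Function.Surjective ε := by
    intro m
    obtain ⟨x, rfl⟩ := hsurj m
    choose l hl using hs
    refine ⟨(fun i => l (x i), 0), ?_⟩
    rw [hεeq]
    simp [hl]
  have hlift : ∀ n (x : Fin (c (n + 4)) → S) y, act (At (n + 3)) S x = f • y →
      ∃ z w, x = act (At (n + 4)) S z + f • w := by
    intro n x y hxy
    refine exists_lift_of_exact hs hk (At (n + 4)) (act (A (n + 3)) R) ?_ x ?_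
    · rw [hAt]
      exact hF n
    · rw [← hAt (n + 3), act_map_algebraMap, hxy]
      ext i
      rw [Pi.smul_apply, smul_eq_mul, (hk _).2 (dvd_mul_right f _)]
      rfl
  have hlift0 : ∀ (x : Fin (c 3) → S) y, ε (x, y) = 0 →
      ∃ z w, x = act (At 3) S z + f • w := by
    intro x y hxy
    rw [hεeq] at hxy
    refine exists_lift_of_exact hs hk (At 3) (Fintype.linearCombination R v) ?_ x hxy
    rw [hAt]
    exact hF0
  have hsq : ∀ n {N : Type u} [AddCommGroup N] [Module S N] (x : Fin (c (n + 2)) → N),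
      act (At n) N (act (At (n + 1)) N x) = f • act (B n) N x := fun n {N} _ _ x => by
    rw [← act_mul, hB, act_smul]
  have hcom' : ∀ n (x : Fin (c (n + 3)) → S),
      act (At n) S (act (B (n + 1)) S x) = act (B n) S (act (At (n + 2)) S x) := fun n x => by
    rw [← act_mul, ← act_mul, hcom]
  have hdd : ∀ n x, d n (d (n + 1) x) = 0 := by
    rintro n ⟨x, y⟩
    rw [hd, hd, Prod.mk_eq_zero]
    constructor
    · rw [map_add, hsq, map_smul, smul_sub, smul_neg]
      abel
    · rw [map_add, map_sub, map_neg, hcom', hsq, map_smul]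
      abel
  have hfy : ∀ {a : ℕ} (y : Fin a → S), f • y = 0 → y = 0 := fun y hy => by
    ext i
    exact hf0 _ (congrFun hy i)
  have hex : ∀ n, Function.Exact (d (n + 1)) (d n) := by
    rintro n ⟨x, y⟩
    refine ⟨fun h => ?_, ?_⟩
    · have h' := h
      rw [hd, Prod.mk_eq_zero] at h'
      obtain ⟨z, w, hzw⟩ := hlift n x (-y) (by
        rw [smul_neg]; exact eq_neg_of_add_eq_zero_left h'.1)
      have h2 : d n ((x, y) - d (n + 1) (z, w)) = 0 := by rw [map_sub, h, hdd, sub_zero]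
      rw [hd (n + 1), Prod.mk_sub_mk, ← hzw, sub_self, hd, map_zero, zero_add,
        Prod.mk_eq_zero] at h2
      have h3 := hfy _ h2.1
      refine ⟨(z, w), ?_⟩
      rw [hd, ← hzw, eq_comm, Prod.mk.injEq]
      exact ⟨rfl, sub_eq_zero.1 h3⟩
    · rintro ⟨z, hz⟩
      rw [← hz, hdd]
  have hex0 : Function.Exact (d 0) ε := by
    rintro ⟨x, y⟩
    refine ⟨fun h => ?_, ?_⟩
    · obtain ⟨z, w, hzw⟩ := hlift0 x y h
      refine ⟨(z, w), ?_⟩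
      rw [hd, ← hzw, Prod.mk.injEq]
      exact ⟨rfl, funext fun j => c2'.elim j⟩
    · rintro ⟨⟨z, w⟩, hz⟩
      rw [← hz, hd, hεeq]
      have h1 : (fun i => algebraMap S R ((act (At 3) S z + f • w) i)) =
          act (A 3) R (fun i => algebraMap S R (z i)) := by
        rw [← hAt 3, act_map_algebraMap]
        ext i
        rw [Pi.add_apply, map_add, Pi.smul_apply, smul_eq_mul, (hk _).2 (dvd_mul_right f _),
          add_zero]
      exact (congrArg _ h1).trans (hF0.apply_apply_eq_zero _)
  have hfM : ∀ m : M, f • m = 0 := fun m => by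
    rw [← algebraMap_smul R f m, (hk f).2 dvd_rfl, zero_smul]
  let e : ∀ n, (P n →ₗ[S] M) ≃ₗ[S] (Fin (c (n + 3)) → M) × (Fin (c (n + 2)) → M) := fun n =>
    (LinearMap.coprodEquiv S).symm.trans (LinearEquiv.prodCongr (homPi _ M) (homPi _ M))
  have he : ∀ n φ, e n φ =
      (homPi _ M (φ ∘ₗ LinearMap.inl S _ _), homPi _ M (φ ∘ₗ LinearMap.inr S _ _)) :=
    fun n φ => rfl
  have key : ∀ n φ, e (n + 1) (LinearMap.lcomp S M (d n) φ) = totD δ τ (n + 2) (e n φ) := by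
    intro n φ
    rw [he, he, totD_apply, Prod.mk.injEq]
    have h1 : (LinearMap.lcomp S M (d n) φ) ∘ₗ LinearMap.inl S _ _ =
        (φ ∘ₗ LinearMap.inl S _ _) ∘ₗ act (At (n + 3)) S +
        (φ ∘ₗ LinearMap.inr S _ _) ∘ₗ act (-B (n + 2)) S := by
      apply LinearMap.ext
      intro x
      change φ (d n (x, 0)) = φ (act (At (n + 3)) S x, 0) + φ (0, act (-B (n + 2)) S x)
      rw [← map_add, hd, act_neg]
      congr 1
      rw [Prod.mk_add_mk, map_zero, smul_zero, add_zero, zero_add, sub_zero]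
    have h2 : (LinearMap.lcomp S M (d n) φ) ∘ₗ LinearMap.inr S _ _ =
        - ((φ ∘ₗ LinearMap.inr S _ _) ∘ₗ act (At (n + 2)) S) := by
      apply LinearMap.ext
      intro x
      change φ (d n (0, x)) = - φ (0, act (At (n + 2)) S x)
      have : d n (0, x) =
        f • ((x, 0) : P n) - (0, act (At (n + 2)) S x) := by
        rw [hd, map_zero, map_zero, zero_add, neg_zero, Prod.smul_mk, Prod.mk_sub_mk, smul_zero,
          sub_zero]
      rw [this, map_sub, map_smul, hfM, zero_sub]
    rw [h1, h2, map_add, homPi_comp, homPi_comp, map_neg, homPi_comp]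
    exact ⟨rfl, rfl⟩
  intro j
  cases j with
  | zero =>
    obtain ⟨e1⟩ := extMod_zero_equiv S P d M ε M hex hex0 hε
    obtain ⟨e2⟩ := ker_equiv_of_comm S _ (totD δ τ 2) (e 0) (e 1) (key 0)
    obtain ⟨e3⟩ := MidHom.equiv_ker (f := totD δ τ 1) (totD δ τ 2) (by
      apply LinearMap.ext
      rintro ⟨x, y⟩
      have hx : x = 0 := funext fun j => c2'.elim j
      have hy : y = 0 := funext fun j => c1'.elim j
      rw [hx, hy]; exact map_zero _)
    exact ⟨(e1.trans e2).trans e3.symm⟩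
  | succ j =>
    obtain ⟨e1⟩ := _root_.extMod_succ_equiv S P d M ε M hex hex0 hε j
    obtain ⟨e2⟩ := MidHom.congr _ _ (totD δ τ (j + 2)) (totD δ τ (j + 3)) (e j) (e (j + 1))
      (e (j + 2)) (key j) (key (j + 1))
    exact ⟨e1.trans e2⟩

lemma exists_totD_of_hypersurface (hs : Function.Surjective (algebraMap S R))
    (hk : ∀ s, algebraMap S R s = 0 ↔ f ∣ s) (hf : f ∈ nonZeroDivisors S) {M : Type u}
    [AddCommGroup M] [Module S M] [Module R M] [IsScalarTower S R M] (F : FreeRes R M) :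
    ∃ (δ : ∀ n, (Fin (padC (padC (padC F.c)) n) → M) →ₗ[S]
        (Fin (padC (padC (padC F.c)) (n + 1)) → M))
      (τ : ∀ n, (Fin (padC (padC (padC F.c)) n) → M) →ₗ[S]
        (Fin (padC (padC (padC F.c)) (n + 2)) → M)),
      (∀ n x, δ n x = mδ (padA (padA (padA F.A))) M n x) ∧
      (∀ n x, δ (n + 2) (τ n x) = τ (n + 1) (δ n x)) ∧
      ∀ j, Nonempty (extMod S j M M ≃ₗ[S] MidHom (totD δ τ (j + 1)) (totD δ τ (j + 2))) := by
  refine exists_totD_aux hs hk hf (padC (padC (padC F.c))) (padA (padA (padA F.A))) ?_ rfl rfl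
    F.e F.surj F.exact_zero F.exact_succ
  intro n
  match n with
  | 0 => exact Matrix.ext fun i => i.elim0
  | 1 => exact Matrix.ext fun i => i.elim0
  | 2 => exact Matrix.ext fun i => i.elim0
  | n + 3 => exact matrix_mul_eq_zero_of_act (fun x => (F.exact_succ n).apply_apply_eq_zero x)
end

/-- A module has a nonzero element killed by the ideal. -/
def HasSocle {Λ : Type*} [CommRing Λ] (I : Ideal Λ) (H : Type*) [AddCommGroup H] [Module Λ H] :
    Prop := ∃ h : H, h ≠ 0 ∧ ∀ a ∈ I, a • h = 0

section Socle
variable {Λ : Type*} [CommRing Λ] {I : Ideal Λ} {H H' : Type*} [AddCommGroup H] [Module Λ H]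
  [AddCommGroup H'] [Module Λ H']

lemma HasSocle.of_injective (f : H →ₗ[Λ] H') (hf : Function.Injective f) (h : HasSocle I H) :
    HasSocle I H' := by
  obtain ⟨x, hx, hI⟩ := h
  exact ⟨f x, fun h => hx (hf (h.trans (map_zero f).symm)), fun a ha => by
    rw [← map_smul, hI a ha, map_zero]⟩

lemma HasSocle.smul_top_ne_top [Module.Finite Λ H] (h : HasSocle I H) :
    I • (⊤ : Submodule Λ H) ≠ ⊤ := by
  intro htop
  obtain ⟨x, hx, hI⟩ := h
  obtain ⟨r, hr, hr'⟩ := Submodule.exists_sub_one_mem_and_smul_eq_zero_of_fg_of_le_smul I ⊤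
    Module.Finite.fg_top htop.ge
  have h1 := hI _ hr
  rw [sub_smul, one_smul, hr' x trivial, zero_sub, neg_eq_zero] at h1
  exact hx h1

lemma hasSocle_of_smul_top_ne_top [IsNoetherian Λ H] [IsArtinian Λ H]
    (h : I • (⊤ : Submodule Λ H) ≠ ⊤) : HasSocle I H := by
  let f : ℕ →o (Submodule Λ H)ᵒᵈ := ⟨fun n => OrderDual.toDual (I ^ n • ⊤), fun m n hmn =>
    OrderDual.toDual_le_toDual.2 (Submodule.smul_mono_left (Ideal.pow_le_pow_right hmn))⟩
  obtain ⟨n, hn⟩ := IsArtinian.monotone_stabilizes f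
  have hn1 : I ^ n • (⊤ : Submodule Λ H) = I ^ (n + 1) • ⊤ := hn (n + 1) (by omega)
  obtain ⟨r, hr, hr'⟩ := Submodule.exists_sub_one_mem_and_smul_eq_zero_of_fg_of_le_smul I
    (I ^ n • (⊤ : Submodule Λ H)) (IsNoetherian.noetherian _) (by
      rw [← Submodule.mul_smul, ← pow_succ', ← hn1])
  obtain ⟨x, hx⟩ : ∃ x : H, x ∉ I • (⊤ : Submodule Λ H) := by
    by_contra hcon
    push Not at hcon
    exact h (Submodule.eq_top_iff'.2 hcon)
  have hy : r • x ≠ 0 := fun h0 => hx (by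
    have : x = -((r - 1) • x) := by rw [sub_smul, one_smul, h0]; abel
    rw [this]
    exact neg_mem (Submodule.smul_mem_smul hr trivial))
  have hyn : ∀ a ∈ I ^ n, a • (r • x) = 0 := fun a ha => by
    rw [smul_comm]
    exact hr' _ (Submodule.smul_mem_smul ha trivial)
  classical
  have hex : ∃ m, ∀ a ∈ I ^ m, a • (r • x) = 0 := ⟨n, hyn⟩
  obtain ⟨m, hm⟩ : ∃ m, Nat.find hex = m + 1 := by
    refine Nat.exists_eq_succ_of_ne_zero fun h0 => hy ?_
    have := Nat.find_spec hex
    rw [h0] at this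
    simpa using this 1 (by simp)
  have h1 := Nat.find_spec hex
  have h2 := Nat.find_min hex (m := m) (by omega)
  push Not at h2
  obtain ⟨a, ha, ha'⟩ := h2
  refine ⟨a • r • x, ha', fun b hb => ?_⟩
  rw [smul_smul]
  rw [hm] at h1
  exact h1 _ (by rw [pow_succ']; exact Ideal.mul_mem_mul hb ha)

lemma smul_top_ne_top_of_surjective (f : H →ₗ[Λ] H') (hf : Function.Surjective f)
    (h : I • (⊤ : Submodule Λ H') ≠ ⊤) : I • (⊤ : Submodule Λ H) ≠ ⊤ := by
  intro htop
  apply h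
  have := congrArg (Submodule.map f) htop
  rwa [Submodule.map_smul'', Submodule.map_top, LinearMap.range_eq_top.2 hf] at this
end Socle

section Koszul
variable {Λ : Type*} [CommRing Λ] {E E' : ℕ → Type*}
  [∀ n, AddCommGroup (E n)] [∀ n, Module Λ (E n)] [∀ n, AddCommGroup (E' n)]
  [∀ n, Module Λ (E' n)] (δ : ∀ n, E n →ₗ[Λ] E (n + 1)) (δ' : ∀ n, E' n →ₗ[Λ] E' (n + 1))
  (hδ : ∀ n x, δ (n + 1) (δ n x) = 0)
  (i : ∀ n, E' n →ₗ[Λ] E n) (hi : ∀ n, Function.Injective (i n))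
  (hc : ∀ n x, δ n (i n x) = i (n + 1) (δ' n x)) (t : Λ)
  (ht : ∀ n x, t • x = 0 ↔ ∃ y, i n y = x) (hs : ∀ n (x : E n), ∃ y, t • y = x)

/-- The map induced in cohomology by an inclusion of complexes. -/
def kosB (n : ℕ) : MidHom (δ' n) (δ' (n + 1)) →ₗ[Λ] MidHom (δ n) (δ (n + 1)) :=
  MidHom.map (i (n + 1)) (fun b hb => by rw [hc, hb, map_zero]) (fun a => ⟨i n a, hc n a⟩)

include hδ hi ht hs in
lemma range_kosB (n : ℕ) : LinearMap.range (kosB δ δ' i hc n) =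
    LinearMap.ker (LinearMap.lsmul Λ (MidHom (δ n) (δ (n + 1))) t) := by
  ext x
  obtain ⟨y, hy, rfl⟩ := x.exists_mk
  rw [LinearMap.mem_ker, LinearMap.lsmul_apply, MidHom.smul_mk, MidHom.mk_eq_zero]
  constructor
  · rintro ⟨z, hz⟩
    obtain ⟨w, hw, rfl⟩ := z.exists_mk
    change MidHom.mk _ _ (i (n + 1) w) _ = _ at hz
    obtain ⟨a, ha⟩ := MidHom.mk_eq_mk.1 hz
    refine ⟨-(t • a), ?_⟩
    rw [map_neg, map_smul, ha, smul_sub, (ht _ _).2 ⟨w, rfl⟩]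
    abel
  · rintro ⟨z, hz⟩
    obtain ⟨z', rfl⟩ := hs _ z
    rw [map_smul, ← sub_eq_zero, ← smul_sub] at hz
    obtain ⟨w, hw⟩ := (ht _ _).1 hz
    have hw' : y = δ n z' - i (n + 1) w := by rw [hw]; abel
    have hw0 : δ' (n + 1) (-w) = 0 := by
      apply hi
      rw [← hc, map_neg, hw, map_zero, ← neg_sub, neg_neg, map_sub, hy, hδ, sub_zero]
    refine ⟨MidHom.mk _ _ (-w) hw0, ?_⟩
    change MidHom.mk _ _ (i (n + 1) (-w)) _ = _
    refine MidHom.mk_eq_mk.2 ⟨-z', ?_⟩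
    rw [hw', map_neg, map_neg]
    abel

include hδ hi hc ht hs in
lemma quotient_equiv_ker_kosB (n : ℕ) : Nonempty
    ((MidHom (δ n) (δ (n + 1)) ⧸ LinearMap.range
      (LinearMap.lsmul Λ (MidHom (δ n) (δ (n + 1))) t)) ≃ₗ[Λ]
      LinearMap.ker (kosB δ δ' i hc (n + 1))) := by
  let D : Submodule Λ (E (n + 1) × E' (n + 2)) := LinearMap.ker
    ((δ (n + 1)).coprod (-(i (n + 2))))
  have hD (p : D) : δ (n + 1) p.1.1 = i (n + 2) p.1.2 := by
    have := p.2
    rw [LinearMap.mem_ker, LinearMap.coprod_apply, LinearMap.neg_apply, ← sub_eq_add_neg,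
      sub_eq_zero] at this
    exact this
  have hD' (z : E (n + 1)) (w : E' (n + 2)) (h : δ (n + 1) z = i (n + 2) w) : (z, w) ∈ D := by
    rw [LinearMap.mem_ker, LinearMap.coprod_apply, LinearMap.neg_apply, ← sub_eq_add_neg,
      sub_eq_zero]
    exact h
  have hw (p : D) : δ' (n + 2) p.1.2 = 0 := by
    apply hi
    rw [← hc, ← hD, hδ, map_zero]
  have htz (p : D) : δ (n + 1) (t • p.1.1) = 0 := by
    rw [map_smul, hD, (ht _ _).2 ⟨_, rfl⟩]
  have htc (b : E' (n + 2)) : t • i (n + 2) b = 0 := (ht _ _).2 ⟨_, rfl⟩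
  let f1 : D →ₗ[Λ] LinearMap.ker (kosB δ δ' i hc (n + 1)) :=
    { toFun := fun p => ⟨MidHom.mk _ _ p.1.2 (hw p), by
        rw [LinearMap.mem_ker, kosB, MidHom.map_mk, MidHom.mk_eq_zero]
        exact ⟨_, hD p⟩⟩
      map_add' := fun p q => rfl
      map_smul' := fun r p => rfl }
  let f2 : D →ₗ[Λ] MidHom (δ n) (δ (n + 1)) :=
    { toFun := fun p => MidHom.mk _ _ (t • p.1.1) (htz p)
      map_add' := fun p q => by
        refine MidHom.mk_eq_mk.2 ⟨0, ?_⟩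
        simp
      map_smul' := fun r p => by
        rw [RingHom.id_apply, MidHom.smul_mk]
        refine MidHom.mk_eq_mk.2 ⟨0, ?_⟩
        simp [smul_comm r t] }
  let f3 := (Submodule.mkQ (LinearMap.range
      (LinearMap.lsmul Λ (MidHom (δ n) (δ (n + 1))) t))) ∘ₗ f2
  have s1 : Function.Surjective f1 := by
    rintro ⟨x, hx⟩
    obtain ⟨w, hw', rfl⟩ := x.exists_mk
    rw [LinearMap.mem_ker, kosB, MidHom.map_mk, MidHom.mk_eq_zero] at hx
    obtain ⟨z, hz⟩ := hx
    exact ⟨⟨(z, w), hD' z w hz⟩, rfl⟩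
  have s3 : Function.Surjective f3 := by
    refine (Submodule.mkQ_surjective _).comp fun x => ?_
    obtain ⟨y, hy, rfl⟩ := x.exists_mk
    obtain ⟨z, rfl⟩ := hs _ y
    rw [map_smul] at hy
    obtain ⟨w, hw'⟩ := (ht _ _).1 hy
    exact ⟨⟨(z, w), hD' z w hw'.symm⟩, rfl⟩
  have hk : LinearMap.ker f3 = LinearMap.ker f1 := by
    ext p
    rw [LinearMap.mem_ker, LinearMap.mem_ker]
    refine (Submodule.Quotient.mk_eq_zero _).trans ?_
    rw [← Subtype.coe_inj]
    refine Iff.trans ?_ (MidHom.mk_eq_zero (hb := hw p)).symm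
    constructor
    · rintro ⟨y, hy⟩
      obtain ⟨y, hy', rfl⟩ := y.exists_mk
      rw [LinearMap.lsmul_apply, MidHom.smul_mk] at hy
      obtain ⟨a, ha⟩ := MidHom.mk_eq_mk.1 hy
      obtain ⟨b, rfl⟩ := hs _ a
      rw [map_smul, ← smul_sub, ← sub_eq_zero, ← smul_sub] at ha
      obtain ⟨v, hv⟩ := (ht _ _).1 ha
      refine ⟨v, hi _ ?_⟩
      rw [← hc, hv, ← hD, map_sub, map_sub, hδ, hy']
      abel
    · rintro ⟨v, hv⟩
      have h0 : δ (n + 1) (p.1.1 - i (n + 1) v) = 0 := by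
        rw [map_sub, hD, hc, hv, sub_self]
      refine ⟨MidHom.mk _ _ (p.1.1 - i (n + 1) v) h0, ?_⟩
      rw [LinearMap.lsmul_apply, MidHom.smul_mk]
      refine MidHom.mk_eq_mk.2 ⟨0, ?_⟩
      rw [map_zero, smul_sub, (ht _ _).2 ⟨v, rfl⟩]
      abel
  exact ⟨(LinearMap.quotKerEquivOfSurjective f3 s3).symm ≪≫ₗ (Submodule.quotEquivOfEq _ _ hk) ≪≫ₗ
    (LinearMap.quotKerEquivOfSurjective f1 s1)⟩

variable (K : Type*) [CommRing K] [Algebra K Λ] [∀ n, Module K (E n)]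
    [∀ n, IsScalarTower K Λ (E n)] [∀ n, Module K (E' n)] [∀ n, IsScalarTower K Λ (E' n)]

lemma length_ker_lsmul {H : Type*} [AddCommGroup H] [Module Λ H] [Module K H]
    [IsScalarTower K Λ H] (h : Module.length K H ≠ ⊤) :
    Module.length K (H ⧸ LinearMap.range (LinearMap.lsmul Λ H t)) =
      Module.length K (LinearMap.ker (LinearMap.lsmul Λ H t)) := by
  have h1 := length_ker_add_range K (LinearMap.lsmul Λ H t)
  have h2 := length_ker_add_range K (LinearMap.range (LinearMap.lsmul Λ H t)).mkQ
  rw [LinearMap.range_eq_top.2 (Submodule.mkQ_surjective _), Submodule.ker_mkQ,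
    ((Submodule.topEquiv (R := Λ) (M := H ⧸ LinearMap.range (LinearMap.lsmul Λ H t))
      ).restrictScalars K).length_eq, ← h1, add_comm] at h2
  refine WithTop.add_right_cancel (fun (h3 : _ = (⊤ : ℕ∞)) => h ?_) h2
  rw [← h1, h3, add_top]

include hδ hi hc ht hs in
lemma length_kosB (n : ℕ) (h : Module.length K (MidHom (δ n) (δ (n + 1))) ≠ ⊤) :
    Module.length K (MidHom (δ' (n + 1)) (δ' (n + 2))) =
      Module.length K (LinearMap.ker (LinearMap.lsmul Λ (MidHom (δ n) (δ (n + 1))) t)) +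
      Module.length K (LinearMap.ker
        (LinearMap.lsmul Λ (MidHom (δ (n + 1)) (δ (n + 2))) t)) := by
  rw [← length_ker_add_range K (kosB δ δ' i hc (n + 1)),
    range_kosB δ δ' hδ i hi hc t ht hs, ← length_ker_lsmul t K h]
  obtain ⟨e⟩ := quotient_equiv_ker_kosB δ δ' hδ i hi hc t ht hs n
  rw [(e.restrictScalars K).length_eq]

include hδ hi hc ht hs in
lemma length_kos_ne_top [Subsingleton (E' 1)]
    (h : ∀ n, Module.length K (MidHom (δ n) (δ (n + 1))) ≠ ⊤) (n : ℕ) :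
    Module.length K (MidHom (δ' n) (δ' (n + 1))) ≠ ⊤ := by
  cases n with
  | zero =>
    have : Subsingleton (MidHom (δ' 0) (δ' 1)) := by
      rw [MidHom.subsingleton_iff]
      exact fun x _ => ⟨0, Subsingleton.elim _ _⟩
    rw [Module.length_eq_zero]
    exact ENat.zero_ne_top
  | succ n =>
    rw [length_kosB δ δ' hδ i hi hc t ht hs K n (h n)]
    have h1 (n) := length_ker_add_range K (LinearMap.lsmul Λ (MidHom (δ n) (δ (n + 1))) t)
    refine WithTop.add_ne_top.2 ⟨fun (h2 : _ = (⊤ : ℕ∞)) => h n ?_,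
      fun (h2 : _ = (⊤ : ℕ∞)) => h (n + 1) ?_⟩
    · rw [← h1 n, h2, top_add]
    · rw [← h1 (n + 1), h2, top_add]

lemma isNoetherian_isArtinian_of_length {H : Type*} [AddCommGroup H] [Module Λ H] [Module K H]
    [IsScalarTower K Λ H] (h : Module.length K H ≠ ⊤) :
    IsNoetherian Λ H ∧ IsArtinian Λ H := by
  have := isFiniteLength_iff_isNoetherian_isArtinian.1 (Module.length_ne_top_iff.1 h)
  have h1 := this.1
  have h2 := this.2
  exact ⟨isNoetherian_of_tower K h1, isArtinian_of_tower K h2⟩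

variable {I : Ideal Λ} (htI : t ∈ I)

include hδ hi hc ht hs htI in
lemma hasSocle_kos (n : ℕ) (h : Module.length K (MidHom (δ n) (δ (n + 1))) ≠ ⊤)
    (h' : Module.length K (MidHom (δ' n) (δ' (n + 1))) ≠ ⊤)
    (hI : HasSocle I (MidHom (δ n) (δ (n + 1)))) :
    HasSocle I (MidHom (δ' n) (δ' (n + 1))) := by
  obtain ⟨n1, a1⟩ := isNoetherian_isArtinian_of_length (Λ := Λ) K h
  obtain ⟨n2, a2⟩ := isNoetherian_isArtinian_of_length (Λ := Λ) K h'
  apply hasSocle_of_smul_top_ne_top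
  refine smul_top_ne_top_of_surjective (kosB δ δ' i hc n).rangeRestrict
    (kosB δ δ' i hc n).surjective_rangeRestrict (HasSocle.smul_top_ne_top ?_)
  obtain ⟨x, hx, hx'⟩ := hI
  refine ⟨⟨x, ?_⟩, fun h => hx (congrArg Subtype.val h), fun a ha => Subtype.ext (hx' a ha)⟩
  rw [range_kosB δ δ' hδ i hi hc t ht hs]
  exact hx' t htI

include hδ hi hc ht hs htI in
lemma hasSocle_kos_succ (n : ℕ) (h : Module.length K (MidHom (δ n) (δ (n + 1))) ≠ ⊤)
    (hI : HasSocle I (MidHom (δ n) (δ (n + 1)))) :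
    HasSocle I (MidHom (δ' (n + 1)) (δ' (n + 2))) := by
  obtain ⟨n1, a1⟩ := isNoetherian_isArtinian_of_length (Λ := Λ) K h
  obtain ⟨e⟩ := quotient_equiv_ker_kosB δ δ' hδ i hi hc t ht hs n
  refine HasSocle.of_injective ((LinearMap.ker (kosB δ δ' i hc (n + 1))).subtype ∘ₗ e.toLinearMap)
    ((Submodule.subtype_injective _).comp e.injective) ?_
  apply hasSocle_of_smul_top_ne_top
  intro htop
  apply hI.smul_top_ne_top
  set P := LinearMap.range (LinearMap.lsmul Λ (MidHom (δ n) (δ (n + 1))) t) with hP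
  have h0 : Submodule.map P.mkQ ⊤ = ⊤ := by
    rw [Submodule.map_top, LinearMap.range_eq_top.2 (Submodule.mkQ_surjective _)]
  have h1 := congrArg (Submodule.comap P.mkQ) htop
  rw [Submodule.comap_top, ← h0, ← Submodule.map_smul'', Submodule.comap_map_mkQ,
    sup_eq_right.2] at h1
  · exact h1
  · rintro _ ⟨y, rfl⟩
    exact Submodule.smul_mem_smul htI trivial
end Koszul

section Tower
variable {Γ : Type*} [CommRing Γ] (W : Type*) [AddCommGroup W] [Module Γ W] (t : ℕ → Γ)

/-- The submodule killed by the first `j` members of a sequence of scalars. -/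
def killedBy (j : ℕ) : Submodule Γ W where
  carrier := {w | ∀ l < j, t l • w = 0}
  add_mem' := fun ha hb l hl => by rw [smul_add, ha l hl, hb l hl, add_zero]
  zero_mem' := fun l _ => smul_zero _
  smul_mem' := fun r x hx l hl => by rw [smul_comm, hx l hl, smul_zero]

lemma killedBy_succ_le (j : ℕ) : killedBy W t (j + 1) ≤ killedBy W t j :=
  fun _ hw l hl => hw l (by omega)

lemma act_comp_apply {ι κ N N' : Type*} [Fintype ι] [Fintype κ] [AddCommGroup N] [Module Γ N]
    [AddCommGroup N'] [Module Γ N'] (A : Matrix ι κ Γ) (f : N →ₗ[Γ] N') (x : κ → N) :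
    act A N' (f ∘ x) = f ∘ act A N x := by
  ext i
  simp [act_apply]

lemma mδ_comp {C : ℕ → ℕ} (A : ∀ n, Matrix (Fin (C n)) (Fin (C (n + 1))) Γ)
    (hA : ∀ n, A n * A (n + 1) = 0) (N : Type*) [AddCommGroup N] [Module Γ N] (n : ℕ)
    (x : Fin (C n) → N) : mδ A N (n + 1) (mδ A N n x) = 0 := by
  rw [← act_mul, ← Matrix.transpose_mul, hA, Matrix.transpose_zero, act_zero]

/-- Postcomposition with a linear map, in each degree. -/
def postc {N N' : Type*} [AddCommGroup N] [Module Γ N] [AddCommGroup N'] [Module Γ N']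
    (f : N →ₗ[Γ] N') (c : ℕ) : (Fin c → N) →ₗ[Γ] (Fin c → N') := f.compLeft (Fin c)

lemma mδ_postc {C : ℕ → ℕ} (A : ∀ n, Matrix (Fin (C n)) (Fin (C (n + 1))) Γ)
    {N N' : Type*} [AddCommGroup N] [Module Γ N] [AddCommGroup N'] [Module Γ N']
    (f : N →ₗ[Γ] N') (n : ℕ) (x : Fin (C n) → N) :
    mδ A N' n (postc f _ x) = postc f _ (mδ A N n x) := act_comp_apply _ f x

variable {C : ℕ → ℕ} (A : ∀ n, Matrix (Fin (C n)) (Fin (C (n + 1))) Γ)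

variable (K : Type*) [CommRing K] [Algebra K Γ] [Module K W] [IsScalarTower K Γ W]

/-- Cohomology of the cochain complex attached to a sequence of matrices. -/
abbrev mH (N : Type*) [AddCommGroup N] [Module Γ N] (n : ℕ) := MidHom (mδ A N n) (mδ A N (n + 1))

section step
variable (hA : ∀ n, A n * A (n + 1) = 0) (j : ℕ)
    (hsurj : ∀ w ∈ killedBy W t j, ∃ v ∈ killedBy W t j, t j • v = w)

lemma smul_eq_zero_iff_mem_range_postc (n : ℕ) (x : Fin (C n) → killedBy W t j) :
    t j • x = 0 ↔ ∃ y, postc (Submodule.inclusion (killedBy_succ_le W t j)) (C n) y = x := by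
  constructor
  · intro h
    refine ⟨fun k => ⟨(x k).1, fun l hl => ?_⟩, rfl⟩
    rcases Nat.lt_succ_iff_lt_or_eq.1 hl with h1 | rfl
    · exact (x k).2 l h1
    · exact congrArg Subtype.val (congrFun h k)
  · rintro ⟨y, rfl⟩
    ext k
    exact (y k).2 j (by omega)

include hsurj in
lemma exists_smul_eq_postc (n : ℕ) (x : Fin (C n) → killedBy W t j) : ∃ y, t j • y = x := by
  choose v hv hv' using hsurj
  exact ⟨fun k => ⟨v _ (x k).2, hv _ (x k).2⟩, by ext k; exact hv' _ (x k).2⟩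

lemma injective_postc (n : ℕ) : Function.Injective
    (postc (Submodule.inclusion (killedBy_succ_le W t j)) (C n)) := fun x y h => by
  funext k
  have := congrArg Subtype.val (congrFun h k)
  exact Subtype.ext this

variable {W t A}
include hA hsurj

lemma length_killedBy_succ (n : ℕ) (h : Module.length K (mH A (killedBy W t j) n) ≠ ⊤) :
    Module.length K (mH A (killedBy W t (j + 1)) (n + 1)) =
      Module.length K (LinearMap.ker (LinearMap.lsmul Γ (mH A (killedBy W t j) n) (t j))) +
      Module.length K (LinearMap.ker
        (LinearMap.lsmul Γ (mH A (killedBy W t j) (n + 1)) (t j))) :=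
  length_kosB (mδ A (killedBy W t j)) (mδ A (killedBy W t (j + 1))) (mδ_comp A hA _)
    (fun n => postc (Submodule.inclusion (killedBy_succ_le W t j)) (C n))
    (injective_postc W t j) (mδ_postc A _) (t j) (smul_eq_zero_iff_mem_range_postc W t j)
    (exists_smul_eq_postc W t j hsurj) K n h

lemma length_killedBy_ne_top (hC : C 1 = 0)
    (h : ∀ n, Module.length K (mH A (killedBy W t j) n) ≠ ⊤) (n : ℕ) :
    Module.length K (mH A (killedBy W t (j + 1)) n) ≠ ⊤ := by
  have : IsEmpty (Fin (C 1)) := by rw [hC]; infer_instance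
  exact length_kos_ne_top (mδ A (killedBy W t j)) (mδ A (killedBy W t (j + 1))) (mδ_comp A hA _)
    (fun n => postc (Submodule.inclusion (killedBy_succ_le W t j)) (C n))
    (injective_postc W t j) (mδ_postc A _) (t j) (smul_eq_zero_iff_mem_range_postc W t j)
    (exists_smul_eq_postc W t j hsurj) K h n

lemma hasSocle_killedBy {I : Ideal Γ} (htI : t j ∈ I) (n : ℕ)
    (h : Module.length K (mH A (killedBy W t j) n) ≠ ⊤)
    (h' : Module.length K (mH A (killedBy W t (j + 1)) n) ≠ ⊤)
    (hI : HasSocle I (mH A (killedBy W t j) n)) :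
    HasSocle I (mH A (killedBy W t (j + 1)) n) :=
  hasSocle_kos (mδ A (killedBy W t j)) (mδ A (killedBy W t (j + 1))) (mδ_comp A hA _)
    (fun n => postc (Submodule.inclusion (killedBy_succ_le W t j)) (C n))
    (injective_postc W t j) (mδ_postc A _) (t j) (smul_eq_zero_iff_mem_range_postc W t j)
    (exists_smul_eq_postc W t j hsurj) K htI n h h' hI

lemma hasSocle_killedBy_succ {I : Ideal Γ} (htI : t j ∈ I) (n : ℕ)
    (h : Module.length K (mH A (killedBy W t j) n) ≠ ⊤)
    (hI : HasSocle I (mH A (killedBy W t j) n)) :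
    HasSocle I (mH A (killedBy W t (j + 1)) (n + 1)) :=
  hasSocle_kos_succ (mδ A (killedBy W t j)) (mδ A (killedBy W t (j + 1))) (mδ_comp A hA _)
    (fun n => postc (Submodule.inclusion (killedBy_succ_le W t j)) (C n))
    (injective_postc W t j) (mδ_postc A _) (t j) (smul_eq_zero_iff_mem_range_postc W t j)
    (exists_smul_eq_postc W t j hsurj) K htI n h hI
end step

variable {W t A}

lemma exists_tower_lengths (hA : ∀ n, A n * A (n + 1) = 0) (hC : C 1 = 0) (s : ℕ)
    (hsurj : ∀ j < s + 1, ∀ w ∈ killedBy W t j, ∃ v ∈ killedBy W t j, t j • v = w)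
    {I : Ideal Γ} (htI : ∀ j, t j ∈ I) (e : ℕ)
    (hfin : ∀ n, Module.length K (mH A (killedBy W t 0) n) ≠ ⊤)
    (hsoc : ∀ n ≤ e, HasSocle I (mH A (killedBy W t 0) (n + 1))) :
    ∃ k : ℕ → ℕ∞, k 0 = 0 ∧ (∀ n, k n ≠ ⊤) ∧ (∀ n ≤ e + s, k (n + 1) ≠ 0) ∧
      ∀ n, Module.length K (mH A (killedBy W t (s + 1)) (n + 1)) = k n + k (n + 1) := by
  have key : ∀ j ≤ s, (∀ n, Module.length K (mH A (killedBy W t j) n) ≠ ⊤) ∧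
      ∀ n ≤ e + j, HasSocle I (mH A (killedBy W t j) (n + 1)) := by
    intro j
    induction j with
    | zero => exact fun _ => ⟨hfin, hsoc⟩
    | succ j ih =>
      intro hj
      obtain ⟨h1, h2⟩ := ih (by omega)
      have h3 := length_killedBy_ne_top K hA j (hsurj j (by omega)) hC h1
      refine ⟨h3, fun n hn => ?_⟩
      by_cases hn' : n ≤ e + j
      · exact hasSocle_killedBy K hA j (hsurj j (by omega)) (htI j) (n + 1) (h1 _) (h3 _)
          (h2 n hn')
      · obtain ⟨m, rfl⟩ : ∃ m, n = m + 1 := ⟨n - 1, by omega⟩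
        exact hasSocle_killedBy_succ K hA j (hsurj j (by omega)) (htI j) (m + 1) (h1 _)
          (h2 m (by omega))
  obtain ⟨h1, h2⟩ := key s le_rfl
  have hle (n) : Module.length K
      (LinearMap.ker (LinearMap.lsmul Γ (mH A (killedBy W t s) n) (t s))) ≤
      Module.length K (mH A (killedBy W t s) n) := by
    rw [← length_ker_add_range K (LinearMap.lsmul Γ (mH A (killedBy W t s) n) (t s))]
    exact le_self_add
  refine ⟨fun n => Module.length K
    (LinearMap.ker (LinearMap.lsmul Γ (mH A (killedBy W t s) n) (t s))), ?_,
    fun n => ne_top_of_le_ne_top (h1 n) (hle n), fun n hn => ?_,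
    fun n => length_killedBy_succ K hA s (hsurj s (by omega)) n (h1 n)⟩
  · refine le_antisymm ((hle 0).trans (le_of_eq ?_)) (zero_le)
    rw [Module.length_eq_zero_iff, MidHom.subsingleton_iff]
    intro x _
    refine ⟨0, funext fun k => ?_⟩
    have : Fin (C 1) := k
    rw [hC] at this
    exact this.elim0
  · obtain ⟨x, hx, hx'⟩ := h2 n hn
    rw [Ne, Module.length_eq_zero_iff]
    intro hsub
    exact hx (congrArg Subtype.val (hsub.elim (⟨x, hx' _ (htI s)⟩ : LinearMap.ker
      (LinearMap.lsmul Γ (mH A (killedBy W t s) (n + 1)) (t s))) 0))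
end Tower

lemma numeric_pos {k t r Q : ℕ → ℕ∞} (hk0 : k 0 = 0) (hk : ∀ n, k n ≠ ⊤)
    (hr : ∀ n, r n ≤ t n) (ht0 : t 0 = 0) (ht1 : t 1 = 0) (hQ : ∀ n, Q n = k n + k (n + 1))
    (h : ∀ n, Q n + r n + r (n + 1) = t (n + 2) + t (n + 1)) (n : ℕ) : k (n + 1) ≤ t (n + 2) := by
  have key : ∀ n, t (n + 1) = k n + r n ∧ t n ≠ ⊤ ∧ t (n + 1) ≠ ⊤ := by
    intro n
    induction n with
    | zero =>
      have : r 0 = 0 := le_antisymm ((hr 0).trans ht0.le) (zero_le)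
      simp [hk0, ht0, ht1, this]
    | succ n ih =>
      obtain ⟨h1, h2, h3⟩ := ih
      have h4 : t (n + 2) = k (n + 1) + r (n + 1) := by
        have h5 : t (n + 2) + t (n + 1) = k (n + 1) + r (n + 1) + t (n + 1) := by
          rw [← h n, hQ, h1]
          abel
        exact WithTop.add_right_cancel h3 h5
      refine ⟨h4, h3, ?_⟩
      rw [h4]
      exact WithTop.add_ne_top.2 ⟨hk _, ne_top_of_le_ne_top h3 (hr _)⟩
  rw [(key (n + 1)).1]
  exact le_self_add

section Gamma
variable (K T : Type*) [CommRing K] [CommRing T] [Algebra K T] (N M : Type*)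
  [AddCommGroup N] [Module K N] [Module T N] [IsScalarTower K T N]
  [AddCommGroup M] [Module K M] [Module T M] [IsScalarTower K T M]

/-- Precomposition with scalars. -/
def preHom : T →ₐ[K] Module.End K (N →ₗ[K] M) where
  toFun a := LinearMap.lcomp K M (Algebra.lsmul K K N a)
  map_one' := by ext; simp
  map_mul' a b := by ext; simp [mul_comm a b]
  map_zero' := by ext; simp
  map_add' a b := by ext; simp
  commutes' r := by ext; simp

/-- Postcomposition with scalars. -/
def postHom : T →ₐ[K] Module.End K (N →ₗ[K] M) where
  toFun a := LinearMap.compRight K (Algebra.lsmul K K M a)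
  map_one' := by ext; simp
  map_mul' a b := by ext; simp
  map_zero' := by ext; simp
  map_add' a b := by ext; simp
  commutes' r := by ext; simp

/-- The two-sided action on the space of linear maps. -/
noncomputable def bimodHom : T ⊗[K] T →ₐ[K] Module.End K (N →ₗ[K] M) :=
  Algebra.TensorProduct.lift (preHom K T N M) (postHom K T N M) (fun a b => by
    ext; simp [preHom, postHom])

/-- Linear maps between two modules form a module over the enveloping algebra. -/
noncomputable abbrev bimod : Module (T ⊗[K] T) (N →ₗ[K] M) :=
  Module.compHom _ (bimodHom K T N M).toRingHom

attribute [local instance] bimod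

lemma bimod_smul_def (r : T ⊗[K] T) (f : N →ₗ[K] M) : r • f = bimodHom K T N M r f := rfl

variable {K T N M} in
lemma tmul_smul_apply (a b : T) (f : N →ₗ[K] M) (z : N) :
    ((a ⊗ₜ[K] b) • f) z = b • f (a • z) := by
  rw [bimod_smul_def]
  simp [bimodHom, preHom, postHom]

lemma bimod_tower : IsScalarTower K (T ⊗[K] T) (N →ₗ[K] M) := ⟨fun r a f => by
  rw [bimod_smul_def, bimod_smul_def, map_smul]; rfl⟩

attribute [local instance] bimod_tower

/-- The commutator element attached to a scalar. -/
noncomputable def comEl {K T : Type*} [CommRing K] [CommRing T] [Algebra K T] (a : T) :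
    T ⊗[K] T := a ⊗ₜ 1 - 1 ⊗ₜ a

variable {K T N M} in
lemma comEl_smul_apply (a : T) (f : N →ₗ[K] M) (z : N) :
    ((comEl a : T ⊗[K] T) • f) z = f (a • z) - a • f z := by
  rw [comEl, sub_smul, LinearMap.sub_apply, tmul_smul_apply, tmul_smul_apply, one_smul, one_smul]


section poly
variable {s : ℕ} {K : Type*} [CommRing K] {M : Type*} [AddCommGroup M] [Module K M]
  [Module (MvPolynomial (Fin s) K) M] [IsScalarTower K (MvPolynomial (Fin s) K) M]
open MvPolynomial

/-- The sequence of commutator elements of the variables. -/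
noncomputable def comX (s : ℕ) (K : Type*) [CommRing K] (l : ℕ) :
    MvPolynomial (Fin s) K ⊗[K] MvPolynomial (Fin s) K :=
  if h : l < s then comEl (X ⟨l, h⟩) else 0

lemma comX_val (l : Fin s) : comX s K l = comEl (X l) := by
  rw [comX, dif_pos l.2]

lemma comX_smul_eq_zero_iff (l : Fin s) (f : MvPolynomial (Fin s) K →ₗ[K] M) :
    comX s K l • f = 0 ↔
    ∀ z, f (X l * z) = (X l : MvPolynomial (Fin s) K) • f z := by
  rw [comX_val, LinearMap.ext_iff]
  refine forall_congr' fun z => ?_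
  rw [comEl_smul_apply, LinearMap.zero_apply, sub_eq_zero, smul_eq_mul]

/-- A primitive of a linear map with respect to the commutator with one variable. -/
noncomputable def primX (j : Fin s) (w : MvPolynomial (Fin s) K →ₗ[K] M) :
    MvPolynomial (Fin s) K →ₗ[K] M :=
  (basisMonomials (Fin s) K).constr K fun a =>
    ∑ i ∈ Finset.range (a j), (X j : MvPolynomial (Fin s) K) ^ i •
      w (monomial (a - Finsupp.single j (i + 1)) 1)

lemma primX_monomial (j : Fin s) (w : MvPolynomial (Fin s) K →ₗ[K] M) (a : Fin s →₀ ℕ) :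
    primX j w (monomial a 1) = ∑ i ∈ Finset.range (a j), (X j : MvPolynomial (Fin s) K) ^ i •
      w (monomial (a - Finsupp.single j (i + 1)) 1) := by
  have := (basisMonomials (Fin s) K).constr_basis K (fun a : Fin s →₀ ℕ =>
    ∑ i ∈ Finset.range (a j), (X j : MvPolynomial (Fin s) K) ^ i •
      w (monomial (a - Finsupp.single j (i + 1)) 1)) a
  rwa [coe_basisMonomials] at this

lemma X_mul_monomial_one (l : Fin s) (a : Fin s →₀ ℕ) :
    (X l * monomial a 1 : MvPolynomial (Fin s) K) = monomial (a + Finsupp.single l 1) 1 := by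
  rw [X, monomial_mul, one_mul, add_comm]

lemma forall_mul_iff_monomial (l : Fin s) (f g : MvPolynomial (Fin s) K →ₗ[K] M) :
    (∀ z, f (X l * z) - (X l : MvPolynomial (Fin s) K) • f z = g z) ↔
      ∀ a, f (monomial (a + Finsupp.single l 1) 1) - (X l : MvPolynomial (Fin s) K) •
        f (monomial a 1) = g (monomial a 1) := by
  constructor
  · intro h a
    rw [← X_mul_monomial_one, h]
  · intro h z
    have : (comEl (X l) : MvPolynomial (Fin s) K ⊗[K] MvPolynomial (Fin s) K) • f = g := by
      refine (basisMonomials (Fin s) K).ext fun a => ?_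
      rw [coe_basisMonomials, comEl_smul_apply, smul_eq_mul, X_mul_monomial_one, h]
    rw [← this, comEl_smul_apply, smul_eq_mul]

lemma exists_comX_smul_eq (j : ℕ) (hj : j < s) (w : MvPolynomial (Fin s) K →ₗ[K] M)
    (hw : w ∈ killedBy (MvPolynomial (Fin s) K →ₗ[K] M) (comX s K) j) :
    ∃ v ∈ killedBy (MvPolynomial (Fin s) K →ₗ[K] M) (comX s K) j, comX s K j • v = w := by
  obtain ⟨j, rfl⟩ : ∃ i : Fin s, j = i := ⟨⟨j, hj⟩, rfl⟩
  refine ⟨primX j w, fun l hl => ?_, ?_⟩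
  · obtain ⟨l, rfl⟩ : ∃ i : Fin s, l = i := ⟨⟨l, hl.trans hj⟩, rfl⟩
    have hlj : l ≠ j := fun h => by rw [h] at hl; exact lt_irrefl _ hl
    have h1 := (comX_smul_eq_zero_iff l w).1 (hw l hl)
    rw [comX_smul_eq_zero_iff]
    intro z
    rw [← sub_eq_zero]
    refine (forall_mul_iff_monomial l (primX j w) 0).2 (fun a => ?_) z
    rw [LinearMap.zero_apply, sub_eq_zero, primX_monomial, primX_monomial, Finset.smul_sum]
    rw [Finsupp.add_apply, Finsupp.single_eq_of_ne hlj.symm, add_zero]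
    refine Finset.sum_congr rfl fun i hi => ?_
    rw [Finset.mem_range] at hi
    rw [smul_comm, ← h1, X_mul_monomial_one]
    congr 4
    ext m
    by_cases hm : m = j
    · subst hm
      simp [Finsupp.single_eq_of_ne hlj.symm]
    · simp [Finsupp.single_eq_of_ne hm]
  · rw [comX_val]
    refine LinearMap.ext fun z => ?_
    rw [comEl_smul_apply, smul_eq_mul]
    refine (forall_mul_iff_monomial j (primX j w) w).2 (fun a => ?_) z
    rw [primX_monomial, primX_monomial, Finset.smul_sum]
    rw [Finsupp.add_apply, Finsupp.single_eq_same, Finset.sum_range_succ', pow_zero, one_smul,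
      zero_add, add_tsub_cancel_right, sub_eq_iff_eq_add, add_comm (w _)]
    refine congrArg (· + w (monomial a 1)) ?_
    refine Finset.sum_congr rfl fun i hi => ?_
    rw [smul_smul, ← pow_succ']
    congr 4
    ext m
    by_cases hm : m = j
    · subst hm
      simp
    · simp [Finsupp.single_eq_of_ne hm]

/-- Linear maps commuting with all variables correspond to elements of the target. -/
lemma killedBy_comX_iff (f : MvPolynomial (Fin s) K →ₗ[K] M) :
    f ∈ killedBy (MvPolynomial (Fin s) K →ₗ[K] M) (comX s K) s ↔ ∀ z, f z = z • f 1 := by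
  constructor
  · intro h
    have h1 := fun l : Fin s => (comX_smul_eq_zero_iff l f).1 (h l l.2)
    intro z
    induction z using MvPolynomial.induction_on with
    | C a =>
      rw [← algebraMap_eq, algebraMap_smul, ← map_smul, Algebra.smul_def, mul_one]
    | add p q hp hq => rw [map_add, hp, hq, add_smul]
    | mul_X p n hp => rw [mul_comm, h1, hp, smul_smul]
  · intro h l hl
    obtain ⟨l, rfl⟩ : ∃ i : Fin s, l = i := ⟨⟨l, hl⟩, rfl⟩
    rw [comX_smul_eq_zero_iff]
    intro z
    rw [h, h z, smul_smul]

/-- Evaluation at one identifies the commuting linear maps with the target. -/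
noncomputable def killedByEquiv :
    killedBy (MvPolynomial (Fin s) K →ₗ[K] M) (comX s K) s ≃ₗ[K] M where
  toFun f := f.1 1
  map_add' _ _ := rfl
  map_smul' _ _ := rfl
  invFun m := ⟨LinearMap.restrictScalars K
    (LinearMap.toSpanSingleton (MvPolynomial (Fin s) K) M m), by
      rw [killedBy_comX_iff]
      intro z
      simp⟩
  left_inv f := by
    refine Subtype.ext (LinearMap.ext fun z => ?_)
    exact ((killedBy_comX_iff f.1).1 f.2 z).symm
  right_inv m := by simp

end poly
end Gamma

section congrK
variable (K : Type*) [CommRing K] {Λ Λ' : Type*} [CommRing Λ] [CommRing Λ'] [Algebra K Λ]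
  [Algebra K Λ'] {A B C A' B' C' : Type*} [AddCommGroup A] [AddCommGroup B]
  [AddCommGroup C] [Module Λ A] [Module Λ B] [Module Λ C] [AddCommGroup A'] [AddCommGroup B']
  [AddCommGroup C'] [Module Λ' A'] [Module Λ' B'] [Module Λ' C'] [Module K A] [Module K B]
  [Module K C] [Module K A'] [Module K B'] [Module K C'] [IsScalarTower K Λ A]
  [IsScalarTower K Λ B] [IsScalarTower K Λ C] [IsScalarTower K Λ' A'] [IsScalarTower K Λ' B']
  [IsScalarTower K Λ' C']

lemma MidHom.congr_restrictScalars (f : A →ₗ[Λ] B) (g : B →ₗ[Λ] C) (f' : A' →ₗ[Λ'] B')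
    (g' : B' →ₗ[Λ'] C') (eA : A ≃ₗ[K] A') (eB : B ≃ₗ[K] B') (eC : C ≃ₗ[K] C')
    (hf : ∀ x, eB (f x) = f' (eA x)) (hg : ∀ x, eC (g x) = g' (eB x)) :
    Nonempty (MidHom f g ≃ₗ[K] MidHom f' g') := by
  have hker (b : B) (hb : g b = 0) : g' (eB b) = 0 := by rw [← hg, hb, map_zero]
  let φ : LinearMap.ker g →ₗ[K] MidHom f' g' :=
    { toFun := fun b => MidHom.mk f' g' (eB b.1) (hker b.1 b.2)
      map_add' := fun x y => by
        refine MidHom.mk_eq_mk.2 ⟨0, ?_⟩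
        simp
      map_smul' := fun r x => by
        rw [RingHom.id_apply, ← algebraMap_smul Λ' r (MidHom.mk f' g' _ _), MidHom.smul_mk]
        refine MidHom.mk_eq_mk.2 ⟨0, ?_⟩
        simp }
  let ψ : LinearMap.ker g →ₗ[K] MidHom f g :=
    { toFun := fun b => MidHom.mk f g b.1 b.2
      map_add' := fun x y => rfl
      map_smul' := fun r x => rfl }
  have hψ : Function.Surjective ψ :=
    Submodule.mkQ_surjective ((LinearMap.range f).comap (LinearMap.ker g).subtype)
  have hφ : Function.Surjective φ := by
    intro x
    obtain ⟨b, hb, rfl⟩ := x.exists_mk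
    obtain ⟨b, rfl⟩ := eB.surjective b
    rw [← hg, map_eq_zero_iff _ eC.injective] at hb
    exact ⟨⟨b, hb⟩, rfl⟩
  have hk : LinearMap.ker ψ = LinearMap.ker φ := by
    ext ⟨b, hb⟩
    refine (MidHom.mk_eq_zero (hb := hb)).trans (Iff.trans ?_
      (MidHom.mk_eq_zero (hb := hker b hb)).symm)
    constructor
    · rintro ⟨a, rfl⟩
      exact ⟨eA a, (hf a).symm⟩
    · rintro ⟨a, ha⟩
      obtain ⟨a, rfl⟩ := eA.surjective a
      exact ⟨a, eB.injective ((hf a).trans ha)⟩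
  exact ⟨(ψ.quotKerEquivOfSurjective hψ).symm ≪≫ₗ Submodule.quotEquivOfEq _ _ hk ≪≫ₗ
    φ.quotKerEquivOfSurjective hφ⟩
end congrK

section
variable {K T : Type u} [CommRing K] [CommRing T] [Algebra K T] {M : Type u}
  [AddCommGroup M] [Module K M] [Module T M] [IsScalarTower K T M]

attribute [local instance] bimod bimod_tower

variable (K) in
/-- The differentials of a resolution with scalars extended to the enveloping algebra. -/
noncomputable def envA {C : ℕ → ℕ} (A : ∀ n, Matrix (Fin (C n)) (Fin (C (n + 1))) T) (n : ℕ) :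
    Matrix (Fin (C n)) (Fin (C (n + 1))) (T ⊗[K] T) := (A n).map (algebraMap T (T ⊗[K] T))

/-- Assemble a family of linear maps into a linear map out of a power. -/
noncomputable def sumHom (c : ℕ) : (Fin c → (T →ₗ[K] M)) ≃ₗ[K] ((Fin c → T) →ₗ[K] M) :=
  LinearMap.lsum K (fun _ : Fin c => T) K

lemma sumHom_apply {c : ℕ} (φ : Fin c → (T →ₗ[K] M)) (x : Fin c → T) :
    sumHom c φ x = ∑ k, φ k (x k) := by
  simp [sumHom, LinearMap.lsum_apply]

lemma sumHom_mδ {C : ℕ → ℕ} (A : ∀ n, Matrix (Fin (C n)) (Fin (C (n + 1))) T) (n : ℕ)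
    (φ : Fin (C n) → (T →ₗ[K] M)) (x : Fin (C (n + 1)) → T) :
    sumHom _ (mδ (envA K A) (T →ₗ[K] M) n φ) x = sumHom _ φ (act (A n) T x) := by
  simp only [sumHom_apply, act_apply, envA, Matrix.transpose_apply, Matrix.map_apply,
    LinearMap.sum_apply, map_sum]
  rw [Finset.sum_comm]
  refine Finset.sum_congr rfl fun i _ => Finset.sum_congr rfl fun j _ => ?_
  rw [Algebra.TensorProduct.algebraMap_apply, tmul_smul_apply, one_smul]
  rfl

lemma length_extMod_ne_top [IsNoetherianRing K] (h : Module.length K M ≠ ⊤) (n : ℕ) :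
    Module.length K (extMod K n M M) ≠ ⊤ := by
  have := (isFiniteLength_iff_isNoetherian_isArtinian.1 (Module.length_ne_top_iff.1 h)).1
  obtain ⟨F⟩ := FreeRes.nonempty (R := K) (M := M)
  obtain ⟨e⟩ := F.extMod_equiv_pad M n
  rw [e.length_eq]
  refine ne_top_of_le_ne_top ?_ (Module.length_le_of_surjective _ (Submodule.mkQ_surjective _))
  refine ne_top_of_le_ne_top ?_ (Module.length_le_of_injective _ (Submodule.subtype_injective _))
  rw [Module.length_pi]
  exact WithTop.mul_ne_top (by
    rw [ENat.card_eq_coe_fintype_card]; exact ENat.natCast_ne_top _) h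

/-- The differential of a free resolution, with scalars restricted. -/
noncomputable def resD (K : Type u) {T : Type u} [CommRing K] [CommRing T] [Algebra K T]
    {C : ℕ → ℕ} (A : ∀ n, Matrix (Fin (C n)) (Fin (C (n + 1))) T) (n : ℕ) :
    (Fin (C (n + 1)) → T) →ₗ[K] (Fin (C n) → T) := (act (A n) T).restrictScalars K

lemma mH_equiv_lcomp {C : ℕ → ℕ} (A : ∀ n, Matrix (Fin (C n)) (Fin (C (n + 1))) T) (n : ℕ) :
    Nonempty (mH (envA K A) (T →ₗ[K] M) n ≃ₗ[K]
      MidHom (LinearMap.lcomp K M (resD K A n)) (LinearMap.lcomp K M (resD K A (n + 1)))) :=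
  MidHom.congr_restrictScalars K _ _ _ _ (sumHom _) (sumHom _) (sumHom _)
    (fun φ => LinearMap.ext fun x => sumHom_mδ A n φ x)
    (fun φ => LinearMap.ext fun x => sumHom_mδ A (n + 1) φ x)

lemma length_mH_ne_top [IsNoetherianRing K] [Module.Free K T] (h : Module.length K M ≠ ⊤)
    (F : FreeRes T M) (n : ℕ) :
    Module.length K (mH (envA K (padA (padA F.A))) (T →ₗ[K] M) n) ≠ ⊤ := by
  have hx (n : ℕ) : Function.Exact (resD K F.A (n + 1)) (resD K F.A n) := F.exact_succ n
  match n with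
  | 0 =>
    rw [Module.length_eq_zero_iff.2]
    · exact ENat.zero_ne_top
    · rw [MidHom.subsingleton_iff]
      exact fun x _ => ⟨0, funext fun k => k.elim0⟩
  | 1 =>
    obtain ⟨e⟩ := mH_equiv_lcomp (K := K) (M := M) (padA (padA F.A)) 1
    obtain ⟨e'⟩ := MidHom.equiv_ker (f := LinearMap.lcomp K M (resD K (padA (padA F.A)) 1))
      (LinearMap.lcomp K M (resD K (padA (padA F.A)) 2)) (by
        apply LinearMap.ext
        intro f
        apply LinearMap.ext
        intro x
        rw [LinearMap.lcomp_apply]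
        have : resD K (padA (padA F.A)) 1 x = 0 := funext fun k => k.elim0
        rw [this, map_zero]; rfl)
    obtain ⟨e''⟩ := extMod_zero_equiv K (fun n => Fin (F.c n) → T) (fun n => resD K F.A n) M
      ((Fintype.linearCombination T F.e).restrictScalars K) M hx F.exact_zero F.surj
    rw [(e.trans (e'.trans e''.symm)).length_eq]
    exact length_extMod_ne_top h 0
  | n + 2 =>
    obtain ⟨e⟩ := mH_equiv_lcomp (K := K) (M := M) (padA (padA F.A)) (n + 2)
    obtain ⟨e''⟩ := extMod_succ_equiv K (fun n => Fin (F.c n) → T) (fun n => resD K F.A n) M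
      ((Fintype.linearCombination T F.e).restrictScalars K) M hx F.exact_zero F.surj n
    rw [(e.trans e''.symm).length_eq]
    exact length_extMod_ne_top h (n + 1)
end

lemma projective_ker_of_finite {K : Type u} [CommRing K] [IsDomain K] [IsPrincipalIdealRing K]
    {P M : Type u} [AddCommGroup P] [Module K P] [AddCommGroup M] [Module K M]
    [Module.Projective K P] [Module.Finite K M] (f : P →ₗ[K] M) (hf : Function.Surjective f) :
    Module.Projective K (LinearMap.ker f) := by
  obtain ⟨n, g, hg⟩ := Module.Finite.exists_fin' K M
  let u : (ULift.{u} (Fin n) → K) →ₗ[K] M :=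
    g ∘ₗ (LinearEquiv.funCongrLeft K K Equiv.ulift.symm).toLinearMap
  have hu : Function.Surjective u := hg.comp (LinearEquiv.surjective _)
  have h1 := LinearMap.shortExact_shortComplexKer hu
  have h2 := LinearMap.shortExact_shortComplexKer hf
  have p1 : Projective (ModuleCat.of K (LinearMap.ker u)) :=
    (IsProjective.iff_projective _).1 inferInstance
  have p2 : Projective (ModuleCat.of K (ULift.{u} (Fin n) → K)) :=
    (IsProjective.iff_projective _).1 inferInstance
  have p3 : Projective (ModuleCat.of K P) :=
    (IsProjective.iff_projective _).1 inferInstance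
  have h3 : HasProjectiveDimensionLT (ModuleCat.of K M) 2 :=
    h1.hasProjectiveDimensionLT_X₃ 1 (by
      change HasProjectiveDimensionLT (ModuleCat.of K (LinearMap.ker u)) 1
      infer_instance) (by
      change HasProjectiveDimensionLT (ModuleCat.of K (ULift.{u} (Fin n) → K)) (1 + 1)
      infer_instance)
  have h4 : HasProjectiveDimensionLT (ModuleCat.of K (LinearMap.ker f)) 1 :=
    h2.hasProjectiveDimensionLT_X₁ 1 (by
      change HasProjectiveDimensionLT (ModuleCat.of K P) 1
      infer_instance) h3
  rw [IsProjective.iff_projective.{u}]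
  exact projective_iff_hasProjectiveDimensionLT_one.2 h4

section socleH
variable {K T : Type u} [CommRing K] [CommRing T] [Algebra K T] {M : Type u}
  [AddCommGroup M] [Module K M] [Module T M] [IsScalarTower K T M]

attribute [local instance] bimod bimod_tower

/-- The ideal of the enveloping algebra generated by commutators and one scalar. -/
noncomputable def socI (T : Type u) [CommRing T] [Algebra K T] (p : K) : Ideal (T ⊗[K] T) :=
  Ideal.span (Set.range (fun a : T => (comEl a : T ⊗[K] T)) ∪ {algebraMap K _ p})

lemma comX_mem_socI {s : ℕ} (p : K) (j : ℕ) : comX s K j ∈ socI (MvPolynomial (Fin s) K) p := by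
  rw [comX]
  split_ifs with h
  · exact Ideal.subset_span (Or.inl ⟨_, rfl⟩)
  · exact zero_mem _

lemma smul_eq_zero_of_mem_socI {H : Type*} [AddCommGroup H] [Module (T ⊗[K] T) H] [Module K H]
    [IsScalarTower K (T ⊗[K] T) H] {p : K} {h : H} (h1 : ∀ a : T, (comEl a : T ⊗[K] T) • h = 0)
    (h2 : p • h = 0) : ∀ a ∈ socI T p, a • h = 0 := by
  intro a ha
  have : socI T p ≤ LinearMap.ker (LinearMap.toSpanSingleton (T ⊗[K] T) H h) := by
    refine Ideal.span_le.2 ?_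
    rintro _ (⟨a, rfl⟩ | rfl)
    · exact h1 a
    · exact (algebraMap_smul _ p h).trans h2
  exact this ha

lemma hasSocle_mH_one (F : FreeRes T M) [Nontrivial M] (p : K) (N : ℕ) (hp : ∀ m : M, p ^ N • m = 0) :
    HasSocle (socI T p) (mH (envA K (padA (padA F.A))) (T →ₗ[K] M) 1) := by
  classical
  have hex : ∃ n, ∀ m : M, p ^ n • m = 0 := ⟨N, hp⟩
  obtain ⟨k, hk⟩ : ∃ k, Nat.find hex = k + 1 := by
    refine Nat.exists_eq_succ_of_ne_zero fun h0 => ?_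
    have := Nat.find_spec hex
    rw [h0] at this
    obtain ⟨m, hm⟩ := exists_ne (0 : M)
    exact hm (by simpa using this m)
  have h1 := Nat.find_spec hex
  have h2 := Nat.find_min hex (m := k) (by omega)
  rw [hk] at h1
  push Not at h2
  obtain ⟨m, hm⟩ := h2
  let φ : Fin (padC (padC F.c) (1 + 1)) → (T →ₗ[K] M) := fun i =>
    p ^ k • (LinearMap.toSpanSingleton T M (F.e (show Fin (F.c 0) from i))).restrictScalars K
  have hφ (x : Fin (padC (padC F.c) (1 + 1)) → T) : sumHom _ φ x = p ^ k • Fintype.linearCombination T F.e (show Fin (F.c 0) → T from x) := by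
    rw [sumHom_apply, Fintype.linearCombination_apply, Finset.smul_sum]
    rfl
  have hcoc : mδ (envA K (padA (padA F.A))) (T →ₗ[K] M) (1 + 1) φ = 0 := by
    apply (sumHom (padC (padC F.c) (1 + 1 + 1))).injective
    apply LinearMap.ext
    intro x
    rw [map_zero, LinearMap.zero_apply]
    refine (sumHom_mδ (padA (padA F.A)) (1 + 1) φ x).trans ((hφ _).trans ?_)
    exact (congrArg _ (F.exact_zero.apply_apply_eq_zero x)).trans (smul_zero _)
  refine ⟨MidHom.mk _ _ φ hcoc, ?_, ?_⟩
  · rw [Ne, MidHom.mk_eq_zero]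
    rintro ⟨a, ha⟩
    obtain ⟨x, rfl⟩ := F.surj m
    apply hm
    refine (hφ x).symm.trans ?_
    rw [← ha]
    have : mδ (envA K (padA (padA F.A))) (T →ₗ[K] M) 1 a = 0 := by
      funext k
      rw [act_apply]
      exact Finset.sum_eq_zero fun i _ => (show Fin 0 from i).elim0
    rw [this, map_zero]
    rfl
  · refine smul_eq_zero_of_mem_socI (fun a => ?_) ?_
    · rw [MidHom.smul_mk, MidHom.mk_eq_zero]
      refine ⟨0, ?_⟩
      rw [map_zero]
      funext i
      refine LinearMap.ext fun z => ?_
      change _ = ((comEl a : T ⊗[K] T) • φ i) z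
      rw [comEl_smul_apply]
      simp only [φ, LinearMap.smul_apply, LinearMap.restrictScalars_apply,
        LinearMap.toSpanSingleton_apply, smul_eq_mul, mul_smul, Pi.zero_apply, LinearMap.zero_apply]
      rw [smul_comm a (p ^ k), smul_comm a z, sub_self]
    · rw [← algebraMap_smul (T ⊗[K] T) p, MidHom.smul_mk, MidHom.mk_eq_zero]
      refine ⟨0, ?_⟩
      rw [map_zero]
      funext i
      refine LinearMap.ext fun z => ?_
      rw [algebraMap_smul]
      refine Eq.symm (Eq.trans (b := p • p ^ k • z • F.e i) rfl ?_)
      rw [smul_smul, ← pow_succ', h1]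
      rfl
end socleH

lemma exists_syzygy_hom {K : Type u} [CommRing K] [IsDomain K] [IsPrincipalIdealRing K]
    {P M D : Type u} [AddCommGroup P] [Module K P] [AddCommGroup M] [Module K M] [AddCommGroup D]
    [Module K D] [Module.Projective K P] [Module.Finite K M] (ε : P →ₗ[K] M)
    (hε : Function.Surjective ε) (j : D →ₗ[K] M) (hj : Function.Injective j) (π : M →ₗ[K] D)
    (hπ : Function.Surjective π) (p : K) (hp0 : p ≠ 0) (hp : (Ideal.span {p}).IsMaximal)
    (hpD : ∀ f : D, p • f = 0) :
    ∃ ψ : LinearMap.ker ε →ₗ[K] M, ∀ (ω : LinearMap.ker ε) (x : P) (f : D),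
      ω.1 = p • x → ε x = j f → π (ψ ω) = f := by
  have : Module.Projective K (LinearMap.ker ε) := projective_ker_of_finite ε hε
  let Y : Submodule K (P × D) := LinearMap.eqLocus (ε ∘ₗ LinearMap.fst K P D)
    (j ∘ₗ LinearMap.snd K P D)
  let N : Submodule K (LinearMap.ker ε) := LinearMap.range (p • (LinearMap.id : LinearMap.ker ε →ₗ[K] _))
  have hY (y : Y) : ε y.1.1 = j y.1.2 := y.2
  let μ0 : Y →ₗ[K] LinearMap.ker ε := LinearMap.codRestrict _
    (p • (LinearMap.fst K P D ∘ₗ Y.subtype)) (fun y => by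
      simp [hY, ← map_smul, hpD])
  let μ : Y →ₗ[K] (LinearMap.ker ε ⧸ N) := N.mkQ ∘ₗ μ0
  have hV : Module.IsTorsionBySet K (LinearMap.ker ε ⧸ N) (Ideal.span {p}) := by
    rw [Module.isTorsionBySet_span_singleton_iff, Module.isTorsionBy_quotient_iff]
    exact fun x => ⟨x, rfl⟩
  have : IsSemisimpleModule K (LinearMap.ker ε ⧸ N) := by
    rw [← hV.isSemisimpleModule_iff]
    let := Ideal.Quotient.field (Ideal.span {p})
    let := hV.module
    infer_instance
  have hker : LinearMap.ker μ ≤ LinearMap.ker (LinearMap.snd K P D ∘ₗ Y.subtype) := by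
    intro y hy
    have hy' : N.mkQ (μ0 y) = 0 := hy
    rw [Submodule.mkQ_apply, Submodule.Quotient.mk_eq_zero] at hy'
    obtain ⟨ω, hω⟩ := hy'
    have h1 : p • ω.1 = p • y.1.1 := congrArg Subtype.val hω
    have h2 : ω.1 = y.1.1 := smul_right_injective P hp0 h1
    apply hj
    change j y.1.2 = j 0
    rw [← hY, ← h2, map_zero]
    exact ω.2
  obtain ⟨g, hg⟩ := IsSemisimpleModule.extension_property
    ((LinearMap.ker μ).liftQ μ le_rfl) (by
      rw [← LinearMap.ker_eq_bot]
      exact Submodule.ker_liftQ_eq_bot _ _ _ le_rfl)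
    ((LinearMap.ker μ).liftQ _ hker)
  obtain ⟨ψ, hψ⟩ := Module.projective_lifting_property π (g ∘ₗ N.mkQ) hπ
  refine ⟨ψ, fun ω x f h1 h2 => ?_⟩
  have h3 := LinearMap.congr_fun hψ ω
  rw [LinearMap.comp_apply] at h3
  rw [h3]
  have h4 := LinearMap.congr_fun hg (Submodule.Quotient.mk ⟨(x, f), h2⟩)
  rw [LinearMap.comp_apply, Submodule.liftQ_apply, Submodule.liftQ_apply] at h4
  refine Eq.trans ?_ h4
  change g (N.mkQ _) = g (N.mkQ _)
  congr 2
  exact Subtype.ext h1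

section bimodMap
variable (K : Type*) {T N M N' M' : Type*} [CommRing K] [CommRing T] [Algebra K T]
  [AddCommGroup N] [Module K N] [Module T N] [IsScalarTower K T N]
  [AddCommGroup M] [Module K M] [Module T M] [IsScalarTower K T M]
  [AddCommGroup N'] [Module K N'] [Module T N'] [IsScalarTower K T N']
  [AddCommGroup M'] [Module K M'] [Module T M'] [IsScalarTower K T M']

attribute [local instance] bimod bimod_tower

/-- Functoriality of the two-sided module of linear maps. -/
noncomputable def bimodMap (a : N' →ₗ[T] N) (b : M →ₗ[T] M') :
    (N →ₗ[K] M) →ₗ[T ⊗[K] T] (N' →ₗ[K] M') where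
  toFun w := b.restrictScalars K ∘ₗ w ∘ₗ a.restrictScalars K
  map_add' w w' := by ext; simp
  map_smul' r w := by
    induction r using TensorProduct.induction_on with
    | zero => ext; simp
    | add r r' h h' =>
      ext x
      have h1 := LinearMap.congr_fun h x
      have h2 := LinearMap.congr_fun h' x
      simp only [RingHom.id_apply, LinearMap.comp_apply, LinearMap.restrictScalars_apply] at h1 h2 ⊢
      rw [add_smul, add_smul, LinearMap.add_apply, LinearMap.add_apply, map_add, h1, h2]
    | tmul x y =>
      ext z
      simp only [RingHom.id_apply, LinearMap.comp_apply, LinearMap.restrictScalars_apply,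
        tmul_smul_apply, map_smul]
end bimodMap

section socleH
variable {K T : Type u} [CommRing K] [CommRing T] [Algebra K T] {M : Type u}
  [AddCommGroup M] [Module K M] [Module T M] [IsScalarTower K T M]

attribute [local instance] bimod bimod_tower

lemma hasSocle_mH_two_of_maps [IsDomain K] [IsPrincipalIdealRing K] [Module.Free K T]
    (F : FreeRes T M) [Module.Finite K M] [IsNoetherian (T ⊗[K] T) (mH (envA K F.A) (T →ₗ[K] M) 0)]
    [IsArtinian (T ⊗[K] T) (mH (envA K F.A) (T →ₗ[K] M) 0)] (p : K) (hp0 : p ≠ 0)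
    (hp : (Ideal.span {p}).IsMaximal) {D : Type u} [AddCommGroup D] [Module K D] [Module T D]
    [IsScalarTower K T D] [Nontrivial D] (hpD : ∀ f : D, p • f = 0) (j : D →ₗ[T] M)
    (hj : Function.Injective j) (π : M →ₗ[T] D) (hπ : Function.Surjective π) :
    HasSocle (socI T p) (mH (envA K F.A) (T →ₗ[K] M) 0) := by
  let ε := Fintype.linearCombination T F.e
  let P0 := Fin (F.c 0) → T
  let P1 := Fin (F.c 1) → T
  let Y : Submodule T (P1 × P0 × D) :=
    LinearMap.eqLocus (act (F.A 0) T ∘ₗ LinearMap.fst T P1 (P0 × D))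
      (algebraMap K T p • (LinearMap.fst T P0 D ∘ₗ LinearMap.snd T P1 (P0 × D))) ⊓
    LinearMap.eqLocus (ε ∘ₗ LinearMap.fst T P0 D ∘ₗ LinearMap.snd T P1 (P0 × D))
      (j ∘ₗ LinearMap.snd T P0 D ∘ₗ LinearMap.snd T P1 (P0 × D))
  have hY1 (y : Y) : act (F.A 0) T y.1.1 = p • y.1.2.1 := y.2.1.trans (algebraMap_smul T p _)
  have hY2 (y : Y) : ε y.1.2.1 = j y.1.2.2 := y.2.2
  let Θ0 : (Fin (F.c 1) → (T →ₗ[K] M)) →ₗ[T ⊗[K] T] (Y →ₗ[K] D) :=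
    ∑ k, bimodMap K (LinearMap.proj k ∘ₗ LinearMap.fst T P1 (P0 × D) ∘ₗ Y.subtype) π ∘ₗ
      LinearMap.proj k
  have hΘ0 (φ) (y : Y) : Θ0 φ y = π (sumHom _ φ y.1.1) := by
    simp only [Θ0, LinearMap.sum_apply, sumHom_apply, map_sum]
    rfl
  let Θ : mH (envA K F.A) (T →ₗ[K] M) 0 →ₗ[T ⊗[K] T] (Y →ₗ[K] D) :=
    Submodule.liftQ _ (Θ0 ∘ₗ (LinearMap.ker (mδ (envA K F.A) (T →ₗ[K] M) 1)).subtype) (by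
      rintro ⟨φ, hφ⟩ ⟨a, ha⟩
      change mδ (envA K F.A) (T →ₗ[K] M) 0 a = φ at ha
      rw [LinearMap.mem_ker, LinearMap.comp_apply, Submodule.subtype_apply]
      refine LinearMap.ext fun y => ?_
      refine (hΘ0 φ y).trans ?_
      rw [← ha, sumHom_mδ, hY1, map_smul, ← algebraMap_smul T p, map_smul, algebraMap_smul,
        hpD]
      rfl)
  have hΘ (φ) (hφ) : Θ (MidHom.mk (mδ (envA K F.A) (T →ₗ[K] M) 0)
    (mδ (envA K F.A) (T →ₗ[K] M) 1) φ hφ) = Θ0 φ := rfl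
  let τ : Y →ₗ[K] D :=
    (LinearMap.snd T P0 D ∘ₗ LinearMap.snd T P1 (P0 × D) ∘ₗ Y.subtype).restrictScalars K
  have hτ : τ ∈ LinearMap.range Θ := by
    obtain ⟨ψ, hψ⟩ := exists_syzygy_hom (ε.restrictScalars K) F.surj (j.restrictScalars K) hj
      (π.restrictScalars K) hπ p hp0 hp hpD
    let Φ : P1 →ₗ[K] M := ψ ∘ₗ LinearMap.codRestrict _ ((act (F.A 0) T).restrictScalars K)
      (fun x => F.exact_zero.apply_apply_eq_zero x)
    obtain ⟨φ, hφ⟩ := (sumHom (K := K) (M := M) (F.c 1)).surjective Φ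
    have hφ0 : mδ (envA K F.A) (T →ₗ[K] M) 1 φ = 0 := by
      apply (sumHom (F.c 2)).injective
      refine LinearMap.ext fun x => ?_
      rw [sumHom_mδ, hφ, map_zero]
      refine (congrArg ψ ?_).trans (map_zero ψ)
      exact Subtype.ext ((F.exact_succ 0).apply_apply_eq_zero x)
    refine ⟨MidHom.mk _ _ φ hφ0, ?_⟩
    rw [hΘ]
    refine LinearMap.ext fun y => ?_
    rw [hΘ0, hφ]
    exact hψ _ _ _ (hY1 y) (hY2 y)
  have hτ0 : τ ≠ 0 := by
    obtain ⟨f, hf⟩ := exists_ne (0 : D)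
    obtain ⟨x, hx⟩ := F.surj (j f)
    obtain ⟨y, hy⟩ := (F.exact_zero (algebraMap K T p • x)).1 (by
      rw [map_smul, hx, ← map_smul, algebraMap_smul, hpD, map_zero])
    intro h0
    exact hf (LinearMap.congr_fun h0 ⟨(y, x, f), hy, hx⟩)
  have hs : HasSocle (socI T p) (LinearMap.range Θ) := by
    refine ⟨⟨τ, hτ⟩, fun h => hτ0 (congrArg Subtype.val h), fun a ha => Subtype.ext ?_⟩
    refine smul_eq_zero_of_mem_socI (h := τ) (fun a => ?_) ?_ a ha
    · refine LinearMap.ext fun y => ?_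
      rw [comEl_smul_apply]
      exact sub_self _
    · exact LinearMap.ext fun y => hpD _
  exact hasSocle_of_smul_top_ne_top (smul_top_ne_top_of_surjective Θ.rangeRestrict
    Θ.surjective_rangeRestrict hs.smul_top_ne_top)
end socleH

/-- A nontrivial finite module of finite length over a central subring has a residue field as
both a submodule and a quotient. -/
lemma exists_residue_sub_quot {K T M : Type u} [CommRing K] [CommRing T] [Algebra K T]
    [IsNoetherianRing T] [AddCommGroup M] [Module K M] [Module T M] [IsScalarTower K T M]
    [Module.Finite T M] [Nontrivial M] (hM : Module.length K M ≠ ⊤) :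
    ∃ 𝔭 : Ideal T, 𝔭.IsMaximal ∧ (∃ j : (T ⧸ 𝔭) →ₗ[T] M, Function.Injective j) ∧
      ∃ π : M →ₗ[T] (T ⧸ 𝔭), Function.Surjective π := by
  obtain ⟨𝔭, h𝔭⟩ := associatedPrimes.nonempty T M
  have hann : Module.annihilator T M ≤ 𝔭 := by
    rw [← Submodule.annihilator_top]; exact IsAssociatedPrime.annihilator_le h𝔭
  obtain ⟨hprime, x, hx⟩ := (isAssociatedPrime_iff).1 h𝔭
  have hx' (a : T) : a ∈ 𝔭 ↔ a • x = 0 := by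
    rw [hx, Submodule.mem_colon_singleton]; simp
  let j : (T ⧸ 𝔭) →ₗ[T] M := Submodule.liftQ 𝔭 (LinearMap.toSpanSingleton T M x)
    (fun a ha => by simpa using (hx' a).1 ha)
  have hj : Function.Injective j := by
    rw [← LinearMap.ker_eq_bot, Submodule.ker_liftQ_eq_bot]
    intro a ha
    exact (hx' a).2 (by simpa using ha)
  have hart : IsArtinian K M :=
    (isFiniteLength_iff_isNoetherian_isArtinian.1 (Module.length_ne_top_iff.1 hM)).2
  have hartD : IsArtinian K (T ⧸ 𝔭) := isArtinian_of_injective (j.restrictScalars K) hj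
  have : IsArtinianRing (T ⧸ 𝔭) := isArtinian_of_tower K hartD
  have hmax : 𝔭.IsMaximal := Ideal.Quotient.maximal_of_isField _ (IsArtinianRing.isField_of_isDomain _)
  refine ⟨𝔭, hmax, ⟨j, hj⟩, ?_⟩
  have hne : 𝔭 • (⊤ : Submodule T M) ≠ ⊤ := by
    intro h
    obtain ⟨r, hr, hr'⟩ := Submodule.exists_sub_one_mem_and_smul_eq_zero_of_fg_of_le_smul 𝔭 ⊤
      Module.Finite.fg_top h.ge
    refine hprime.ne_top ((Ideal.eq_top_iff_one _).2 ?_)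
    have : r ∈ 𝔭 := hann (Module.mem_annihilator.2 fun m => hr' m trivial)
    simpa using sub_mem this hr
  obtain ⟨N, hN, hle⟩ := (eq_top_or_exists_le_coatom (𝔭 • (⊤ : Submodule T M))).resolve_left hne
  have : IsSimpleModule T (M ⧸ N) := (isSimpleModule_iff_isCoatom).2 hN
  obtain ⟨I, hI, ⟨e⟩⟩ := isSimpleModule_iff_quot_maximal.1 this
  have h𝔭I : 𝔭 = I := by
    refine hmax.eq_of_le hI.ne_top fun a ha => ?_
    obtain ⟨m, hm⟩ := Submodule.mkQ_surjective N (e.symm (Ideal.Quotient.mk I 1))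
    have h1 : a • N.mkQ m = 0 := by
      rw [← map_smul]
      exact (Submodule.Quotient.mk_eq_zero _).2 (hle (Submodule.smul_mem_smul ha trivial))
    rw [hm, ← map_smul, LinearEquiv.map_eq_zero_iff] at h1
    refine Ideal.Quotient.eq_zero_iff_mem.1 ?_
    simpa [Algebra.smul_def] using h1
  subst h𝔭I
  exact ⟨e.toLinearMap ∘ₗ N.mkQ, e.surjective.comp (Submodule.mkQ_surjective _)⟩

attribute [local instance] bimod bimod_tower

lemma HasSocle.of_linearEquiv {Γ : Type*} [CommRing Γ] {I : Ideal Γ} {H H' : Type*}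
    [AddCommGroup H] [Module Γ H] [AddCommGroup H'] [Module Γ H'] (e : H ≃ₗ[Γ] H')
    (h : HasSocle I H) : HasSocle I H' := by
  obtain ⟨x, hx, hx'⟩ := h
  exact ⟨e x, by simpa using hx, fun a ha => by rw [← map_smul, hx' a ha, map_zero]⟩

lemma mH_killedBy_zero {Γ W : Type*} [CommRing Γ] [AddCommGroup W] [Module Γ W] (t : ℕ → Γ)
    {C : ℕ → ℕ} (A : ∀ n, Matrix (Fin (C n)) (Fin (C (n + 1))) Γ) (n : ℕ) :
    Nonempty (mH A W n ≃ₗ[Γ] mH A (killedBy W t 0) n) := by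
  let e : W ≃ₗ[Γ] killedBy W t 0 :=
    { LinearMap.codRestrict (killedBy W t 0) LinearMap.id (fun w l hl => (Nat.not_lt_zero l hl).elim) with
      invFun := Subtype.val
      left_inv := fun _ => rfl
      right_inv := fun _ => rfl }
  exact MidHom.congr _ _ _ _ (LinearEquiv.piCongrRight fun _ => e)
    (LinearEquiv.piCongrRight fun _ => e) (LinearEquiv.piCongrRight fun _ => e)
    (fun x => (mδ_postc A e.toLinearMap n x).symm)
    (fun x => (mδ_postc A e.toLinearMap (n + 1) x).symm)

section star
variable {K T S : Type u} [CommRing K] [CommRing T] [CommRing S] [Algebra K T] [Algebra T S]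
  [Algebra K S] [IsScalarTower K T S] {M : Type u}
  [AddCommGroup M] [Module K M] [Module T M] [Module S M] [IsScalarTower K T M]
  [IsScalarTower T S M] [IsScalarTower K S M]

lemma padA_mul_eq_zero {R : Type*} [CommRing R] {c : ℕ → ℕ}
    (A : ∀ n, Matrix (Fin (c n)) (Fin (c (n + 1))) R) (hA : ∀ n, A n * A (n + 1) = 0) (n : ℕ) :
    padA A n * padA A (n + 1) = 0 := by
  cases n with
  | zero => exact Matrix.zero_mul _
  | succ n => exact hA n

lemma FreeRes.mul_eq_zero {R : Type u} [CommRing R] {M : Type u} [AddCommGroup M] [Module R M]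
    (F : FreeRes R M) (n : ℕ) : F.A n * F.A (n + 1) = 0 :=
  matrix_mul_eq_zero_of_act fun x => (F.exact_succ n).apply_apply_eq_zero x

lemma envA_mul_eq_zero {c : ℕ → ℕ}
    (A : ∀ n, Matrix (Fin (c n)) (Fin (c (n + 1))) T) (hA : ∀ n, A n * A (n + 1) = 0) (n : ℕ) :
    envA K A n * envA K A (n + 1) = 0 := by
  rw [envA, envA, ← Matrix.map_mul, hA, Matrix.map_zero _ (map_zero _)]

lemma mH_killedBy_equiv {s : ℕ} [Module (MvPolynomial (Fin s) K) M]
    [IsScalarTower K (MvPolynomial (Fin s) K) M] [Algebra (MvPolynomial (Fin s) K) S]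
    [IsScalarTower (MvPolynomial (Fin s) K) S M]
    {c : ℕ → ℕ} (A : ∀ n, Matrix (Fin (c n)) (Fin (c (n + 1))) (MvPolynomial (Fin s) K)) (n : ℕ) :
    Nonempty (mH (envA K A) (killedBy (MvPolynomial (Fin s) K →ₗ[K] M) (comX s K) s) n ≃ₗ[K]
      mH (fun n => (A n).map (algebraMap (MvPolynomial (Fin s) K) S)) M n) := by
  have key (n : ℕ) (x : Fin (c n) → killedBy (MvPolynomial (Fin s) K →ₗ[K] M) (comX s K) s) :
      LinearEquiv.piCongrRight (fun _ => killedByEquiv) (mδ (envA K A) _ n x) =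
      mδ (fun n => (A n).map (algebraMap (MvPolynomial (Fin s) K) S)) M n
        (LinearEquiv.piCongrRight (fun _ => killedByEquiv) x) := by
    change _ = act _ M _
    rw [← Matrix.transpose_map, act_map_same]
    ext k
    simp only [LinearEquiv.piCongrRight_apply, act_apply, map_sum, envA, Matrix.transpose_apply,
      Matrix.map_apply]
    refine Finset.sum_congr rfl fun i _ => ?_
    have h1 := (killedBy_comX_iff (x i).1).1 (x i).2 (A n i k)
    change ((algebraMap _ (MvPolynomial (Fin s) K ⊗[K] MvPolynomial (Fin s) K) (A n i k)) •
      (x i).1) 1 = A n i k • (x i).1 1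
    rw [Algebra.TensorProduct.algebraMap_apply, tmul_smul_apply, one_smul, ← h1]
    simp
  exact MidHom.congr_restrictScalars K _ _ _ _ _ _ _ (key n) (key (n + 1))

lemma mH_padA_map {c : ℕ → ℕ} (A : ∀ n, Matrix (Fin (c n)) (Fin (c (n + 1))) T) (n : ℕ) :
    Nonempty (mH (fun n => (padA (padA A) n).map (algebraMap T S)) M (n + 1) ≃ₗ[S]
      mH (padA fun n => (A n).map (algebraMap T S)) M n) := by
  cases n with
  | zero =>
    refine MidHom.congr (mδ (fun n => (padA (padA A) n).map (algebraMap T S)) M 1)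
      (mδ (fun n => (padA (padA A) n).map (algebraMap T S)) M 2) _ _ (LinearEquiv.refl S _)
      (LinearEquiv.refl S _) (LinearEquiv.refl S _) (fun x => ?_) (fun x => rfl)
    have hx : x = 0 := funext fun k => k.elim0
    subst hx
    exact (map_zero (mδ (fun n => (padA (padA A) n).map (algebraMap T S)) M 1)).trans
      (map_zero (mδ (padA fun n => (A n).map (algebraMap T S)) M 0)).symm
  | succ n => exact ⟨LinearEquiv.refl S _⟩

set_option maxHeartbeats 1000000 in
/-- Nonvanishing of self-extensions over a quotient of a flat algebra over a polynomial ring by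
one nonzerodivisor, for modules of finite length over the coefficients. -/
theorem extMod_self_nonzero_of_flat_polynomial [IsDomain K] [IsPrincipalIdealRing K] {s : ℕ}
    [Module (MvPolynomial (Fin (s + 1)) K) M] [IsScalarTower K (MvPolynomial (Fin (s + 1)) K) M]
    [Algebra (MvPolynomial (Fin (s + 1)) K) S] [Module.Flat (MvPolynomial (Fin (s + 1)) K) S]
    [IsScalarTower (MvPolynomial (Fin (s + 1)) K) S M]
    {R : Type u} [CommRing R] [Algebra S R] [Module R M] [IsScalarTower S R M]
    (hs : Function.Surjective (algebraMap S R)) {f : S}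
    (hk : ∀ a, algebraMap S R a = 0 ↔ f ∣ a) (hf : f ∈ nonZeroDivisors S)
    [IsNoetherianRing S] [Nontrivial M]
    (hi : IsBaseChange S (LinearMap.id : M →ₗ[MvPolynomial (Fin (s + 1)) K] M))
    (hM : Module.length K M ≠ ⊤) (p : K) (N : ℕ) (hp : ∀ m : M, p ^ N • m = 0) (e : ℕ)
    (he : e = 0 ∨ (e = 1 ∧ p ≠ 0 ∧ (Ideal.span {p}).IsMaximal)) (i : ℕ) (his : i ≤ e + s) :
    ¬ Subsingleton (extMod R i M M) := by
  let T := MvPolynomial (Fin (s + 1)) K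
  have hKfl := isFiniteLength_iff_isNoetherian_isArtinian.1 (Module.length_ne_top_iff.1 hM)
  have hKn := hKfl.1
  have : Module.Finite K M := inferInstance
  have : Module.Finite T M := Module.Finite.of_restrictScalars_finite K T M
  have : Module.Finite S M := Module.Finite.of_restrictScalars_finite T S M
  have : Module.Finite R M := Module.Finite.of_restrictScalars_finite S R M
  have : IsNoetherianRing R := isNoetherianRing_of_surjective S R (algebraMap S R) hs
  obtain ⟨F⟩ := FreeRes.nonempty (R := R) (M := M)
  obtain ⟨G⟩ := FreeRes.nonempty (R := T) (M := M)
  obtain ⟨δ, τ, hδ, hc, hext⟩ := exists_totD_of_hypersurface hs hk hf F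
  let W := T →ₗ[K] M
  have hfin := length_mH_ne_top hM G
  have hsoc : ∀ n ≤ e, HasSocle (socI T p) (mH (envA K (padA (padA G.A))) W (n + 1)) := by
    intro n hn
    match n with
    | 0 => exact hasSocle_mH_one G p N hp
    | 1 =>
      obtain ⟨-, hp0, hpm⟩ := he.resolve_left (by omega)
      obtain ⟨𝔭, h𝔭, ⟨j, hj⟩, π, hπ⟩ := exists_residue_sub_quot (T := T) hM
      have hNA := isNoetherian_isArtinian_of_length (Λ := T ⊗[K] T) K (hfin 2)
      have hNA1 : IsNoetherian (T ⊗[K] T) (mH (envA K G.A) W 0) := hNA.1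
      have hNA2 : IsArtinian (T ⊗[K] T) (mH (envA K G.A) W 0) := hNA.2
      have hp𝔭 : algebraMap K T p ∈ 𝔭 := by
        refine h𝔭.isPrime.mem_of_pow_mem N ?_
        rw [← Ideal.Quotient.eq_zero_iff_mem]
        refine hj ?_
        have h1 : (Ideal.Quotient.mk 𝔭 (algebraMap K T p ^ N)) =
            algebraMap K T (p ^ N) • (Ideal.Quotient.mk 𝔭 1) := by
          rw [Algebra.smul_def, map_one, mul_one, map_pow (algebraMap K T), map_pow]; exact
            (map_pow _ _ _).symm
        rw [h1, map_smul, algebraMap_smul, hp, map_zero]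
      have : Nontrivial (T ⧸ 𝔭) := Ideal.Quotient.nontrivial_iff.2 h𝔭.ne_top
      refine hasSocle_mH_two_of_maps G p hp0 hpm (D := T ⧸ 𝔭) (fun x => ?_) j hj π hπ
      rw [← algebraMap_smul T p x, Algebra.smul_def]
      rw [show algebraMap T (T ⧸ 𝔭) (algebraMap K T p) = 0 from
        Ideal.Quotient.eq_zero_iff_mem.2 hp𝔭, zero_mul]
    | n + 2 => omega
  have hA : ∀ n, envA K (padA (padA G.A)) n * envA K (padA (padA G.A)) (n + 1) = 0 :=
    envA_mul_eq_zero _ (padA_mul_eq_zero _ (padA_mul_eq_zero _ G.mul_eq_zero))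
  obtain ⟨k, hk0, hktop, hkpos, hklen⟩ := exists_tower_lengths (W := W) (t := comX (s + 1) K) K hA
    rfl s (fun j hj w hw => exists_comX_smul_eq j hj w hw) (I := socI T p)
    (fun j => comX_mem_socI p j) e
    (fun n => by
      obtain ⟨e⟩ := mH_killedBy_zero (W := W) (comX (s + 1) K) (envA K (padA (padA G.A))) n
      rw [← (e.restrictScalars K).length_eq]
      exact hfin n)
    (fun n hn => by
      obtain ⟨e⟩ := mH_killedBy_zero (W := W) (comX (s + 1) K) (envA K (padA (padA G.A))) (n + 1)
      exact (hsoc n hn).of_linearEquiv e)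
  have hQ (n : ℕ) : Module.length K (MidHom (totD δ τ (n + 1)) (totD δ τ (n + 2))) =
      k n + k (n + 1) := by
    obtain ⟨e1⟩ := hext n
    obtain ⟨e2⟩ := (G.baseChange hi).extMod_equiv_pad M n
    obtain ⟨e3⟩ := mH_padA_map (S := S) (M := M) G.A n
    obtain ⟨e4⟩ := mH_killedBy_equiv (S := S) (M := M) (padA (padA G.A)) (n + 1)
    have e5 := e1.symm.trans (e2.trans e3.symm)
    have e6 := (e5.restrictScalars K).trans e4.symm
    exact e6.length_eq.trans (hklen n)
  have hsub (n : ℕ) (h : Subsingleton (Fin (padC (padC (padC F.c)) (n + 1)) → M)) :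
      Module.length K (MidHom (δ n) (δ (n + 1))) = 0 := by
    rw [Module.length_eq_zero_iff, MidHom.subsingleton_iff]
    exact fun x _ => ⟨0, Subsingleton.elim _ _⟩
  have hpos := numeric_pos (t := fun n => Module.length K (MidHom (δ n) (δ (n + 1))))
    (r := fun n => Module.length K (LinearMap.range (chi δ τ hc n)))
    (Q := fun n => Module.length K (MidHom (totD δ τ (n + 1)) (totD δ τ (n + 2))))
    hk0 hktop
    (fun n => Module.length_le_of_surjective ((chi δ τ hc n).rangeRestrict.restrictScalars K)
      (LinearMap.surjective_rangeRestrict _))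
    (hsub 0 ⟨fun a b => funext fun k => k.elim0⟩)
    (hsub 1 ⟨fun a b => funext fun k => k.elim0⟩) hQ
    (fun n => length_tot δ τ K hc n) i
  intro hE
  refine hkpos i his (le_antisymm (hpos.trans (le_of_eq ?_)) zero_le)
  change Module.length K (MidHom (δ (i + 2)) (δ (i + 3))) = 0
  rw [Module.length_eq_zero_iff, MidHom.subsingleton_iff]
  obtain ⟨e⟩ := F.extMod_equiv_pad M i
  have h2 := MidHom.subsingleton_iff.1 (e.symm.toEquiv.subsingleton)
  intro x hx
  rw [hδ] at hx
  obtain ⟨y, hy⟩ := h2 x hx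
  exact ⟨y, (hδ _ _).trans hy⟩
end star

/-- Universal property of power series rings over a complete target. -/
lemma exists_mvPowerSeries_hom {P A : Type*} [CommRing P] [CommRing A] (I : Ideal A)
    [IsAdicComplete I A] (φ : P →+* A) {n : ℕ} (a : Fin n → A) (ha : ∀ i, a i ∈ I) :
    ∃ Φ : MvPowerSeries (Fin n) P →+* A, (∀ c, Φ (MvPowerSeries.C c) = φ c) ∧
      ∀ i, Φ (MvPowerSeries.X i) = a i := by
  let E : MvPolynomial (Fin n) P →+* A := MvPolynomial.eval₂Hom φ a
  have hle (k : ℕ) : MvPolynomial.idealOfVars (Fin n) P ^ k ≤ (I ^ k).comap E := by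
    rw [← Ideal.map_le_iff_le_comap, Ideal.map_pow]
    apply Ideal.pow_right_mono
    rw [MvPolynomial.idealOfVars, Ideal.map_span, Ideal.span_le]
    rintro _ ⟨_, ⟨i, rfl⟩, rfl⟩
    simpa [E] using ha i
  let F (k : ℕ) : MvPowerSeries (Fin n) P →+* A ⧸ I ^ k :=
    (Ideal.quotientMap (I ^ k) E (hle k)).comp
      (MvPowerSeries.truncTotalAlgHom (Fin n) P k : _ →+* _)
  have hF {k l : ℕ} (h : k ≤ l) : (Ideal.Quotient.factorPow I h).comp (F l) = F k := by
    ext s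
    change Ideal.Quotient.factorPow I h (Ideal.Quotient.mk _ (E _)) = Ideal.Quotient.mk _ (E _)
    change Ideal.Quotient.mk _ (E _) = Ideal.Quotient.mk _ (E _)
    rw [Ideal.Quotient.eq, ← map_sub]
    exact hle k (MvPowerSeries.truncTotal_sub_truncTotal_mem_pow_idealOfVars h le_rfl s)
  have key (p : MvPolynomial (Fin n) P) :
      IsAdicComplete.liftRingHom I F hF (p : MvPowerSeries (Fin n) P) = E p := by
    rw [← sub_eq_zero]
    refine IsHausdorff.haus (I := I) inferInstance _ fun k ↦ ?_
    rw [SModEq.zero, smul_eq_mul, Ideal.mul_top, ← Ideal.Quotient.eq_zero_iff_mem, map_sub,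
      IsAdicComplete.mk_liftRingHom, sub_eq_zero]
    have := (MvPowerSeries.truncTotalAlgHom (Fin n) P k).commutes p
    change Ideal.quotientMap (I ^ k) E (hle k)
      (MvPowerSeries.truncTotalAlgHom (Fin n) P k (algebraMap _ _ p)) = _
    rw [this]; rfl
  refine ⟨IsAdicComplete.liftRingHom I F hF, fun c ↦ ?_, fun i ↦ ?_⟩
  · have := key (MvPolynomial.C c)
    simpa [E] using this
  · have := key (MvPolynomial.X i)
    simpa [E] using this

/-- A finite module over a Noetherian adically complete ring is adically complete. -/
lemma isAdicComplete_of_finite {S : Type u} {M : Type u} [CommRing S] [IsNoetherianRing S] (J : Ideal S)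
    [IsAdicComplete J S] [AddCommGroup M] [Module S M] [Module.Finite S M] :
    IsAdicComplete J M := by
  rw [← AdicCompletion.of_bijective_iff]
  have h1 := AdicCompletion.ofTensorProduct_bijective_of_finite_of_isNoetherian J M
  have h2 := AdicCompletion.of_bijective J S
  let e : S ≃ₗ[S] AdicCompletion J S := AdicCompletion.ofLinearEquiv J S
  let g := (TensorProduct.lid S M).symm ≪≫ₗ TensorProduct.congr e (LinearEquiv.refl S M)
  have : (AdicCompletion.of J M : M → AdicCompletion J M) =
      AdicCompletion.ofTensorProduct J M ∘ g := by
    ext m n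
    have he : e 1 = 1 := rfl
    simp [g, he]
  rw [this]
  exact h1.comp g.bijective

/-- Nakayama's lemma for finiteness over an adically complete ring. -/
lemma finite_of_finite_quotient_adic {P : Type u} {N : Type u} [CommRing P] [IsNoetherianRing P] (J : Ideal P)
    [IsAdicComplete J P] [AddCommGroup N] [Module P N] [IsHausdorff J N]
    (h : Module.Finite P (N ⧸ (J • ⊤ : Submodule P N))) : Module.Finite P N := by
  obtain ⟨n, f, hf⟩ := Module.Finite.exists_fin' P (N ⧸ (J • ⊤ : Submodule P N))
  obtain ⟨g, hg⟩ := Module.projective_lifting_property (Submodule.mkQ (J • ⊤ : Submodule P N)) f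
    (Submodule.mkQ_surjective _)
  have := isAdicComplete_of_finite (M := Fin n → P) J
  have : Function.Surjective g := surjective_of_mkQ_comp_surjective (I := J) (by rw [hg]; exact hf)
  exact Module.Finite.of_surjective g this

instance flat_mvPowerSeries {B : Type u} [CommRing B] [IsNoetherianRing B] (m : ℕ) :
    Module.Flat (MvPolynomial (Fin m) B) (MvPowerSeries (Fin m) B) :=
  Module.Flat.of_linearEquiv (MvPowerSeries.toAdicCompletionAlgEquiv (Fin m) B).toLinearEquiv

lemma mvPowerSeries_sub_truncTotal_mem {B : Type u} [CommRing B] {m : ℕ}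
    (s : MvPowerSeries (Fin m) B) (n : ℕ) :
    s - (MvPowerSeries.truncTotal n s : MvPolynomial (Fin m) B) ∈
      (MvPolynomial.idealOfVars (Fin m) B ^ n • ⊤ :
        Submodule (MvPolynomial (Fin m) B) (MvPowerSeries (Fin m) B)) := by
  set e := (MvPowerSeries.toAdicCompletionAlgEquiv (Fin m) B).toLinearEquiv with he
  have h := AdicCompletion.pow_smul_top_eq_ker_eval (M := MvPolynomial (Fin m) B) (n := n)
    (MvPolynomial.idealOfVars_fg (Fin m) B)
  have h1 : e (s - (MvPowerSeries.truncTotal n s : MvPolynomial (Fin m) B)) ∈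
      (MvPolynomial.idealOfVars (Fin m) B ^ n • ⊤ :
        Submodule (MvPolynomial (Fin m) B) (AdicCompletion (MvPolynomial.idealOfVars (Fin m) B) (MvPolynomial (Fin m) B))) := by
    rw [h, LinearMap.mem_ker, map_sub, map_sub, sub_eq_zero]
    have h2 : e ((MvPowerSeries.truncTotal n s : MvPolynomial (Fin m) B) : MvPowerSeries (Fin m) B) =
      AdicCompletion.of _ _ (MvPowerSeries.truncTotal n s) := MvPowerSeries.toAdicCompletion_coe _
    rw [h2]
    exact MvPowerSeries.toAdicCompletion_apply_eq_mk_truncTotal (n := n) (p := s)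
  have h3 := Submodule.mem_map_of_mem (f := e.symm.toLinearMap) h1
  rw [Submodule.map_smul''] at h3
  have h4 : e.symm.toLinearMap (e (s - (MvPowerSeries.truncTotal n s : MvPolynomial (Fin m) B))) =
    s - (MvPowerSeries.truncTotal n s : MvPolynomial (Fin m) B) := e.symm_apply_apply _
  rw [h4] at h3
  exact Submodule.smul_mono le_rfl le_top h3

/-- A finite module over the polynomial ring on which power series act is unchanged by base
change to the power series ring. -/
lemma isBaseChange_mvPowerSeries {B M : Type u} [CommRing B] [IsNoetherianRing B] {m : ℕ}
    [AddCommGroup M] [Module (MvPolynomial (Fin m) B) M] [Module (MvPowerSeries (Fin m) B) M]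
    [IsScalarTower (MvPolynomial (Fin m) B) (MvPowerSeries (Fin m) B) M]
    [Module.Finite (MvPolynomial (Fin m) B) M] :
    IsBaseChange (MvPowerSeries (Fin m) B)
      (LinearMap.id : M →ₗ[MvPolynomial (Fin m) B] M) := by
  set T := MvPolynomial (Fin m) B
  set S := MvPowerSeries (Fin m) B
  have : Module.Finite S M := Module.Finite.of_restrictScalars_finite T S M
  set I := MvPolynomial.idealOfVars (Fin m) B with hI
  have hmap : I.map (algebraMap T S) = Ideal.span (Set.range MvPowerSeries.X) := by
    rw [hI, MvPolynomial.idealOfVars, Ideal.map_span, ← Set.range_comp]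
    congr 2; ext1 i
    exact MvPolynomial.coe_X i
  have hc : IsAdicComplete I M := by
    have : IsAdicComplete (I.map (algebraMap T S)) S := by rw [hmap]; infer_instance
    have := isAdicComplete_of_finite (M := M) (I.map (algebraMap T S))
    rwa [IsAdicComplete.map_algebraMap_iff] at this
  have hb := AdicCompletion.of_bijective I M
  have ht := AdicCompletion.ofTensorProduct_bijective_of_finite_of_isNoetherian I M
  let e : S ≃ₗ[T] AdicCompletion I T := (MvPowerSeries.toAdicCompletionAlgEquiv (Fin m) B).toLinearEquiv
  let g : S ⊗[T] M ≃ₗ[T] AdicCompletion I T ⊗[T] M := TensorProduct.congr e (LinearEquiv.refl T M)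
  have key (x : S ⊗[T] M) : AdicCompletion.of I M
      (LinearMap.liftBaseChange S (LinearMap.id : M →ₗ[T] M) x) =
      AdicCompletion.ofTensorProduct I M (g x) := by
    induction x with
    | zero => simp
    | add x y hx hy => simp only [map_add, hx, hy]
    | tmul s x =>
      refine AdicCompletion.ext fun n ↦ ?_
      have h1 : (e s).val n = Ideal.Quotient.mk _ (MvPowerSeries.truncTotal n s) :=
        MvPowerSeries.toAdicCompletion_apply_eq_mk_truncTotal (n := n) (p := s)
      have h2 : ((AdicCompletion.ofTensorProduct I M) (g (s ⊗ₜ x))).val n =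
          Submodule.mkQ _ ((MvPowerSeries.truncTotal n s : T) • x) := by
        change ((AdicCompletion.ofTensorProduct I M) (e s ⊗ₜ x)).val n = _
        rw [AdicCompletion.ofTensorProduct_tmul, AdicCompletion.smul_eval, h1]
        rfl
      rw [h2, AdicCompletion.of_apply, LinearMap.liftBaseChange_tmul, LinearMap.id_apply,
        ← sub_eq_zero, ← map_sub, Submodule.mkQ_apply, Submodule.Quotient.mk_eq_zero]
      have h3 := mvPowerSeries_sub_truncTotal_mem s n
      have h4 : s • x - (MvPowerSeries.truncTotal n s : T) • x =
          (LinearMap.toSpanSingleton S M x).restrictScalars T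
            (s - (MvPowerSeries.truncTotal n s : MvPolynomial (Fin m) B)) := by
        simp only [LinearMap.coe_restrictScalars, LinearMap.toSpanSingleton_apply, sub_smul]
        congr 1
        rw [← algebraMap_smul S (MvPowerSeries.truncTotal n s : T) x]
        congr 1
      rw [h4]
      have h5 := Submodule.mem_map_of_mem (f := (LinearMap.toSpanSingleton S M x).restrictScalars T) h3
      rw [Submodule.map_smul''] at h5
      exact Submodule.smul_mono le_rfl le_top h5
  change Function.Bijective (LinearMap.liftBaseChange S (LinearMap.id : M →ₗ[T] M))
  have hcomp : Function.Bijective (AdicCompletion.of I M ∘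
      LinearMap.liftBaseChange S (LinearMap.id : M →ₗ[T] M)) := by
    have : (AdicCompletion.of I M ∘ LinearMap.liftBaseChange S (LinearMap.id : M →ₗ[T] M)) =
      AdicCompletion.ofTensorProduct I M ∘ g := funext key
    rw [this]; exact ht.comp g.bijective
  exact (Function.Bijective.of_comp_iff' hb _).1 hcomp

/-- A finite module over a Noetherian local ring killed by a power of the maximal ideal has
finite length. -/
lemma length_ne_top_of_pow_smul_eq_zero {K M : Type u} [CommRing K] [IsNoetherianRing K] [IsLocalRing K]
    [AddCommGroup M] [Module K M] [Module.Finite K M] (p : K) (hp : maximalIdeal K = Ideal.span {p})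
    (N : ℕ) (h : ∀ m : M, p ^ N • m = 0) : Module.length K M ≠ ⊤ := by
  rcases N with _ | N
  · have : Subsingleton M := ⟨fun a b => by rw [← one_smul K a, ← one_smul K b]; simpa using (h a).trans (h b).symm⟩
    simp [Module.length_eq_zero]
  rw [Module.length_ne_top_iff, isFiniteLength_iff_isNoetherian_isArtinian]
  refine ⟨inferInstance, ?_⟩
  set I : Ideal K := Ideal.span {p ^ (N + 1)} with hI
  have hle : I ≤ maximalIdeal K := by
    rw [hI, Ideal.span_singleton_le_iff_mem, hp, pow_succ']
    exact Ideal.mul_mem_right _ _ (Ideal.mem_span_singleton_self p)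
  have hIM : Module.IsTorsionBySet K M I := fun m ⟨a, ha⟩ => by
    obtain ⟨c, rfl⟩ := Ideal.mem_span_singleton'.1 ha
    rw [mul_smul, h, smul_zero]
  let : Module (K ⧸ I) M := hIM.module
  have : IsScalarTower K (K ⧸ I) M := hIM.isScalarTower
  have : Nontrivial (K ⧸ I) := Ideal.Quotient.nontrivial_iff.2 (fun h => by
    rw [h] at hle; exact (maximalIdeal.isMaximal K).ne_top (top_le_iff.1 hle))
  have : IsLocalRing (K ⧸ I) := .of_surjective' (Ideal.Quotient.mk I) Ideal.Quotient.mk_surjective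
  have : IsArtinianRing (K ⧸ I) := by
    rw [isArtinianRing_iff_isNilpotent_maximalIdeal]
    refine ⟨N + 1, ?_⟩
    have : maximalIdeal (K ⧸ I) = Ideal.span {Ideal.Quotient.mk I p} := by
      rw [← IsLocalRing.map_maximalIdeal_of_surjective _ (Ideal.Quotient.mk_surjective (I := I)), hp, Ideal.map_span, Set.image_singleton]
    rw [this, Ideal.span_singleton_pow, ← map_pow, Ideal.Quotient.eq_zero_iff_mem.2 (Ideal.mem_span_singleton_self _)]
    simp
  have : Module.Finite (K ⧸ I) M := Module.Finite.of_restrictScalars_finite K _ M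
  have : IsArtinian (K ⧸ I) M := inferInstance
  exact (LinearMap.isArtinian_iff_of_bijective (σ := Ideal.Quotient.mk I) (⟨⟨id, fun _ _ => rfl⟩, fun _ _ => rfl⟩ : M →ₛₗ[Ideal.Quotient.mk I] M) Function.bijective_id).2 this

section
variable {S A : Type u} [CommRing S] [CommRing A] [Algebra S A] (V : Submonoid S)

lemma surjective_localization_algebraMapSubmonoid (hs : Function.Surjective (algebraMap S A)) :
    Function.Surjective (algebraMap (Localization V) (Localization (Algebra.algebraMapSubmonoid A V))) := by
  intro y
  obtain ⟨a, ⟨_, w, hw, rfl⟩, rfl⟩ := IsLocalization.exists_mk'_eq (Algebra.algebraMapSubmonoid A V) y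
  obtain ⟨s, rfl⟩ := hs a
  refine ⟨IsLocalization.mk' (Localization V) s ⟨w, hw⟩, ?_⟩
  rw [IsLocalization.algebraMap_mk' A]

lemma localization_algebraMap_eq_zero_iff {f : S} (hk : ∀ a, algebraMap S A a = 0 ↔ f ∣ a)
    (a : Localization V) :
    algebraMap (Localization V) (Localization (Algebra.algebraMapSubmonoid A V)) a = 0 ↔
      algebraMap S (Localization V) f ∣ a := by
  constructor
  · obtain ⟨s, w, rfl⟩ := IsLocalization.exists_mk'_eq V a
    intro h
    rw [IsLocalization.algebraMap_mk' A, IsLocalization.mk'_eq_zero_iff] at h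
    obtain ⟨⟨_, w', hw', rfl⟩, h⟩ := h
    rw [← map_mul, hk] at h
    have h2 := map_dvd (algebraMap S (Localization V)) h
    rw [map_mul, (IsLocalization.map_units (Localization V) ⟨w', hw'⟩).dvd_mul_left] at h2
    rw [IsLocalization.mk'_eq_mul_mk'_one]
    exact Dvd.dvd.mul_right h2 _
  · rintro ⟨c, rfl⟩
    rw [map_mul, ← IsScalarTower.algebraMap_apply, IsScalarTower.algebraMap_apply S A, (hk f).2 dvd_rfl,
      map_zero, zero_mul]

end

set_option maxHeartbeats 400000 in

/-- Nonvanishing of self-extensions, reduced to a localization of the coefficient ring at a prime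
generated by one element. -/
theorem extMod_self_nonzero_of_localization {B A M : Type u} {s : ℕ} [CommRing B] [IsDomain B]
    [IsNoetherianRing B] [CommRing A] [IsNoetherianRing A] [Algebra (MvPowerSeries (Fin (s + 1)) B) A] [Algebra B A]
    [IsScalarTower B (MvPowerSeries (Fin (s + 1)) B) A] [AddCommGroup M] [Module A M] [Module B M]
    [IsScalarTower B A M] [Module.Finite B M]

    {f : MvPowerSeries (Fin (s + 1)) B}
    (hk : ∀ a, algebraMap (MvPowerSeries (Fin (s + 1)) B) A a = 0 ↔ f ∣ a) (hf : f ≠ 0)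
    (ϖ : B) (hprime : (Ideal.span {ϖ}).IsPrime)
    (hsupp : ∀ b : B, (∀ m : M, b • m = 0) → ϖ ∣ b) (e : ℕ)
    (he : (e = 0 ∧ ϖ = 0) ∨ (e = 1 ∧ ϖ ≠ 0 ∧ ∃ b : B, b ≠ 0 ∧ ∀ m : M, b • m = 0))
    (K S' A' : Type u) [CommRing K] [Algebra B K] [IsLocalization.AtPrime K (Ideal.span {ϖ})]
    [CommRing S'] [Algebra (MvPowerSeries (Fin (s + 1)) B) S'] [IsLocalization (Algebra.algebraMapSubmonoid (MvPowerSeries (Fin (s + 1)) B) (Ideal.span {ϖ}).primeCompl) S']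
    [Algebra B S'] [IsScalarTower B (MvPowerSeries (Fin (s + 1)) B) S'] [Algebra K S'] [IsScalarTower B K S']
    [CommRing A'] [Algebra A A'] [Algebra S' A'] [Algebra (MvPowerSeries (Fin (s + 1)) B) A'] [IsScalarTower (MvPowerSeries (Fin (s + 1)) B) A A'] [IsScalarTower (MvPowerSeries (Fin (s + 1)) B) S' A']
    [IsLocalization (Algebra.algebraMapSubmonoid A (Ideal.span {ϖ}).primeCompl) A']
    (hs' : Function.Surjective (algebraMap S' A'))
    (hk' : ∀ a, algebraMap S' A' a = 0 ↔ algebraMap (MvPowerSeries (Fin (s + 1)) B) S' f ∣ a)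
    (i : ℕ) (hi : i + 1 ≤ e + s) : ¬ Subsingleton (extMod A (i + 1) M M) := by
  have : IsLocalRing K := IsLocalization.AtPrime.isLocalRing K (Ideal.span {ϖ})
  let : Algebra (MvPolynomial (Fin (s + 1)) B) S' := ((algebraMap (MvPowerSeries (Fin (s + 1)) B) S').comp (algebraMap (MvPolynomial (Fin (s + 1)) B) (MvPowerSeries (Fin (s + 1)) B))).toAlgebra
  have : IsScalarTower (MvPolynomial (Fin (s + 1)) B) (MvPowerSeries (Fin (s + 1)) B) S' := .of_algebraMap_eq' rfl
  have : IsScalarTower B (MvPolynomial (Fin (s + 1)) B) S' := .of_algebraMap_eq' <| by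
    rw [IsScalarTower.algebraMap_eq (MvPolynomial (Fin (s + 1)) B) (MvPowerSeries (Fin (s + 1)) B) S', RingHom.comp_assoc, ← IsScalarTower.algebraMap_eq B (MvPolynomial (Fin (s + 1)) B) (MvPowerSeries (Fin (s + 1)) B), ← IsScalarTower.algebraMap_eq]
  have : IsDomain (MvPowerSeries (Fin (s + 1)) B) := NoZeroDivisors.to_isDomain _
  let : Algebra (MvPolynomial (Fin (s + 1)) B) (MvPolynomial (Fin (s + 1)) K) := MvPolynomial.algebraMvPolynomial
  let : Algebra (MvPolynomial (Fin (s + 1)) K) S' := (MvPolynomial.aeval (fun j => algebraMap (MvPowerSeries (Fin (s + 1)) B) S' (MvPowerSeries.X j))).toAlgebra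
  have hTT' (j) : algebraMap (MvPolynomial (Fin (s + 1)) B) (MvPolynomial (Fin (s + 1)) K) (MvPolynomial.X j) = MvPolynomial.X j :=
    MvPolynomial.map_X _ j
  have hTTC (c) : algebraMap (MvPolynomial (Fin (s + 1)) B) (MvPolynomial (Fin (s + 1)) K) (MvPolynomial.C c) = MvPolynomial.C (algebraMap B K c) :=
    MvPolynomial.map_C _ c
  have : IsScalarTower (MvPolynomial (Fin (s + 1)) B) (MvPolynomial (Fin (s + 1)) K) S' := .of_algebraMap_eq' <| by
    refine MvPolynomial.ringHom_ext (fun c => ?_) (fun j => ?_)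
    · have h1 : algebraMap (MvPolynomial (Fin (s + 1)) K) S' (MvPolynomial.C (algebraMap B K c)) = algebraMap K S' (algebraMap B K c) :=
        MvPolynomial.aeval_C _ _
      rw [RingHom.comp_apply, hTTC, h1, ← IsScalarTower.algebraMap_apply B K S',
        IsScalarTower.algebraMap_apply (MvPolynomial (Fin (s + 1)) B) (MvPowerSeries (Fin (s + 1)) B) S', IsScalarTower.algebraMap_apply B (MvPowerSeries (Fin (s + 1)) B) S']
      exact congrArg _ (MvPolynomial.coe_C c)
    · have h1 : algebraMap (MvPolynomial (Fin (s + 1)) K) S' (MvPolynomial.X j) = algebraMap (MvPowerSeries (Fin (s + 1)) B) S' (MvPowerSeries.X j) :=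
        MvPolynomial.aeval_X _ _
      rw [RingHom.comp_apply, hTT', h1, IsScalarTower.algebraMap_apply (MvPolynomial (Fin (s + 1)) B) (MvPowerSeries (Fin (s + 1)) B) S']
      congr 1
      exact MvPolynomial.coe_X j
  have : IsScalarTower K (MvPolynomial (Fin (s + 1)) K) S' := .of_algebraMap_eq' <| by
    ext c
    exact (MvPolynomial.aeval_C _ c).symm
  have : IsLocalization (Algebra.algebraMapSubmonoid (MvPolynomial (Fin (s + 1)) B) (Ideal.span {ϖ}).primeCompl) (MvPolynomial (Fin (s + 1)) K) := MvPolynomial.isLocalization (Ideal.span {ϖ}).primeCompl K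
  have : IsLocalization (Algebra.algebraMapSubmonoid (MvPowerSeries (Fin (s + 1)) B) (Algebra.algebraMapSubmonoid (MvPolynomial (Fin (s + 1)) B) (Ideal.span {ϖ}).primeCompl)) S' := by
    have : Algebra.algebraMapSubmonoid (MvPowerSeries (Fin (s + 1)) B) (Algebra.algebraMapSubmonoid (MvPolynomial (Fin (s + 1)) B) (Ideal.span {ϖ}).primeCompl) =
        Algebra.algebraMapSubmonoid (MvPowerSeries (Fin (s + 1)) B) (Ideal.span {ϖ}).primeCompl := by
      rw [Algebra.algebraMapSubmonoid, Algebra.algebraMapSubmonoid, Algebra.algebraMapSubmonoid,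
        IsScalarTower.algebraMap_eq B (MvPolynomial (Fin (s + 1)) B) (MvPowerSeries (Fin (s + 1)) B)]
      exact Submonoid.map_map (Ideal.span {ϖ}).primeCompl _ _
    rw [this]; infer_instance
  have : Module.Flat (MvPowerSeries (Fin (s + 1)) B) S' := IsLocalization.flat S' (Algebra.algebraMapSubmonoid (MvPowerSeries (Fin (s + 1)) B) (Ideal.span {ϖ}).primeCompl)
  have : Module.Flat (MvPolynomial (Fin (s + 1)) B) S' := Module.Flat.trans (MvPolynomial (Fin (s + 1)) B) (MvPowerSeries (Fin (s + 1)) B) S'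
  have : Module.Flat (MvPolynomial (Fin (s + 1)) K) S' :=
    (Module.flat_iff_of_isLocalization (MvPolynomial (Fin (s + 1)) K) (Algebra.algebraMapSubmonoid (MvPolynomial (Fin (s + 1)) B) (Ideal.span {ϖ}).primeCompl) S').2 inferInstance
  -- module structures
  obtain ⟨M', _, _, _, _, g, hg⟩ : ∃ (M' : Type u) (_ : AddCommGroup M') (_ : Module A M')
      (_ : Module A' M') (_ : IsScalarTower A A' M') (g : M →ₗ[A] M'), IsBaseChange A' g :=
    ⟨A' ⊗[A] M, inferInstance, inferInstance, inferInstance, inferInstance,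
      TensorProduct.mk A A' M 1, TensorProduct.isBaseChange A M A'⟩
  let : Module (MvPowerSeries (Fin (s + 1)) B) M := Module.compHom M (algebraMap (MvPowerSeries (Fin (s + 1)) B) A)
  have : IsScalarTower (MvPowerSeries (Fin (s + 1)) B) A M := .of_algebraMap_smul fun _ _ => rfl
  have : IsScalarTower B (MvPowerSeries (Fin (s + 1)) B) M := .of_algebraMap_smul fun b m => by
    rw [← algebraMap_smul A (algebraMap B (MvPowerSeries (Fin (s + 1)) B) b), ← IsScalarTower.algebraMap_apply, algebraMap_smul]
  let : Module (MvPolynomial (Fin (s + 1)) B) M := Module.compHom M (algebraMap (MvPolynomial (Fin (s + 1)) B) (MvPowerSeries (Fin (s + 1)) B))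
  have : IsScalarTower (MvPolynomial (Fin (s + 1)) B) (MvPowerSeries (Fin (s + 1)) B) M := .of_algebraMap_smul fun _ _ => rfl
  have : IsScalarTower B (MvPolynomial (Fin (s + 1)) B) M := .of_algebraMap_smul fun b m => by
    rw [← algebraMap_smul (MvPowerSeries (Fin (s + 1)) B) (algebraMap B (MvPolynomial (Fin (s + 1)) B) b), ← IsScalarTower.algebraMap_apply, algebraMap_smul]
  have : Module.Finite (MvPolynomial (Fin (s + 1)) B) M := Module.Finite.of_restrictScalars_finite B (MvPolynomial (Fin (s + 1)) B) M
  let : Module S' M' := Module.compHom M' (algebraMap S' A')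
  have : IsScalarTower S' A' M' := .of_algebraMap_smul fun _ _ => rfl
  let : Module (MvPolynomial (Fin (s + 1)) K) M' := Module.compHom M' (algebraMap (MvPolynomial (Fin (s + 1)) K) S')
  have : IsScalarTower (MvPolynomial (Fin (s + 1)) K) S' M' := .of_algebraMap_smul fun _ _ => rfl
  let : Module K M' := Module.compHom M' (algebraMap K S')
  have : IsScalarTower K S' M' := .of_algebraMap_smul fun _ _ => rfl
  have : IsScalarTower K (MvPolynomial (Fin (s + 1)) K) M' := .of_algebraMap_smul fun c m => by
    rw [← algebraMap_smul S' (algebraMap K (MvPolynomial (Fin (s + 1)) K) c), ← IsScalarTower.algebraMap_apply, algebraMap_smul]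
  let : Module (MvPowerSeries (Fin (s + 1)) B) M' := Module.compHom M' (algebraMap (MvPowerSeries (Fin (s + 1)) B) A)
  have : IsScalarTower (MvPowerSeries (Fin (s + 1)) B) A M' := .of_algebraMap_smul fun _ _ => rfl
  have : IsScalarTower (MvPowerSeries (Fin (s + 1)) B) S' M' := .of_algebraMap_smul fun c m => by
    rw [← algebraMap_smul A' (algebraMap (MvPowerSeries (Fin (s + 1)) B) S' c), ← IsScalarTower.algebraMap_apply,
      IsScalarTower.algebraMap_apply (MvPowerSeries (Fin (s + 1)) B) A A', algebraMap_smul, algebraMap_smul]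
  let : Module (MvPolynomial (Fin (s + 1)) B) M' := Module.compHom M' (algebraMap (MvPolynomial (Fin (s + 1)) B) (MvPowerSeries (Fin (s + 1)) B))
  have : IsScalarTower (MvPolynomial (Fin (s + 1)) B) (MvPowerSeries (Fin (s + 1)) B) M' := .of_algebraMap_smul fun _ _ => rfl
  have : IsScalarTower (MvPolynomial (Fin (s + 1)) B) S' M' := .of_algebraMap_smul fun c m => by
    rw [IsScalarTower.algebraMap_apply (MvPolynomial (Fin (s + 1)) B) (MvPowerSeries (Fin (s + 1)) B) S', algebraMap_smul, algebraMap_smul]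
  have : IsScalarTower (MvPolynomial (Fin (s + 1)) B) (MvPolynomial (Fin (s + 1)) K) M' := .of_algebraMap_smul fun c m => by
    rw [← algebraMap_smul S' (algebraMap (MvPolynomial (Fin (s + 1)) B) (MvPolynomial (Fin (s + 1)) K) c), ← IsScalarTower.algebraMap_apply, algebraMap_smul]
  let : Module B M' := Module.compHom M' (algebraMap B A)
  have : IsScalarTower B A M' := .of_algebraMap_smul fun _ _ => rfl
  have : IsScalarTower B (MvPowerSeries (Fin (s + 1)) B) M' := .of_algebraMap_smul fun b m => by
    rw [← algebraMap_smul A (algebraMap B (MvPowerSeries (Fin (s + 1)) B) b), ← IsScalarTower.algebraMap_apply, algebraMap_smul]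
  have : IsScalarTower B (MvPolynomial (Fin (s + 1)) B) M' := .of_algebraMap_smul fun b m => by
    rw [← algebraMap_smul (MvPowerSeries (Fin (s + 1)) B) (algebraMap B (MvPolynomial (Fin (s + 1)) B) b), ← IsScalarTower.algebraMap_apply, algebraMap_smul]
  have : IsScalarTower B K M' := .of_algebraMap_smul fun b m => by
    rw [← algebraMap_smul S' (algebraMap B K b), ← IsScalarTower.algebraMap_apply,
      IsScalarTower.algebraMap_apply B (MvPowerSeries (Fin (s + 1)) B) S', algebraMap_smul, algebraMap_smul]
  -- localizations
  have hloc : IsLocalizedModule (Algebra.algebraMapSubmonoid A (Ideal.span {ϖ}).primeCompl) g :=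
     (isLocalizedModule_iff_isBaseChange _ A' g).2 hg
  have hlocB : IsLocalizedModule (Ideal.span {ϖ}).primeCompl (g.restrictScalars B) := IsLocalizedModule.restrictScalars (Ideal.span {ϖ}).primeCompl g
  let gS : M →ₗ[(MvPowerSeries (Fin (s + 1)) B)] M' := g.restrictScalars (MvPowerSeries (Fin (s + 1)) B)
  let gT : M →ₗ[(MvPolynomial (Fin (s + 1)) B)] M' := g.restrictScalars (MvPowerSeries (Fin (s + 1)) B) |>.restrictScalars (MvPolynomial (Fin (s + 1)) B)
  have hlocS : IsLocalizedModule (Algebra.algebraMapSubmonoid (MvPowerSeries (Fin (s + 1)) B) (Ideal.span {ϖ}).primeCompl) gS :=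
    haveI : IsLocalizedModule (Ideal.span {ϖ}).primeCompl (gS.restrictScalars B) := hlocB
    IsLocalizedModule.of_restrictScalars (Ideal.span {ϖ}).primeCompl gS
  have hlocT : IsLocalizedModule (Algebra.algebraMapSubmonoid (MvPolynomial (Fin (s + 1)) B) (Ideal.span {ϖ}).primeCompl) gT :=
    haveI : IsLocalizedModule (Ideal.span {ϖ}).primeCompl (gT.restrictScalars B) := hlocB
    IsLocalizedModule.of_restrictScalars (Ideal.span {ϖ}).primeCompl gT
  have hbS : IsBaseChange S' gS := (isLocalizedModule_iff_isBaseChange _ S' gS).1 hlocS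
  have hbT : IsBaseChange (MvPolynomial (Fin (s + 1)) K) gT := (isLocalizedModule_iff_isBaseChange _ (MvPolynomial (Fin (s + 1)) K) gT).1 hlocT
  have hid : IsBaseChange (MvPowerSeries (Fin (s + 1)) B) (LinearMap.id : M →ₗ[(MvPolynomial (Fin (s + 1)) B)] M) := isBaseChange_mvPowerSeries
  have hbTS : IsBaseChange S' gT := by
    have h1 := hid.comp hbS
    rw [LinearMap.comp_id] at h1
    exact h1
  have hi' : IsBaseChange S' (LinearMap.id : M' →ₗ[(MvPolynomial (Fin (s + 1)) K)] M') := hbT.of_comp hbTS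
  have : IsNoetherianRing S' := IsLocalization.isNoetherianRing (Algebra.algebraMapSubmonoid (MvPowerSeries (Fin (s + 1)) B) (Ideal.span {ϖ}).primeCompl) _ inferInstance
  have : IsNoetherianRing K := IsLocalization.isNoetherianRing (Ideal.span {ϖ}).primeCompl _ inferInstance
  have : IsDomain K := IsLocalization.isDomain_of_le_nonZeroDivisors (M := (Ideal.span {ϖ}).primeCompl) K (Ideal.primeCompl_le_nonZeroDivisors _)
  have hmaxK : maximalIdeal K = Ideal.span {algebraMap B K ϖ} := by
    rw [← IsLocalization.AtPrime.map_eq_maximalIdeal (Ideal.span {ϖ}) K, Ideal.map_span, Set.image_singleton]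
  have htfae := tfae_of_isNoetherianRing_of_isLocalRing_of_isDomain K
  have hprin : (maximalIdeal K).IsPrincipal := ⟨_, hmaxK⟩
  have : IsPrincipalIdealRing K := (htfae.out 0 4).2 hprin
  have : Module.Finite K M' := Module.Finite.of_isLocalizedModule (Ideal.span {ϖ}).primeCompl (g.restrictScalars B)
  have hinj : Function.Injective (algebraMap B K) :=
    IsLocalization.injective K (Ideal.primeCompl_le_nonZeroDivisors (Ideal.span {ϖ}))
  have : Nontrivial M' := by
    have h1 : (⟨Ideal.span {ϖ}, hprime⟩ : PrimeSpectrum B) ∈ Module.support B M := by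
      rw [Module.mem_support_iff_of_finite]
      intro b hb
      exact Ideal.mem_span_singleton.2 (hsupp b (fun m => Module.mem_annihilator.1 hb m))
    rw [Module.mem_support_iff] at h1
    exact (IsLocalizedModule.iso (Ideal.span {ϖ}).primeCompl (g.restrictScalars B)).symm.toEquiv.nontrivial
  obtain ⟨N, hN⟩ : ∃ N : ℕ, ∀ m : M', (algebraMap B K ϖ) ^ N • m = 0 := by
    rcases he with ⟨-, rfl⟩ | ⟨-, h0, b, hb, hbM⟩
    · exact ⟨1, by simp⟩
    · have hne : Ideal.span {algebraMap B K b} ≠ ⊥ := by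
        rw [Ne, Ideal.span_singleton_eq_bot, map_eq_zero_iff _ hinj]; exact hb
      obtain ⟨N, hN⟩ := ((htfae.out 4 6 : _ ↔ ∀ I : Ideal K, I ≠ ⊥ → ∃ n : ℕ, I = maximalIdeal K ^ n)).1 hprin _ hne
      refine ⟨N, fun m => ?_⟩
      rw [hmaxK, Ideal.span_singleton_pow] at hN
      have h2 : algebraMap B K ϖ ^ N ∈ Ideal.span {algebraMap B K b} := by
        rw [hN]; exact Ideal.mem_span_singleton_self _
      obtain ⟨c, hc⟩ := Ideal.mem_span_singleton'.1 h2
      rw [← hc, mul_smul]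
      have h3 : (algebraMap B K b) • m = 0 := by
        rw [algebraMap_smul]
        obtain ⟨⟨x, w⟩, hx⟩ := IsLocalizedModule.surj (Ideal.span {ϖ}).primeCompl (g.restrictScalars B) m
        have h4 : w • (b • m) = 0 := by
          rw [smul_comm, hx, ← map_smul, hbM, map_zero]
        have h5 := IsLocalizedModule.map_units (g.restrictScalars B) w
        rw [Module.End.isUnit_iff] at h5
        exact h5.1 (by rw [map_zero, Module.algebraMap_end_apply]; exact h4)
      rw [h3, smul_zero]
  have hlen : Module.length K M' ≠ ⊤ := length_ne_top_of_pow_smul_eq_zero _ hmaxK N hN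
  have hle : Algebra.algebraMapSubmonoid (MvPowerSeries (Fin (s + 1)) B) (Ideal.span {ϖ}).primeCompl ≤ nonZeroDivisors (MvPowerSeries (Fin (s + 1)) B) :=
    map_le_nonZeroDivisors_of_injective _ MvPowerSeries.C_injective (Ideal.primeCompl_le_nonZeroDivisors _)
  have : IsDomain S' := IsLocalization.isDomain_of_le_nonZeroDivisors _ hle
  have hf' : algebraMap (MvPowerSeries (Fin (s + 1)) B) S' f ∈ nonZeroDivisors S' := by
    rw [mem_nonZeroDivisors_iff_ne_zero, Ne, map_eq_zero_iff _ (IsLocalization.injective S' hle)]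
    exact hf
  have he' : e = 0 ∨ (e = 1 ∧ algebraMap B K ϖ ≠ 0 ∧ (Ideal.span {algebraMap B K ϖ}).IsMaximal) := by
    rcases he with ⟨h, -⟩ | ⟨h, h0, -⟩
    · exact .inl h
    · refine .inr ⟨h, by rwa [Ne, map_eq_zero_iff _ hinj], ?_⟩
      rw [← hmaxK]; exact maximalIdeal.isMaximal K
  have : Module.Flat A A' := IsLocalization.flat A' (Algebra.algebraMapSubmonoid A (Ideal.span {ϖ}).primeCompl)
  have : Module.Finite A M := Module.Finite.of_restrictScalars_finite B A M
  intro hsub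
  have hfin := extMod_self_nonzero_of_flat_polynomial (K := K) (S := S') (R := A') (M := M') hs' hk' hf' hi' hlen
    (algebraMap B K ϖ) N hN e he' (i + 1) hi
  exact hfin (extMod_succ_subsingleton_baseChange hg hg i hsub)


/-- Nonvanishing of self-extensions over a quotient of a power series ring by one equation, for a
module that is finite over the coefficients. -/
theorem extMod_self_nonzero_of_mvPowerSeries {B A M : Type u} {s : ℕ} [CommRing B] [IsDomain B]
    [IsNoetherianRing B] [CommRing A] [IsNoetherianRing A] [Algebra (MvPowerSeries (Fin (s + 1)) B) A] [Algebra B A]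
    [IsScalarTower B (MvPowerSeries (Fin (s + 1)) B) A] [AddCommGroup M] [Module A M] [Module B M]
    [IsScalarTower B A M] [Module.Finite B M]
    (hs : Function.Surjective (algebraMap (MvPowerSeries (Fin (s + 1)) B) A))
    {f : MvPowerSeries (Fin (s + 1)) B}
    (hk : ∀ a, algebraMap (MvPowerSeries (Fin (s + 1)) B) A a = 0 ↔ f ∣ a) (hf : f ≠ 0)
    (ϖ : B) (hprime : (Ideal.span {ϖ}).IsPrime)
    (hsupp : ∀ b : B, (∀ m : M, b • m = 0) → ϖ ∣ b) (e : ℕ)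
    (he : (e = 0 ∧ ϖ = 0) ∨ (e = 1 ∧ ϖ ≠ 0 ∧ ∃ b : B, b ≠ 0 ∧ ∀ m : M, b • m = 0))
    (i : ℕ) (hi : i + 1 ≤ e + s) : ¬ Subsingleton (extMod A (i + 1) M M) := by
  let : Algebra (Localization.AtPrime (Ideal.span {ϖ}))
      (Localization (Algebra.algebraMapSubmonoid (MvPowerSeries (Fin (s + 1)) B) (Ideal.span {ϖ}).primeCompl)) :=
    localizationAlgebra (Ideal.span {ϖ}).primeCompl (MvPowerSeries (Fin (s + 1)) B)
  have : IsScalarTower B (Localization.AtPrime (Ideal.span {ϖ}))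
      (Localization (Algebra.algebraMapSubmonoid (MvPowerSeries (Fin (s + 1)) B) (Ideal.span {ϖ}).primeCompl)) :=
    isScalarTower_localizationAlgebra (Ideal.span {ϖ}).primeCompl (MvPowerSeries (Fin (s + 1)) B)
  have hWA : Algebra.algebraMapSubmonoid A (Algebra.algebraMapSubmonoid (MvPowerSeries (Fin (s + 1)) B)
      (Ideal.span {ϖ}).primeCompl) = Algebra.algebraMapSubmonoid A (Ideal.span {ϖ}).primeCompl := by
    rw [Algebra.algebraMapSubmonoid, Algebra.algebraMapSubmonoid, Algebra.algebraMapSubmonoid,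
      IsScalarTower.algebraMap_eq B (MvPowerSeries (Fin (s + 1)) B) A]
    exact Submonoid.map_map (Ideal.span {ϖ}).primeCompl _ _
  have : IsLocalization (Algebra.algebraMapSubmonoid A (Ideal.span {ϖ}).primeCompl)
      (Localization (Algebra.algebraMapSubmonoid A (Algebra.algebraMapSubmonoid
        (MvPowerSeries (Fin (s + 1)) B) (Ideal.span {ϖ}).primeCompl))) := by
    rw [← hWA]; infer_instance
  exact extMod_self_nonzero_of_localization hk hf ϖ hprime hsupp e he
    (Localization.AtPrime (Ideal.span {ϖ}))
    (Localization (Algebra.algebraMapSubmonoid (MvPowerSeries (Fin (s + 1)) B) (Ideal.span {ϖ}).primeCompl))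
    (Localization (Algebra.algebraMapSubmonoid A (Algebra.algebraMapSubmonoid
        (MvPowerSeries (Fin (s + 1)) B) (Ideal.span {ϖ}).primeCompl)))
    (surjective_localization_algebraMapSubmonoid _ hs) (localization_algebraMap_eq_zero_iff _ hk) i hi

/-- The elements of a list form a weakly regular sequence on `S ⧸ I`. -/
def WeaklyRegularMod {S : Type*} [CommRing S] : Ideal S → List S → Prop
  | _, [] => True
  | I, y :: ys => (∀ a, y * a ∈ I → a ∈ I) ∧ WeaklyRegularMod (I ⊔ Ideal.span {y}) ys

lemma WeaklyRegularMod.comap {S A : Type*} [CommRing S] [CommRing A] (φ : S →+* A)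
    (hφ : Function.Surjective φ) (I : Ideal A) (ys : List S) (h : WeaklyRegularMod I (ys.map φ)) :
    WeaklyRegularMod (I.comap φ) ys := by
  induction ys generalizing I with
  | nil => trivial
  | cons y ys ih =>
    refine ⟨fun a ha => h.1 (φ a) (by simpa [Ideal.mem_comap] using ha), ?_⟩
    have h2 := ih _ h.2
    have : (I ⊔ Ideal.span {φ y}).comap φ = I.comap φ ⊔ Ideal.span {y} := by
      apply le_antisymm
      · intro a ha
        obtain ⟨i, hi, c, hc, hic⟩ := Submodule.mem_sup.1 (Ideal.mem_comap.1 ha)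
        obtain ⟨c, rfl⟩ := Ideal.mem_span_singleton'.1 hc
        obtain ⟨c, rfl⟩ := hφ c
        refine Submodule.mem_sup.2 ⟨a - c * y, ?_, c * y, Ideal.mul_mem_left _ _ (Ideal.mem_span_singleton_self y), by ring⟩
        rw [Ideal.mem_comap, map_sub, map_mul, ← hic, add_sub_cancel_right]
        exact hi
      · refine sup_le (Ideal.comap_mono le_sup_left) ?_
        rw [Ideal.span_singleton_le_iff_mem, Ideal.mem_comap]
        exact le_sup_right (a := I) (Ideal.mem_span_singleton_self _)
    rwa [this] at h2

lemma exists_eq_span_sup_of_sup_span {S : Type*} [CommRing S] [IsNoetherianRing S] [IsLocalRing S]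
    {K L : Ideal S} (hLK : L ≤ K) {y g : S} (hy : y ∈ maximalIdeal S) (hreg : ∀ a, y * a ∈ K → a ∈ K)
    (hg : K ⊔ Ideal.span {y} = Ideal.span {g} ⊔ (L ⊔ Ideal.span {y})) :
    ∃ k, K = Ideal.span {k} ⊔ L := by
  have h1 : g ∈ K ⊔ Ideal.span {y} := hg ▸ le_sup_left (b := L ⊔ Ideal.span {y}) (Ideal.mem_span_singleton_self g)
  obtain ⟨k, hk, c, hc, hkc⟩ := Submodule.mem_sup.1 h1
  have hle : Ideal.span {k} ⊔ L ≤ K := sup_le ((Ideal.span_singleton_le_iff_mem _).2 hk) hLK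
  refine ⟨k, le_antisymm ?_ hle⟩
  refine Submodule.le_of_le_smul_of_le_jacobson_bot (I := Ideal.span {y}) (IsNoetherian.noetherian K) ?_ ?_
  · rw [IsLocalRing.jacobson_eq_maximalIdeal _ bot_ne_top]
    exact (Ideal.span_singleton_le_iff_mem _).2 hy
  · intro a ha
    have h2 : a ∈ Ideal.span {k} ⊔ L ⊔ Ideal.span {y} := by
      have h3 : a ∈ Ideal.span {g} ⊔ (L ⊔ Ideal.span {y}) := hg ▸ le_sup_left (b := Ideal.span {y}) ha
      refine (sup_le ((Ideal.span_singleton_le_iff_mem _).2 ?_) (sup_le (le_sup_right.trans le_sup_left) le_sup_right) :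
        Ideal.span {g} ⊔ (L ⊔ Ideal.span {y}) ≤ _) h3
      rw [← hkc]
      exact add_mem (le_sup_left (a := Ideal.span {k} ⊔ L) (le_sup_left (a := Ideal.span {k}) (Ideal.mem_span_singleton_self k)))
        (le_sup_right (a := Ideal.span {k} ⊔ L) hc)
    obtain ⟨b, hb, c, hc, rfl⟩ := Submodule.mem_sup.1 h2
    obtain ⟨c, rfl⟩ := Ideal.mem_span_singleton.1 hc
    refine Submodule.add_mem_sup hb (Submodule.smul_mem_smul (Ideal.mem_span_singleton_self y) (hreg c ?_))
    simpa using sub_mem ha (hle hb)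

/-- An ideal which is principal modulo a regular sequence is principal. -/
lemma WeaklyRegularMod.exists_eq_span_sup {S : Type*} [CommRing S] [IsNoetherianRing S] [IsLocalRing S]
    (ys : List S) (hys : ∀ y ∈ ys, y ∈ maximalIdeal S) {K L : Ideal S} (hLK : L ≤ K)
    (hreg : WeaklyRegularMod K ys) (g : S)
    (hg : K ⊔ Ideal.ofList ys = Ideal.span {g} ⊔ (L ⊔ Ideal.ofList ys)) :
    ∃ k, K = Ideal.span {k} ⊔ L := by
  induction ys generalizing K L g with
  | nil => exact ⟨g, by simpa using hg⟩
  | cons y ys ih =>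
    rw [Ideal.ofList_cons, ← sup_assoc, ← sup_assoc (a := L)] at hg
    obtain ⟨k, hk⟩ := ih (fun z hz => hys z (List.mem_cons_of_mem _ hz))
      (sup_le_sup_right hLK (Ideal.span {y})) hreg.2 g hg
    exact exists_eq_span_sup_of_sup_span hLK (hys y List.mem_cons_self) hreg.1 hk

/-- Lifting approximate surjectivity along an adically complete ring. -/
lemma exists_sub_mem_of_adic {P A : Type*} [CommRing P] [CommRing A] [IsNoetherianRing A]
    [IsLocalRing A] (J : Ideal P) [IsAdicComplete J P] (φ : P →+* A) (𝔞 : Ideal A)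
    (hJ : J.map φ ≤ maximalIdeal A) (h : ∀ a, ∃ p, a - φ p ∈ 𝔞 ⊔ J.map φ) (a : A) :
    ∃ p, a - φ p ∈ 𝔞 := by
  by_cases htop : 𝔞 = ⊤
  · exact ⟨0, by simp [htop]⟩
  have : Nontrivial (A ⧸ 𝔞) := Ideal.Quotient.nontrivial_iff.2 htop
  have : IsLocalRing (A ⧸ 𝔞) := .of_surjective' (Ideal.Quotient.mk 𝔞) Ideal.Quotient.mk_surjective
  let f : P →+* A ⧸ 𝔞 := (Ideal.Quotient.mk 𝔞).comp φ
  have hf : J.map f = (J.map φ).map (Ideal.Quotient.mk 𝔞) := (Ideal.map_map _ _).symm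
  have : IsHausdorff (J.map f) (A ⧸ 𝔞) := by
    refine IsHausdorff.of_isLocalRing _ _ fun ht => ?_
    have : J.map f ≤ maximalIdeal (A ⧸ 𝔞) := by
      rw [hf, ← IsLocalRing.map_maximalIdeal_of_surjective _ (Ideal.Quotient.mk_surjective (I := 𝔞))]
      exact Ideal.map_mono hJ
    exact (maximalIdeal.isMaximal _).ne_top (top_le_iff.1 (ht ▸ this))
  have hs : Function.Surjective f := by
    apply surjective_of_mk_map_comp_surjective f (I := J)
    intro x
    obtain ⟨x, rfl⟩ := Ideal.Quotient.mk_surjective x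
    obtain ⟨x, rfl⟩ := Ideal.Quotient.mk_surjective x
    obtain ⟨p, hp⟩ := h x
    refine ⟨p, ?_⟩
    rw [RingHom.comp_apply, Ideal.Quotient.eq, ← neg_mem_iff, neg_sub, hf]
    change Ideal.Quotient.mk 𝔞 x - Ideal.Quotient.mk 𝔞 (φ p) ∈ _
    rw [← map_sub]
    have := Ideal.mem_map_of_mem (Ideal.Quotient.mk 𝔞) hp
    rwa [Ideal.map_sup, Ideal.map_quotient_self, bot_sup_eq] at this
  obtain ⟨p, hp⟩ := hs (Ideal.Quotient.mk 𝔞 a)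
  exact ⟨p, Ideal.Quotient.eq.1 hp.symm⟩

/-- Lifting finiteness along an adically complete ring. -/
lemma finite_of_finite_quotient_map {P A N : Type u} [CommRing P] [IsNoetherianRing P] [CommRing A]
    [IsNoetherianRing A] [IsLocalRing A] (J : Ideal P) [IsAdicComplete J P] [Algebra P A]
    [AddCommGroup N] [Module A N] [Module P N] [IsScalarTower P A N] [Module.Finite A N]
    (hJ : J.map (algebraMap P A) ≤ maximalIdeal A)
    (h : Module.Finite P (N ⧸ (J.map (algebraMap P A) • ⊤ : Submodule A N))) : Module.Finite P N := by
  have : IsHausdorff (J.map (algebraMap P A)) N :=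
    IsHausdorff.of_isLocalRing _ _ fun ht => (maximalIdeal.isMaximal A).ne_top (top_le_iff.1 (ht ▸ hJ))
  have : IsHausdorff J N := IsHausdorff.map_algebraMap_iff.1 this
  refine finite_of_finite_quotient_adic J ?_
  have he : (J.map (algebraMap P A) • ⊤ : Submodule A N).restrictScalars P = J • ⊤ := by
    rw [← Submodule.restrictScalars_top P A N, ← Ideal.smul_restrictScalars]
  rw [← he]
  exact h

/-- A finite module killed by a power of the maximal ideal is finite over any ring surjecting onto
the residue field. -/
lemma finite_of_pow_maximalIdeal_le {P A N : Type u} [CommRing P] [CommRing A]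
    [IsNoetherianRing A] [IsLocalRing A] [Algebra P A]
    [AddCommGroup N] [Module A N] [Module P N] [IsScalarTower P A N] [Module.Finite A N]
    (hP : ∀ a : A, ∃ p : P, a - algebraMap P A p ∈ maximalIdeal A) (n : ℕ)
    (h : (maximalIdeal A) ^ n • (⊤ : Submodule A N) = ⊥) : Module.Finite P N := by
  induction n generalizing N with
  | zero =>
    have : Subsingleton N := by
      rw [pow_zero, Ideal.one_eq_top, Submodule.top_smul] at h
      exact (Submodule.subsingleton_iff A).1 (subsingleton_of_top_le_bot h.le)
    infer_instance
  | succ n ih =>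
    let N' : Submodule A N := maximalIdeal A • ⊤
    have h1 : Module.Finite P (N'.restrictScalars P) := by
      refine ih (N := N') ?_
      apply Submodule.map_injective_of_injective N'.injective_subtype
      rw [Submodule.map_smul'', Submodule.map_top, Submodule.range_subtype, Submodule.map_bot, ← h, pow_succ,
        Submodule.mul_smul]
    have h2 : Module.Finite P (N ⧸ N') := by
      obtain ⟨s, hs⟩ := (inferInstance : Module.Finite A (N ⧸ N')).fg_top
      refine ⟨⟨s, Submodule.eq_top_iff'.2 fun x => ?_⟩⟩
      have hx : x ∈ Submodule.span A (s : Set (N ⧸ N')) := hs ▸ Submodule.mem_top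
      change x ∈ Submodule.span P (s : Set (N ⧸ N'))
      induction hx using Submodule.span_induction with
      | mem x hx => exact Submodule.subset_span hx
      | zero => exact zero_mem _
      | add x y _ _ hx hy => exact add_mem hx hy
      | smul a x _ hx =>
        obtain ⟨p, hp⟩ := hP a
        have h0 : (a - algebraMap P A p) • x = 0 := by
          obtain ⟨z, rfl⟩ := Submodule.mkQ_surjective N' x
          rw [← map_smul, Submodule.mkQ_apply, Submodule.Quotient.mk_eq_zero]
          exact Submodule.smul_mem_smul hp Submodule.mem_top
        rw [sub_smul, sub_eq_zero, algebraMap_smul] at h0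
        rw [h0]
        exact Submodule.smul_mem _ _ hx
    have h3 : Module.Finite P (N ⧸ N'.restrictScalars P) := h2
    exact Module.Finite.of_submodule_quotient (N'.restrictScalars P)

lemma ofList_ofFn {A : Type*} [CommRing A] {n : ℕ} (a : Fin n → A) :
    Ideal.ofList (List.ofFn a) = Ideal.span (Set.range a) := by
  simp only [Ideal.ofList, List.mem_ofFn]; rfl

lemma mvPowerSeries_sub_C_constantCoeff_mem {B : Type u} [CommRing B] {m : ℕ}
    (s : MvPowerSeries (Fin m) B) :
    s - MvPowerSeries.C (MvPowerSeries.constantCoeff s) ∈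
      Ideal.span (Set.range (MvPowerSeries.X : Fin m → MvPowerSeries (Fin m) B)) := by
  have h := mvPowerSeries_sub_truncTotal_mem s 1
  have h1 : (MvPowerSeries.truncTotal 1 s : MvPolynomial (Fin m) B) =
      MvPolynomial.C (MvPowerSeries.constantCoeff s) := by
    ext n
    rw [MvPowerSeries.coeff_truncTotal_eq_ite, MvPolynomial.coeff_C]
    simp only [Nat.lt_one_iff, Finsupp.degree_eq_zero_iff]
    by_cases hn : n = 0
    · simp [hn]
    · simp [hn, Ne.symm hn]
  rw [h1, MvPolynomial.coe_C, pow_one, ← Submodule.restrictScalars_top (MvPolynomial (Fin m) B) (MvPowerSeries (Fin m) B), ← Ideal.smul_restrictScalars,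
    Submodule.restrictScalars_mem, smul_eq_mul, Ideal.mul_top, MvPolynomial.idealOfVars, Ideal.map_span, ← Set.range_comp] at h
  have h2 : (algebraMap (MvPolynomial (Fin m) B) (MvPowerSeries (Fin m) B)) ∘ MvPolynomial.X = MvPowerSeries.X :=
    funext fun i => MvPolynomial.coe_X i
  rwa [h2] at h

section
open MvPowerSeries
variable {D A : Type u} [CommRing D] [IsDomain D] [IsPrincipalIdealRing D] [IsLocalRing D]
  [IsAdicComplete (maximalIdeal D) D] [CommRing A] [IsNoetherianRing A] [IsLocalRing A]
  [IsAdicComplete (maximalIdeal A) A]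

/-- A complete local ring with a regular sequence as in the hypotheses is a quotient of an iterated power
series ring over a discrete valuation ring by one equation. -/
lemma exists_mvPowerSeries_presentation (ϖ : D) (hϖ : maximalIdeal D = Ideal.span {ϖ}) (hϖ0 : ϖ ≠ 0)
    (φ : D →+* A) (hφ : ∀ a, ∃ d, a - φ d ∈ maximalIdeal A) {r m : ℕ} (us : Fin r → A) (vs : Fin m → A)
    (hmax : maximalIdeal A = Ideal.span (Set.range vs) ⊔ Ideal.span (Set.range us) ⊔ Ideal.span {φ ϖ})
    (hreg : WeaklyRegularMod ⊥ (List.ofFn us ++ List.ofFn vs))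
    (hN : ∃ N : ℕ, φ ϖ ^ N ∈ Ideal.span (Set.range us) ⊔ Ideal.span (Set.range vs)) :
    ∃ (β : MvPowerSeries (Fin r) D →+* A) (Φ : MvPowerSeries (Fin m) (MvPowerSeries (Fin r) D) →+* A)
      (f : MvPowerSeries (Fin m) (MvPowerSeries (Fin r) D)),
      (∀ d, β (C d) = φ d) ∧ (∀ j, β (X j) = us j) ∧ (∀ b, Φ (C b) = β b) ∧ (∀ j, Φ (X j) = vs j) ∧
      Function.Surjective Φ ∧ f ≠ 0 ∧ ∀ a, Φ a = 0 ↔ f ∣ a := by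
  have hu (j) : us j ∈ maximalIdeal A := by
    rw [hmax]
    exact le_sup_left (b := Ideal.span {φ ϖ}) (le_sup_right (a := Ideal.span (Set.range vs)) (Ideal.subset_span ⟨j, rfl⟩))
  have hv (j) : vs j ∈ maximalIdeal A := by
    rw [hmax]
    exact le_sup_left (b := Ideal.span {φ ϖ}) (le_sup_left (b := Ideal.span (Set.range us)) (Ideal.subset_span ⟨j, rfl⟩))
  obtain ⟨β, hβC, hβX⟩ := exists_mvPowerSeries_hom (maximalIdeal A) φ us hu
  obtain ⟨Φ, hΦC, hΦX⟩ := exists_mvPowerSeries_hom (maximalIdeal A) β vs hv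
  have hJD : (maximalIdeal D).map φ = Ideal.span {φ ϖ} := by rw [hϖ, Ideal.map_span, Set.image_singleton]
  have hJβ : (Ideal.span (Set.range (X : Fin r → MvPowerSeries (Fin r) D))).map β = Ideal.span (Set.range us) := by
    rw [Ideal.map_span, ← Set.range_comp]; congr 2; ext1 j; exact hβX j
  have hJΦ : (Ideal.span (Set.range (X : Fin m → MvPowerSeries (Fin m) (MvPowerSeries (Fin r) D)))).map Φ =
      Ideal.span (Set.range vs) := by
    rw [Ideal.map_span, ← Set.range_comp]; congr 2; ext1 j; exact hΦX j
  have h1 (a) : ∃ d, a - φ d ∈ Ideal.span (Set.range vs) ⊔ Ideal.span (Set.range us) := by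
    refine exists_sub_mem_of_adic (maximalIdeal D) φ _ (by rw [hJD, hmax]; exact le_sup_right) (fun a => ?_) a
    rw [hJD, ← hmax]; exact hφ a
  have h2 (a) : ∃ b, a - β b ∈ Ideal.span (Set.range vs) := by
    refine exists_sub_mem_of_adic (Ideal.span (Set.range X)) β _ ?_ (fun a => ?_) a
    · rw [hJβ, hmax]; exact le_sup_right.trans le_sup_left
    · rw [hJβ]
      obtain ⟨d, hd⟩ := h1 a
      exact ⟨C d, by rwa [hβC]⟩
  have hs : Function.Surjective Φ := by
    have h3 (a) : ∃ b, a - Φ b ∈ (⊥ : Ideal A) := by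
      refine exists_sub_mem_of_adic (Ideal.span (Set.range X)) Φ _ ?_ (fun a => ?_) a
      · rw [hJΦ, hmax]; exact le_sup_left.trans le_sup_left
      · rw [hJΦ, bot_sup_eq]
        obtain ⟨d, hd⟩ := h2 a
        exact ⟨C d, by rwa [hΦC]⟩
    intro a
    obtain ⟨b, hb⟩ := h3 a
    exact ⟨b, (sub_eq_zero.1 hb).symm⟩
  let Ys : List (MvPowerSeries (Fin m) (MvPowerSeries (Fin r) D)) :=
    List.ofFn (fun j : Fin r => C (X j)) ++ List.ofFn (fun j : Fin m => X j)
  have hYs : Ys.map Φ = List.ofFn us ++ List.ofFn vs := by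
    rw [List.map_append, List.map_ofFn, List.map_ofFn]
    congr 2
    · ext1 j; simp [hΦC, hβX]
    · ext1 j; simp [hΦX]
  have hYmax (y) (hy : y ∈ Ys) : y ∈ maximalIdeal (MvPowerSeries (Fin m) (MvPowerSeries (Fin r) D)) := by
    have h4 : Φ y ∈ maximalIdeal A := by
      have h5 : Φ y ∈ Ys.map Φ := List.mem_map_of_mem hy
      rw [hYs, List.mem_append, List.mem_ofFn, List.mem_ofFn] at h5
      rcases h5 with ⟨j, hj⟩ | ⟨j, hj⟩ <;> rw [← hj]
      exacts [hu j, hv j]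
    rw [mem_maximalIdeal, mem_nonunits_iff] at h4 ⊢
    exact fun h => h4 (h.map Φ)
  have hC (s : MvPowerSeries (Fin m) (MvPowerSeries (Fin r) D)) :
      s - C (C (constantCoeff (constantCoeff s))) ∈ Ideal.ofList Ys := by
    rw [Ideal.ofList_append, ofList_ofFn, ofList_ofFn]
    have e1 := mvPowerSeries_sub_C_constantCoeff_mem s
    have e2 := Ideal.mem_map_of_mem (C : _ →+* MvPowerSeries (Fin m) (MvPowerSeries (Fin r) D))
      (mvPowerSeries_sub_C_constantCoeff_mem (constantCoeff s))
    rw [Ideal.map_span, ← Set.range_comp] at e2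
    have := Submodule.add_mem_sup e2 e1
    rw [map_sub] at this
    rwa [sub_add_sub_cancel'] at this
  have hker : WeaklyRegularMod ((⊥ : Ideal A).comap Φ) Ys :=
    WeaklyRegularMod.comap Φ hs ⊥ Ys (by rwa [hYs])
  let CC : D →+* MvPowerSeries (Fin m) (MvPowerSeries (Fin r) D) := (C).comp C
  obtain ⟨d, hd⟩ := (IsPrincipalIdealRing.principal (((⊥ : Ideal A).comap Φ ⊔ Ideal.ofList Ys).comap CC)).1
  have hdmem : CC d ∈ (⊥ : Ideal A).comap Φ ⊔ Ideal.ofList Ys := by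
    rw [← Ideal.mem_comap, hd]; exact Submodule.mem_span_singleton_self d
  obtain ⟨f, hf⟩ := WeaklyRegularMod.exists_eq_span_sup Ys hYmax (L := ⊥) bot_le hker (CC d) (by
    rw [bot_sup_eq]
    apply le_antisymm
    · intro s hs
      have e1 : CC (constantCoeff (constantCoeff s)) ∈ (⊥ : Ideal A).comap Φ ⊔ Ideal.ofList Ys := by
        rw [← sub_sub_cancel s (CC _)]
        exact sub_mem hs (le_sup_right (a := (⊥ : Ideal A).comap Φ) (hC s))
      rw [← Ideal.mem_comap, hd] at e1
      obtain ⟨c, hc⟩ := Ideal.mem_span_singleton'.1 e1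
      rw [← sub_add_cancel s (CC (constantCoeff (constantCoeff s))), ← hc, map_mul]
      refine add_mem ?_ ?_
      · have := hC s
        rw [← map_mul, hc]
        exact le_sup_right (a := Ideal.span {CC d}) this
      · exact le_sup_left (b := Ideal.ofList Ys) (Ideal.mul_mem_left _ _ (Ideal.mem_span_singleton_self _))
    · exact sup_le ((Ideal.span_singleton_le_iff_mem _).2 hdmem) le_sup_right)
  rw [sup_bot_eq] at hf
  have hkf (a) : Φ a = 0 ↔ f ∣ a := by
    rw [← Ideal.mem_span_singleton, ← hf]; rfl
  refine ⟨β, Φ, f, hβC, hβX, hΦC, hΦX, hs, ?_, hkf⟩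
  rintro rfl
  obtain ⟨N, hN⟩ := hN
  have hmap : (Ideal.ofList Ys).map Φ = Ideal.span (Set.range us) ⊔ Ideal.span (Set.range vs) := by
    rw [Ideal.map_ofList, hYs, Ideal.ofList_append, ofList_ofFn, ofList_ofFn]
  rw [← hmap, Ideal.mem_map_iff_of_surjective Φ hs] at hN
  obtain ⟨l, hl, hlN⟩ := hN
  have e3 : l - CC (ϖ ^ N) = 0 := by
    rw [← zero_dvd_iff, ← hkf, map_sub, hlN, sub_eq_zero]
    simp [CC, hΦC, hβC]
  have e4 : Ideal.ofList Ys ≤ RingHom.ker ((constantCoeff (R := D)).comp (constantCoeff (σ := Fin m) (R := MvPowerSeries (Fin r) D))) := by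
    rw [Ideal.ofList_append, ofList_ofFn, ofList_ofFn]
    refine sup_le (Ideal.span_le.2 ?_) (Ideal.span_le.2 ?_)
    · rintro _ ⟨j, rfl⟩; simp
    · rintro _ ⟨j, rfl⟩; simp
  have e5 := e4 hl
  rw [sub_eq_zero.1 e3, RingHom.mem_ker] at e5
  simp [CC, hϖ0] at e5
end

section
variable {B E : Type*} [CommRing B] [CommRing E] [Algebra B E] [Algebra.IsIntegral B E]

lemma ringKrullDim_le_quotient_of_isIntegral {L : Ideal B} (hL : ∀ b ∈ L, algebraMap B E b = 0) :
    ringKrullDim E ≤ ringKrullDim (B ⧸ L) := by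
  let : Algebra (B ⧸ L) E := (Ideal.Quotient.lift L (algebraMap B E) hL).toAlgebra
  have : IsScalarTower B (B ⧸ L) E := IsScalarTower.of_algebraMap_eq fun _ => rfl
  have : Algebra.IsIntegral (B ⧸ L) E := Algebra.IsIntegral.tower_top B
  refine Order.krullDim_le_of_strictMono (PrimeSpectrum.comap (algebraMap (B ⧸ L) E)) ?_
  intro p q h
  exact Ideal.IsIntegral.comap_lt_comap (R := B ⧸ L) (I := p.asIdeal) (J := q.asIdeal) h

lemma exists_ltSeries_of_isIntegral (hinj : Function.Injective (algebraMap B E)) (n : ℕ)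
    (s : LTSeries (PrimeSpectrum B)) (hs : s.length = n) :
    ∃ t : LTSeries (PrimeSpectrum E), t.length = n ∧
      (RelSeries.last t).comap (algebraMap B E) = RelSeries.last s := by
  have hker : RingHom.ker (algebraMap B E) = ⊥ := (RingHom.injective_iff_ker_eq_bot _).mp hinj
  induction n generalizing s with
  | zero =>
    obtain ⟨Q, -, hQ, h⟩ := Ideal.exists_ideal_over_prime_of_isIntegral (S := E)
      (RelSeries.last s).asIdeal ⊥ (by
        change RingHom.ker (algebraMap B E) ≤ _
        rw [hker]; exact bot_le)
    exact ⟨RelSeries.singleton _ ⟨Q, hQ⟩, rfl, PrimeSpectrum.ext h⟩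
  | succ n ih =>
    have h0 : s.length ≠ 0 := by omega
    obtain ⟨t, ht, h⟩ := ih s.eraseLast (by simp [hs])
    have hlt := s.eraseLast_last_rel_last h0
    obtain ⟨Q, hle, hQ, h2⟩ := Ideal.exists_ideal_over_prime_of_isIntegral (S := E)
      (RelSeries.last s).asIdeal (RelSeries.last t).asIdeal (by
        have := congrArg PrimeSpectrum.asIdeal h
        rw [PrimeSpectrum.comap_asIdeal] at this
        rw [this]; exact le_of_lt hlt)
    have hne : RelSeries.last t ≠ ⟨Q, hQ⟩ := by
      intro he
      have : RelSeries.last s.eraseLast = RelSeries.last s := by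
        rw [← h, he]; exact PrimeSpectrum.ext h2
      exact ne_of_lt hlt this
    refine ⟨RelSeries.snoc t ⟨Q, hQ⟩ (lt_of_le_of_ne (show RelSeries.last t ≤ ⟨Q, hQ⟩ from hle) hne), by simp [ht], ?_⟩
    rw [RelSeries.last_snoc]
    exact PrimeSpectrum.ext h2

lemma ringKrullDim_le_of_isIntegral_of_injective (hinj : Function.Injective (algebraMap B E)) :
    ringKrullDim B ≤ ringKrullDim E := by
  refine iSup_le fun s => ?_
  obtain ⟨t, ht, -⟩ := exists_ltSeries_of_isIntegral hinj _ s rfl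
  rw [← ht]
  exact le_iSup (fun t : LTSeries (PrimeSpectrum E) => ((t.length : ℕ∞) : WithBot ℕ∞)) t
end

lemma withBot_le_of_add_one_le {x : WithBot ℕ∞} {n : ℕ} (h : x + 1 ≤ ((n + 1 : ℕ) : WithBot ℕ∞)) :
    x ≤ (n : WithBot ℕ∞) := by
  induction x with
  | bot => exact bot_le
  | coe a =>
    induction a with
    | top => exact absurd h (by
        rw [not_le]; exact WithBot.coe_lt_coe.mpr (ENat.natCast_lt_top _))
    | coe a => norm_cast at h ⊢; omega

section
variable {D : Type u} [CommRing D] {r : ℕ}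

lemma span_C_isPrime {ϖ : D} (h : (Ideal.span {ϖ}).IsPrime) :
    (Ideal.span {(MvPowerSeries.C ϖ : MvPowerSeries (Fin r) D)}).IsPrime := by
  have hk : RingHom.ker (MvPowerSeries.map (σ := Fin r) (Ideal.Quotient.mk (Ideal.span {ϖ}))) =
      Ideal.span {(MvPowerSeries.C ϖ : MvPowerSeries (Fin r) D)} := by
    ext f
    rw [RingHom.mem_ker, Ideal.mem_span_singleton]
    constructor
    · intro hf
      have : ∀ n, ∃ c, MvPowerSeries.coeff n f = ϖ * c := fun n => by
        have := congrArg (MvPowerSeries.coeff n) hf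
        rw [MvPowerSeries.coeff_map, map_zero, Ideal.Quotient.eq_zero_iff_mem,
          Ideal.mem_span_singleton] at this
        exact this
      choose c hc using this
      obtain ⟨c', hc'⟩ : ∃ c' : MvPowerSeries (Fin r) D, ∀ n, MvPowerSeries.coeff n c' = c n :=
        ⟨c, fun _ => rfl⟩
      refine ⟨c', ?_⟩
      ext n
      rw [MvPowerSeries.coeff_C_mul, hc, hc']
    · rintro ⟨g, rfl⟩
      rw [map_mul, MvPowerSeries.map_C, Ideal.Quotient.eq_zero_iff_mem.mpr
        (Ideal.mem_span_singleton_self ϖ), map_zero, zero_mul]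
  rw [← hk]
  have : IsDomain (MvPowerSeries (Fin r) (D ⧸ Ideal.span {ϖ})) := NoZeroDivisors.to_isDomain _
  exact RingHom.ker_isPrime _

lemma ringKrullDim_mvPowerSeries_le [IsLocalRing D] [IsNoetherianRing D] {ϖ : D}
    (hϖ : maximalIdeal D = Ideal.span {ϖ}) :
    ringKrullDim (MvPowerSeries (Fin r) D) ≤ ((r + 1 : ℕ) : WithBot ℕ∞) := by
  have hm : maximalIdeal (MvPowerSeries (Fin r) D) =
      Ideal.span (insert (MvPowerSeries.C ϖ) (Set.range MvPowerSeries.X)) := by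
    apply le_antisymm
    · intro f hf
      have h1 := mvPowerSeries_sub_C_constantCoeff_mem f
      have h2 : MvPowerSeries.constantCoeff f ∈ maximalIdeal D := by
        rw [mem_maximalIdeal, mem_nonunits_iff, ← MvPowerSeries.isUnit_iff_constantCoeff]
        exact hf
      rw [hϖ, Ideal.mem_span_singleton] at h2
      obtain ⟨c, hc⟩ := h2
      rw [hc] at h1
      have h3 := Ideal.add_mem _ (Ideal.span_mono (Set.subset_insert (MvPowerSeries.C ϖ) _) h1)
        (Ideal.mul_mem_right (MvPowerSeries.C c) _ (Ideal.subset_span (Set.mem_insert (MvPowerSeries.C ϖ)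
          (Set.range (MvPowerSeries.X : Fin r → MvPowerSeries (Fin r) D)))))
      rw [← map_mul] at h3
      simpa using h3
    · rw [Ideal.span_le]
      have hu : ϖ ∈ maximalIdeal D := hϖ ▸ Ideal.mem_span_singleton_self ϖ
      rintro _ (rfl | ⟨i, rfl⟩) <;>
        rw [SetLike.mem_coe, mem_maximalIdeal, mem_nonunits_iff, MvPowerSeries.isUnit_iff_constantCoeff]
      · simpa using hu
      · simp
  refine (ringKrullDim_le_spanFinrank_maximalIdeal (R := MvPowerSeries (Fin r) D)).trans ?_
  rw [hm]
  have h1 := Submodule.spanFinrank_span_le_ncard_of_finite (R := MvPowerSeries (Fin r) D)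
    (s := insert (MvPowerSeries.C ϖ) (Set.range (MvPowerSeries.X : Fin r → MvPowerSeries (Fin r) D)))
    ((Set.finite_range _).insert _)
  have h2 := Set.ncard_insert_le (MvPowerSeries.C ϖ) (Set.range (MvPowerSeries.X : Fin r → MvPowerSeries (Fin r) D))
  have h3 : (Set.range (MvPowerSeries.X : Fin r → MvPowerSeries (Fin r) D)).ncard ≤ r := by
    rw [← Nat.card_coe_set_eq]
    simpa using Finite.card_range_le (MvPowerSeries.X : Fin r → MvPowerSeries (Fin r) D)
  exact_mod_cast h1.trans (h2.trans (by omega))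
end

section
variable {D A : Type u} [CommRing D] [IsDomain D] [IsPrincipalIdealRing D] [IsLocalRing D]
  [IsAdicComplete (maximalIdeal D) D] [CommRing A] [IsNoetherianRing A] [IsLocalRing A] {r : ℕ}
  [Algebra D A] [Algebra (MvPowerSeries (Fin r) D) A] [IsScalarTower D (MvPowerSeries (Fin r) D) A]

lemma finite_mvPowerSeries_of_pow_le {N : Type u} [AddCommGroup N] [Module A N] [Module.Finite A N]
    [Module (MvPowerSeries (Fin r) D) N] [IsScalarTower (MvPowerSeries (Fin r) D) A N]
    {ϖ : D} (hϖ : maximalIdeal D = Ideal.span {ϖ}) (hϖA : algebraMap D A ϖ ∈ maximalIdeal A)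
    (hφ : ∀ a : A, ∃ d, a - algebraMap D A d ∈ maximalIdeal A) (us : Fin r → A)
    (hX : ∀ j, algebraMap (MvPowerSeries (Fin r) D) A (MvPowerSeries.X j) = us j)
    (hus : ∀ j, us j ∈ maximalIdeal A) (n : ℕ)
    (hn : maximalIdeal A ^ n ≤ Module.annihilator A N ⊔ Ideal.span (Set.range us) ⊔
      Ideal.span {algebraMap D A ϖ}) :
    Module.Finite (MvPowerSeries (Fin r) D) N := by
  let J : Ideal (MvPowerSeries (Fin r) D) := Ideal.span (Set.range MvPowerSeries.X)
  have hJ : J.map (algebraMap _ A) = Ideal.span (Set.range us) := by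
    rw [Ideal.map_span, ← Set.range_comp]
    congr 2
    exact funext hX
  have hD : (maximalIdeal D).map (algebraMap D A) = Ideal.span {algebraMap D A ϖ} := by
    rw [hϖ, Ideal.map_span, Set.image_singleton]
  refine finite_of_finite_quotient_map (A := A) J ?_ ?_
  · rw [hJ, Ideal.span_le]
    rintro _ ⟨j, rfl⟩
    exact hus j
  let : Module D (N ⧸ (J.map (algebraMap (MvPowerSeries (Fin r) D) A) • ⊤ : Submodule A N)) :=
    Module.compHom _ (algebraMap D A)
  have : IsScalarTower D A (N ⧸ (J.map (algebraMap (MvPowerSeries (Fin r) D) A) • ⊤ : Submodule A N)) :=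
    IsScalarTower.of_algebraMap_smul fun _ _ => rfl
  have : IsScalarTower D (MvPowerSeries (Fin r) D)
      (N ⧸ (J.map (algebraMap (MvPowerSeries (Fin r) D) A) • ⊤ : Submodule A N)) :=
    IsScalarTower.of_algebraMap_smul fun d y => by
      rw [← algebraMap_smul A (algebraMap D (MvPowerSeries (Fin r) D) d) y,
        ← IsScalarTower.algebraMap_apply D (MvPowerSeries (Fin r) D) A, algebraMap_smul]
  suffices h : Module.Finite D
      (N ⧸ (J.map (algebraMap (MvPowerSeries (Fin r) D) A) • ⊤ : Submodule A N)) from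
    Module.Finite.of_restrictScalars_finite D _ _
  refine finite_of_finite_quotient_map (A := A) (maximalIdeal D) ?_ ?_
  · rw [hD, Ideal.span_singleton_le_iff_mem]; exact hϖA
  refine finite_of_pow_maximalIdeal_le hφ n ?_
  rw [eq_bot_iff, Submodule.smul_le]
  intro a ha y _
  suffices h : maximalIdeal A ^ n ≤ Module.annihilator A
      ((N ⧸ (J.map (algebraMap (MvPowerSeries (Fin r) D) A) • ⊤ : Submodule A N)) ⧸
      ((maximalIdeal D).map (algebraMap D A) • ⊤ : Submodule A
        (N ⧸ (J.map (algebraMap (MvPowerSeries (Fin r) D) A) • ⊤ : Submodule A N)))) by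
    exact (Submodule.mem_bot A).mpr (Module.mem_annihilator.1 (h ha) y)
  refine hn.trans (sup_le (sup_le ?_ ?_) ?_)
  · intro c hc
    rw [Module.mem_annihilator] at hc ⊢
    intro y
    obtain ⟨y, rfl⟩ := Submodule.Quotient.mk_surjective _ y
    obtain ⟨y, rfl⟩ := Submodule.Quotient.mk_surjective _ y
    rw [← Submodule.Quotient.mk_smul, ← Submodule.Quotient.mk_smul, hc]; rfl
  · rw [← hJ]
    intro c hc
    rw [Module.mem_annihilator]
    intro y
    obtain ⟨y, rfl⟩ := Submodule.Quotient.mk_surjective _ y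
    obtain ⟨y, rfl⟩ := Submodule.Quotient.mk_surjective _ y
    rw [← Submodule.Quotient.mk_smul, ← Submodule.Quotient.mk_smul,
      (Submodule.Quotient.mk_eq_zero _).mpr (Submodule.smul_mem_smul hc Submodule.mem_top)]; rfl
  · rw [← hD]
    intro c hc
    rw [Module.mem_annihilator]
    intro y
    obtain ⟨y, rfl⟩ := Submodule.Quotient.mk_surjective _ y
    rw [← Submodule.Quotient.mk_smul,
      (Submodule.Quotient.mk_eq_zero _).mpr (Submodule.smul_mem_smul hc Submodule.mem_top)]
end

lemma ringKrullDim_quotient_singleton_add_one_le {B : Type*} [CommRing B] [IsDomain B] {b : B} (hb : b ≠ 0) :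
    ringKrullDim (B ⧸ Ideal.span {b}) + 1 ≤ ringKrullDim B :=
  ringKrullDim_quotient_succ_le_of_nonZeroDivisor (mem_nonZeroDivisors_of_ne_zero hb)

lemma not_add_one_le_of_le {x : WithBot ℕ∞} {n : ℕ} (h : (n : WithBot ℕ∞) ≤ x)
    (h' : x + 1 ≤ (n : WithBot ℕ∞)) : False := by
  have h2 : ((n : WithBot ℕ∞)) + 1 ≤ n := (add_le_add_left h 1).trans h'
  norm_cast at h2
  omega

section
variable {D A : Type u} [CommRing D] [IsDomain D] [IsPrincipalIdealRing D] [IsLocalRing D]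
  [IsAdicComplete (maximalIdeal D) D] [CommRing A] [IsNoetherianRing A] [IsLocalRing A]
  [IsAdicComplete (maximalIdeal A) A]

/-- Nonvanishing of self-extensions over a complete local ring with a suitable system of parameters
and coefficient ring. -/
theorem extMod_self_nonzero_of_parameters (ϖ : D) (hϖ : maximalIdeal D = Ideal.span {ϖ}) (hϖ0 : ϖ ≠ 0)
    (φ : D →+* A) (hφ : ∀ a, ∃ d, a - φ d ∈ maximalIdeal A) {r s : ℕ} (us : Fin r → A)
    (vs : Fin (s + 1) → A)
    (hmax : maximalIdeal A = Ideal.span (Set.range vs) ⊔ Ideal.span (Set.range us) ⊔ Ideal.span {φ ϖ})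
    (hreg : WeaklyRegularMod ⊥ (List.ofFn us ++ List.ofFn vs))
    (hN : ∃ N : ℕ, φ ϖ ^ N ∈ Ideal.span (Set.range us) ⊔ Ideal.span (Set.range vs))
    (M : Type u) [AddCommGroup M] [Module A M] [Module.Finite A M] (n : ℕ)
    (hn : maximalIdeal A ^ n ≤ Module.annihilator A M ⊔ Ideal.span (Set.range us) ⊔ Ideal.span {φ ϖ})
    (e : ℕ) (he : (e = 0 ∧ (r : WithBot ℕ∞) < ringKrullDim (A ⧸ Module.annihilator A M)) ∨
      (e = 1 ∧ ringKrullDim (A ⧸ Module.annihilator A M) ≤ r ∧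
        (r : WithBot ℕ∞) ≤ ringKrullDim (A ⧸ (Module.annihilator A M ⊔ Ideal.span {φ ϖ}))))
    (i : ℕ) (hi : i + 1 ≤ e + s) : ¬ Subsingleton (extMod A (i + 1) M M) := by
  obtain ⟨β, Φ, f, hβC, hβX, hΦC, hΦX, hs, hf, hk⟩ :=
    exists_mvPowerSeries_presentation ϖ hϖ hϖ0 φ hφ us vs hmax hreg hN
  let : Algebra D A := φ.toAlgebra
  let : Algebra (MvPowerSeries (Fin r) D) A := β.toAlgebra
  let : Algebra (MvPowerSeries (Fin (s + 1)) (MvPowerSeries (Fin r) D)) A := Φ.toAlgebra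
  have : IsScalarTower D (MvPowerSeries (Fin r) D) A :=
    IsScalarTower.of_algebraMap_eq fun d => (hβC d).symm
  have : IsScalarTower (MvPowerSeries (Fin r) D) (MvPowerSeries (Fin (s + 1)) (MvPowerSeries (Fin r) D)) A :=
    IsScalarTower.of_algebraMap_eq fun d => (hΦC d).symm
  let : Module (MvPowerSeries (Fin r) D) M := Module.compHom M (algebraMap (MvPowerSeries (Fin r) D) A)
  have : IsScalarTower (MvPowerSeries (Fin r) D) A M := IsScalarTower.of_algebraMap_smul fun _ _ => rfl
  have husm : ∀ j, us j ∈ maximalIdeal A := fun j => by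
    rw [hmax]
    exact Ideal.mem_sup_left (Ideal.mem_sup_right (Ideal.subset_span ⟨j, rfl⟩))
  have hϖA : φ ϖ ∈ maximalIdeal A := by
    rw [hmax]
    exact Ideal.mem_sup_right (Ideal.mem_span_singleton_self _)
  have hMf : Module.Finite (MvPowerSeries (Fin r) D) M :=
    finite_mvPowerSeries_of_pow_le (A := A) hϖ hϖA hφ us hβX husm n hn
  have hInt : ∀ I : Ideal A, Module.annihilator A M ≤ I → Algebra.IsIntegral (MvPowerSeries (Fin r) D) (A ⧸ I) := by
    intro I hI
    have : Module.Finite (MvPowerSeries (Fin r) D) (A ⧸ I) :=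
      finite_mvPowerSeries_of_pow_le (A := A) hϖ hϖA hφ us hβX husm n (hn.trans (by
        rw [Ideal.annihilator_quotient]
        exact sup_le_sup_right (sup_le_sup_right hI _) _))
    exact Algebra.IsIntegral.of_finite _ _
  have : IsDomain (MvPowerSeries (Fin r) D) := NoZeroDivisors.to_isDomain _
  have hdimB : ringKrullDim (MvPowerSeries (Fin r) D) ≤ ((r + 1 : ℕ) : WithBot ℕ∞) :=
    ringKrullDim_mvPowerSeries_le hϖ
  have hann : ∀ b : MvPowerSeries (Fin r) D, (∀ m : M, b • m = 0) →
      algebraMap (MvPowerSeries (Fin r) D) A b ∈ Module.annihilator A M := fun b hb => by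
    rw [Module.mem_annihilator]; exact hb
  have := hInt _ le_rfl
  rcases he with ⟨he, hdim⟩ | ⟨he, hdim1, hdim2⟩
  · refine extMod_self_nonzero_of_mvPowerSeries hs hk hf (0 : MvPowerSeries (Fin r) D) ?_ ?_ e (.inl ⟨he, rfl⟩) i hi
    · rw [Set.singleton_zero, Ideal.span_zero]; exact Ideal.isPrime_bot
    · intro b hb
      rw [zero_dvd_iff]
      by_contra hb0
      refine absurd hdim (not_lt.mpr ?_)
      refine (ringKrullDim_le_quotient_of_isIntegral (B := MvPowerSeries (Fin r) D) (L := Ideal.span {b}) ?_).trans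
        (withBot_le_of_add_one_le ((ringKrullDim_quotient_singleton_add_one_le hb0).trans hdimB))
      intro c hc
      obtain ⟨c, rfl⟩ := Ideal.mem_span_singleton'.mp hc
      rw [map_mul, IsScalarTower.algebraMap_apply _ A _ b, Ideal.Quotient.algebraMap_eq,
        Ideal.Quotient.eq_zero_iff_mem.mpr (hann b hb), mul_zero]
  · have hpD : (Ideal.span {ϖ}).IsPrime := hϖ ▸ (maximalIdeal.isMaximal D).isPrime
    have hCp := span_C_isPrime (r := r) hpD
    have hC0 : (MvPowerSeries.C ϖ : MvPowerSeries (Fin r) D) ≠ 0 := by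
      rw [Ne, map_eq_zero_iff _ MvPowerSeries.C_injective]; exact hϖ0
    have hC1 := ringKrullDim_quotient_singleton_add_one_le hC0
    have := hInt (Module.annihilator A M ⊔ Ideal.span {φ ϖ}) le_sup_left
    have hCz : algebraMap (MvPowerSeries (Fin r) D) (A ⧸ (Module.annihilator A M ⊔ Ideal.span {φ ϖ}))
        (MvPowerSeries.C ϖ) = 0 := by
      rw [IsScalarTower.algebraMap_apply _ A _, Ideal.Quotient.algebraMap_eq]
      refine Ideal.Quotient.eq_zero_iff_mem.mpr (Ideal.mem_sup_right ?_)
      have : algebraMap (MvPowerSeries (Fin r) D) A (MvPowerSeries.C ϖ) = φ ϖ := hβC ϖ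
      rw [this]
      exact Ideal.mem_span_singleton_self _
    refine extMod_self_nonzero_of_mvPowerSeries hs hk hf (MvPowerSeries.C ϖ : MvPowerSeries (Fin r) D) hCp ?_ e
      (.inr ⟨he, hC0, ?_⟩) i hi
    · intro b hb
      by_contra hb0
      rw [← Ideal.mem_span_singleton] at hb0
      have h1 := ringKrullDim_le_quotient_of_isIntegral (B := MvPowerSeries (Fin r) D)
        (E := A ⧸ (Module.annihilator A M ⊔ Ideal.span {φ ϖ}))
        (L := Ideal.span {MvPowerSeries.C ϖ} ⊔ Ideal.span {b}) (by
          change _ ≤ RingHom.ker _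
          rw [sup_le_iff, Ideal.span_singleton_le_iff_mem, Ideal.span_singleton_le_iff_mem]
          refine ⟨hCz, ?_⟩
          rw [RingHom.mem_ker, IsScalarTower.algebraMap_apply _ A _ b, Ideal.Quotient.algebraMap_eq]
          exact Ideal.Quotient.eq_zero_iff_mem.mpr (Ideal.mem_sup_left (hann b hb)))
      have := hCp
      have h2 := ringKrullDim_succ_le_of_surjective
        (Ideal.Quotient.factor (le_sup_left : Ideal.span {MvPowerSeries.C ϖ} ≤ Ideal.span {MvPowerSeries.C ϖ} ⊔ Ideal.span {b}))
        (Ideal.Quotient.factor_surjective _) (r := Ideal.Quotient.mk _ b)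
        (mem_nonZeroDivisors_of_ne_zero (by rwa [Ne, Ideal.Quotient.eq_zero_iff_mem]))
        (by
          rw [Ideal.Quotient.factor_mk]
          exact Ideal.Quotient.eq_zero_iff_mem.mpr (Ideal.mem_sup_right (Ideal.mem_span_singleton_self _)))
      exact not_add_one_le_of_le (hdim2.trans h1) (h2.trans (withBot_le_of_add_one_le (hC1.trans hdimB)))
    · by_contra hno
      push Not at hno
      have hinj : Function.Injective (algebraMap (MvPowerSeries (Fin r) D) (A ⧸ Module.annihilator A M)) := by
        rw [injective_iff_map_eq_zero]
        intro b hb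
        by_contra hb0
        obtain ⟨m, hm⟩ := hno b hb0
        rw [IsScalarTower.algebraMap_apply _ A _ b, Ideal.Quotient.algebraMap_eq,
          Ideal.Quotient.eq_zero_iff_mem, Module.mem_annihilator] at hb
        exact hm (hb m)
      have h1 := ringKrullDim_le_of_isIntegral_of_injective hinj
      have h2 := ringKrullDim_le_quotient_of_isIntegral (B := MvPowerSeries (Fin r) D)
        (E := A ⧸ (Module.annihilator A M ⊔ Ideal.span {φ ϖ})) (L := Ideal.span {MvPowerSeries.C ϖ}) (by
          intro c hc
          obtain ⟨c, rfl⟩ := Ideal.mem_span_singleton'.mp hc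
          rw [map_mul, hCz, mul_zero])
      exact not_add_one_le_of_le (hdim2.trans h2) (hC1.trans (h1.trans hdim1))
end

section
open Polynomial

lemma aeval_eq_zero_of_map_eq_zero {F E k : Type*} [Field F] [CommRing E] [Field k] [Algebra F E] {p : ℕ}
    (hp : p.Prime) [CharP k p] (π : E →+* k) (e : E) (c : F) (hc : algebraMap F E c = e ^ p)
    (hne : ∀ x : F, π (algebraMap F E x) ≠ π e) (g : F[X]) (hg : π (aeval e g) = 0) : aeval e g = 0 := by
  let : Algebra F k := (π.comp (algebraMap F E)).toAlgebra
  have : Fact p.Prime := ⟨hp⟩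
  have : ExpChar k p := ExpChar.prime hp
  have hirr : Irreducible (X ^ p - C c) := by
    refine X_pow_sub_C_irreducible_of_prime hp fun b hb => hne b ?_
    apply frobenius_inj k p
    rw [frobenius_def, frobenius_def, ← map_pow, ← map_pow, ← map_pow, hb, hc]
  have hroot : ∀ q : F[X], aeval (π e) q = π (aeval e q) := fun q => by
    rw [aeval_def, aeval_def, Polynomial.hom_eval₂]; rfl
  have h1 : X ^ p - C c = minpoly F (π e) := by
    refine minpoly.eq_of_irreducible_of_monic hirr ?_ (monic_X_pow_sub_C c hp.ne_zero)
    rw [hroot, map_sub, map_pow, aeval_X, aeval_C, hc, sub_self, map_zero]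
  obtain ⟨h, rfl⟩ : X ^ p - C c ∣ g := h1 ▸ minpoly.dvd F (π e) (by rw [hroot, hg])
  rw [map_mul, map_sub, map_pow, aeval_X, aeval_C, hc, sub_self, zero_mul]

lemma exists_section_of_charP {E k : Type*} [CommRing E] [Field k] {p : ℕ} (hp : p.Prime) [CharP E p]
    [CharP k p] (π : E →+* k) (hπ : Function.Surjective π) (hker : ∀ x, π x = 0 → x ^ p = 0) :
    ∃ σ : k →+* E, π.comp σ = RingHom.id k := by
  have : Fact p.Prime := ⟨hp⟩
  have : ExpChar E p := ExpChar.prime hp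
  have : Nontrivial E := π.domain_nontrivial
  obtain ⟨F, -, hF⟩ := zorn_le_nonempty₀
    {F : Subring E | (frobenius E p).range ≤ F ∧ ∀ x ∈ F, π x = 0 → x = 0} (by
      intro c hc hchain y hy
      have hmem := fun x => @Subring.mem_sSup_of_directedOn E _ c ⟨y, hy⟩ hchain.directedOn x
      refine ⟨sSup c, ⟨(hc hy).1.trans (le_sSup hy), ?_⟩, fun z hz => le_sSup hz⟩
      intro x hx h0
      obtain ⟨z, hz, hxz⟩ := (hmem x).1 hx
      exact (hc hz).2 x hxz h0) (frobenius E p).range (by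
      refine ⟨le_rfl, ?_⟩
      rintro _ ⟨y, rfl⟩ h0
      rw [frobenius_def] at h0 ⊢
      rw [map_pow] at h0
      exact hker y (pow_eq_zero_iff hp.ne_zero |>.1 h0))
  obtain ⟨⟨hfrob, hinj⟩, hmax⟩ := hF
  have hfield : IsField F := by
    refine ⟨⟨0, 1, zero_ne_one⟩, mul_comm, ?_⟩
    rintro ⟨x, hx⟩ hx0
    have hpx : π x ≠ 0 := fun h => hx0 (Subtype.ext (hinj x hx h))
    obtain ⟨y, hy⟩ := hπ (π x)⁻¹
    refine ⟨⟨x ^ (p - 1) * y ^ p, F.mul_mem (F.pow_mem hx _) (hfrob ⟨y, rfl⟩)⟩, ?_⟩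
    apply Subtype.ext
    change x * (x ^ (p - 1) * y ^ p) = 1
    rw [← sub_eq_zero]
    refine hinj _ (F.sub_mem (F.mul_mem hx (F.mul_mem (F.pow_mem hx _) (hfrob ⟨y, rfl⟩))) F.one_mem) ?_
    rw [← mul_assoc, mul_pow_sub_one hp.ne_zero, ← mul_pow, map_sub, map_pow, map_mul, hy,
      mul_inv_cancel₀ hpx, one_pow, map_one, sub_self]
  have hsurj : ∀ a : k, ∃ x : F, π x = a := by
    intro a
    by_contra hno
    push Not at hno
    obtain ⟨e, rfl⟩ := hπ a
    let : Field F := hfield.toField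
    have key := aeval_eq_zero_of_map_eq_zero (F := F) hp π e ⟨e ^ p, hfrob ⟨e, rfl⟩⟩ rfl hno
    have hle : F ≤ (aeval (R := F) e).range.toSubring := fun x hx =>
      ⟨C ⟨x, hx⟩, aeval_C e _⟩
    have h2 : (aeval (R := F) e).range.toSubring ≤ F := hmax ⟨hfrob.trans hle, by
      rintro _ ⟨g, rfl⟩ h0
      exact key g h0⟩ hle
    exact hno ⟨e, h2 ⟨X, aeval_X e⟩⟩ rfl
  let ρ : F →+* k := π.comp F.subtype
  have hρ : Function.Bijective ρ := by
    refine ⟨(injective_iff_map_eq_zero _).2 fun x hx => Subtype.ext (hinj x x.2 hx), hsurj⟩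
  refine ⟨F.subtype.comp (RingEquiv.ofBijective ρ hρ).symm.toRingHom, ?_⟩
  ext a
  exact (RingEquiv.ofBijective ρ hρ).apply_symm_apply a

lemma formallySmooth_zmod {k : Type u} [Field k] {p : ℕ} (hp : p.Prime) [Algebra (ZMod p) k] :
    Algebra.FormallySmooth (ZMod p) k := by
  have : Fact p.Prime := ⟨hp⟩
  have : CharP k p := charP_of_injective_algebraMap (algebraMap (ZMod p) k).injective p
  refine Algebra.FormallySmooth.of_comp_surjective ?_
  intro B _ _ I hI f
  have hI2 : ∀ x ∈ I, x * x = 0 := fun x hx => by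
    have := Ideal.mul_mem_mul hx hx
    rwa [← pow_two, hI] at this
  let E : Subring (k × B) := RingHom.eqLocus (f.toRingHom.comp (RingHom.fst k B))
    ((Ideal.Quotient.mk I).comp (RingHom.snd k B))
  have : CharP E p := by
    refine ⟨fun n => ?_⟩
    rw [← CharP.cast_eq_zero_iff k p n]
    constructor
    · intro h
      have := congrArg (fun e : E => e.1.1) h
      simpa using this
    · intro h
      rw [CharP.cast_eq_zero_iff k p n] at h
      apply Subtype.ext
      obtain ⟨m, rfl⟩ := h
      have hB : ((p : ℕ) : B) = 0 := by
        rw [← map_natCast (algebraMap (ZMod p) B), CharP.cast_eq_zero, map_zero]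
      ext
      · simp
      · simp [hB]
  let π : E →+* k := (RingHom.fst k B).comp E.subtype
  obtain ⟨σ, hσ⟩ := exists_section_of_charP hp π (fun a => by
      obtain ⟨b, hb⟩ := Ideal.Quotient.mk_surjective (f a)
      exact ⟨⟨(a, b), hb.symm⟩, rfl⟩) (by
      rintro ⟨⟨a, b⟩, h⟩ (rfl : a = 0)
      have hb : b ∈ I := by
        rw [← Ideal.Quotient.eq_zero_iff_mem]
        have : f 0 = Ideal.Quotient.mk I b := h
        rw [← this, map_zero]
      apply Subtype.ext
      have : b ^ p = 0 := pow_eq_zero_of_le hp.two_le (by rw [pow_two, hI2 b hb])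
      ext
      · simp [hp.ne_zero]
      · exact this)
  refine ⟨⟨((RingHom.snd k B).comp E.subtype).comp σ, fun r => ?_⟩, ?_⟩
  · have := RingHom.congr_fun (Subsingleton.elim ((((RingHom.snd k B).comp E.subtype).comp σ).comp (algebraMap (ZMod p) k)) (algebraMap (ZMod p) B)) r
    exact this
  · ext a
    have h1 : (σ a).1.1 = a := RingHom.congr_fun hσ a
    have h2 : f (σ a).1.1 = Ideal.Quotient.mk I (σ a).1.2 := (σ a).2
    rw [h1] at h2
    exact h2.symm
end

lemma formallySmooth_rat {k : Type u} [Field k] [Algebra ℚ k] : Algebra.FormallySmooth ℚ k := by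
  obtain ⟨s, hs⟩ := exists_isTranscendenceBasis ℚ k
  have := hs.isAlgebraic_field
  have : CharZero k := charZero_of_injective_algebraMap (algebraMap ℚ k).injective
  have : Algebra.IsSeparable (IntermediateField.adjoin ℚ (Set.range ((↑) : s → k))) k := inferInstance
  exact Algebra.FormallySmooth.of_algebraicIndependent_of_isSeparable hs.1

section
variable {A : Type u} [CommRing A] [IsLocalRing A] [IsAdicComplete (maximalIdeal A) A]

lemma exists_coefficient_field_of_formallySmooth {K : Type*} [CommRing K] [Algebra K A]
    [Algebra.FormallySmooth K (ResidueField A)] :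
    ∃ σ : ResidueField A →+* A, ∀ a, residue A (σ a) = a := by
  obtain ⟨g, hg⟩ := Algebra.FormallySmooth.exists_mkₐ_comp_eq_of_isAdicComplete (R := K) (S := A)
    (A := ResidueField A) (I := maximalIdeal A) (AlgHom.id K (ResidueField A))
  exact ⟨g, fun a => DFunLike.congr_fun hg a⟩

lemma exists_coefficient_field (h : ringChar A = ringChar (ResidueField A)) :
    ∃ σ : ResidueField A →+* A, ∀ a, residue A (σ a) = a := by
  rcases CharP.char_is_prime_or_zero (ResidueField A) (ringChar (ResidueField A)) with hp | h0
  · set p := ringChar (ResidueField A) with hpdef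
    have : CharP A p := ringChar.of_eq h
    let : Algebra (ZMod p) A := ZMod.algebra A p
    have := formallySmooth_zmod (k := ResidueField A) hp
    exact exists_coefficient_field_of_formallySmooth (K := ZMod p)
  · have : CharP (ResidueField A) 0 := ringChar.of_eq h0
    have : CharZero (ResidueField A) := CharP.charP_to_charZero _
    obtain ⟨_⟩ := EqualCharZero.nonempty_algebraRat_iff (R := A) |>.2 fun I hI => by
      refine ⟨fun m n hmn => ?_⟩
      apply Nat.cast_injective (R := ResidueField A)
      have := congrArg (Ideal.Quotient.factor (le_maximalIdeal hI)) hmn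
      rw [map_natCast, map_natCast] at this
      exact this
    exact @exists_coefficient_field_of_formallySmooth A _ _ _ ℚ _ _ (@formallySmooth_rat (ResidueField A) _ (ResidueField.algebra A))
end

section
variable {V E : Type u} [CommRing V] [CommRing E] {p : ℕ}

/-- Sections over `p`-torsion-free rings that are formally smooth modulo `p`. -/
lemma exists_section_of_formallySmooth_mod (hV : ∀ v : V, (p : V) * v = 0 → v = 0)
    [Algebra (ZMod p) (V ⧸ Ideal.span {(p : V)})]
    [Algebra.FormallySmooth (ZMod p) (V ⧸ Ideal.span {(p : V)})]
    (π : E →+* V) (hπ : Function.Surjective π)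
    (hsq : ∀ x y, π x = 0 → π y = 0 → x * y = 0) (hpk : ∀ x, π x = 0 → (p : E) * x = 0) :
    ∃ σ : V →+* E, ∀ v, π (σ v) = v := by
  let E' := E ⧸ Ideal.span {(p : E)}
  have : CharP (ZMod p) p := ZMod.charP p
  have hpE' : ((p : ℕ) : E') = 0 := by
    rw [← map_natCast (Ideal.Quotient.mk (Ideal.span {(p : E)}))]
    exact Ideal.Quotient.eq_zero_iff_mem.2 (Ideal.mem_span_singleton_self _)
  let V' := V ⧸ Ideal.span {(p : V)}
  let : Algebra (ZMod p) E' := (ZMod.castHom (ringChar.dvd hpE') E').toAlgebra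
  have hle : Ideal.span {(p : E)} ≤ (Ideal.span {(p : V)}).comap π := by
    rw [Ideal.span_singleton_le_iff_mem, Ideal.mem_comap, map_natCast]
    exact Ideal.mem_span_singleton_self _
  let π₀ : E' →+* V' := Ideal.quotientMap _ π hle
  let π' : E' →ₐ[ZMod p] V' := ⟨π₀, fun r =>
    RingHom.congr_fun (Subsingleton.elim (π₀.comp (algebraMap (ZMod p) E')) (algebraMap (ZMod p) V')) r⟩
  have hπ' : Function.Surjective π' := Ideal.quotientMap_surjective (H := hle) hπ
  have hker : ∀ e, π' e = 0 → ∃ j, π j = 0 ∧ Ideal.Quotient.mk _ j = e := by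
    intro e he
    obtain ⟨e, rfl⟩ := Ideal.Quotient.mk_surjective e
    have he : Ideal.Quotient.mk (Ideal.span {(p : V)}) (π e) = 0 := he
    rw [Ideal.Quotient.eq_zero_iff_mem, Ideal.mem_span_singleton] at he
    obtain ⟨w, hw⟩ := he
    obtain ⟨w, rfl⟩ := hπ w
    refine ⟨e - p * w, by rw [map_sub, hw, map_mul, map_natCast, sub_self], ?_⟩
    rw [Ideal.Quotient.eq, Ideal.mem_span_singleton]
    exact ⟨-w, by ring⟩
  have hinj : ∀ j, π j = 0 → (Ideal.Quotient.mk _ j : E') = 0 → j = 0 := by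
    intro j hj h0
    rw [Ideal.Quotient.eq_zero_iff_mem, Ideal.mem_span_singleton] at h0
    obtain ⟨e, rfl⟩ := h0
    rw [map_mul, map_natCast] at hj
    exact hpk e (hV _ hj)
  have hnil : IsNilpotent (RingHom.ker (π' : E' →+* V')) := by
    refine ⟨2, ?_⟩
    rw [Ideal.zero_eq_bot, eq_bot_iff, pow_two, Ideal.mul_le]
    intro x hx y hy
    obtain ⟨x, hx', rfl⟩ := hker x hx
    obtain ⟨y, hy', rfl⟩ := hker y hy
    rw [← map_mul, hsq x y hx' hy', map_zero]; exact Ideal.zero_mem _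
  let τ : V' →ₐ[ZMod p] E' :=
    Algebra.FormallySmooth.liftOfSurjective (AlgHom.id _ V') π' hπ' hnil
  have hτ : ∀ v, π' (τ v) = v := Algebra.FormallySmooth.liftOfSurjective_apply (AlgHom.id _ V') π' hπ' hnil
  have hex : ∀ v, ∃ e, π e = v ∧ Ideal.Quotient.mk _ e = τ (Ideal.Quotient.mk _ v) := by
    intro v
    obtain ⟨e, rfl⟩ := hπ v
    obtain ⟨j, hj, h⟩ := hker (Ideal.Quotient.mk _ e - τ (Ideal.Quotient.mk _ (π e))) (by
      rw [map_sub, hτ]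
      exact sub_self _)
    exact ⟨e - j, by rw [map_sub, hj, sub_zero], by rw [map_sub, h, sub_sub_cancel]⟩
  choose σ hσ1 hσ2 using hex
  have huniq : ∀ e v, π e = v → Ideal.Quotient.mk _ e = τ (Ideal.Quotient.mk _ v) → e = σ v := by
    intro e v h1 h2
    rw [← sub_eq_zero]
    apply hinj
    · rw [map_sub, h1, hσ1, sub_self]
    · rw [map_sub, h2, hσ2, sub_self]
  refine ⟨{ toFun := σ, map_one' := ?_, map_mul' := ?_, map_zero' := ?_, map_add' := ?_ }, hσ1⟩
  · exact (huniq 1 1 (map_one _) (by rw [map_one, map_one, map_one])).symm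
  · exact fun x y => (huniq _ _ (by rw [map_mul, hσ1, hσ1]) (by rw [map_mul, hσ2, hσ2, map_mul, map_mul])).symm
  · exact (huniq 0 0 (map_zero _) (by rw [map_zero, map_zero, map_zero])).symm
  · exact fun x y => (huniq _ _ (by rw [map_add, hσ1, hσ1]) (by rw [map_add, hσ2, hσ2, map_add, map_add])).symm
end

/-- The coefficient ring map in mixed characteristic. -/
lemma exists_lift_residueField {V A : Type u} [CommRing V] [IsLocalRing V] [CommRing A] [IsLocalRing A]
    [IsAdicComplete (maximalIdeal A) A] {p : ℕ} (hp : p.Prime)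
    (hV : ∀ v : V, (p : V) * v = 0 → v = 0) (hmax : maximalIdeal V = Ideal.span {(p : V)})
    (hpA : (p : A) ∈ maximalIdeal A) (ψ : V →+* ResidueField A) :
    ∃ φ : V →+* A, ∀ v, residue A (φ v) = ψ v := by
  have hm : (Ideal.span {(p : V)}).IsMaximal := hmax ▸ maximalIdeal.isMaximal V
  have hpV : ((p : ℕ) : V ⧸ Ideal.span {(p : V)}) = 0 := by
    rw [← map_natCast (Ideal.Quotient.mk (Ideal.span {(p : V)}))]
    exact Ideal.Quotient.eq_zero_iff_mem.2 (Ideal.mem_span_singleton_self _)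
  let : Algebra (ZMod p) (V ⧸ Ideal.span {(p : V)}) :=
    (ZMod.castHom (ringChar.dvd hpV) (V ⧸ Ideal.span {(p : V)})).toAlgebra
  have : Algebra.FormallySmooth (ZMod p) (V ⧸ Ideal.span {(p : V)}) :=
    @formallySmooth_zmod (V ⧸ Ideal.span {(p : V)}) (Ideal.Quotient.field _) p hp _
  set m := maximalIdeal A
  have hstep : ∀ (n : ℕ) (g : V →+* A ⧸ m ^ (n + 1)), ∃ g' : V →+* A ⧸ m ^ (n + 2),
      (Ideal.Quotient.factorPow m (Nat.le_succ (n + 1))).comp g' = g := by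
    intro n g
    let θ := Ideal.Quotient.factorPow m (Nat.le_succ (n + 1))
    let E : Subring (V × (A ⧸ m ^ (n + 2))) := RingHom.eqLocus (g.comp (RingHom.fst V (A ⧸ m ^ (n + 2))))
      (θ.comp (RingHom.snd V (A ⧸ m ^ (n + 2))))
    have hθ : ∀ y, θ y = 0 → ∃ b ∈ m ^ (n + 1), Ideal.Quotient.mk _ b = y := by
      intro y hy
      obtain ⟨b, rfl⟩ := Ideal.Quotient.mk_surjective y
      exact ⟨b, Ideal.Quotient.eq_zero_iff_mem.1 hy, rfl⟩
    let π : E →+* V := (RingHom.fst V (A ⧸ m ^ (n + 2))).comp E.subtype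
    have hker : ∀ e : E, π e = 0 → ∃ b ∈ m ^ (n + 1), e.1 = (0, Ideal.Quotient.mk _ b) := by
      rintro ⟨⟨v, y⟩, h⟩ (rfl : v = 0)
      have h : g 0 = θ y := h
      rw [map_zero] at h
      obtain ⟨b, hb, rfl⟩ := hθ y h.symm
      exact ⟨b, hb, rfl⟩
    obtain ⟨σ, hσ⟩ := exists_section_of_formallySmooth_mod (p := p) hV π (by
        intro v
        obtain ⟨y, hy⟩ := Ideal.Quotient.factor_surjective (Ideal.pow_le_pow_right (Nat.le_succ (n + 1))) (g v)
        exact ⟨⟨(v, y), hy.symm⟩, rfl⟩) (by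
        intro x y hx hy
        obtain ⟨b, hb, hb'⟩ := hker x hx
        obtain ⟨c, hc, hc'⟩ := hker y hy
        apply Subtype.ext
        change x.1 * y.1 = 0
        rw [hb', hc', Prod.mk_mul_mk, ← map_mul, mul_zero]
        refine Prod.ext rfl (Ideal.Quotient.eq_zero_iff_mem.2 ?_)
        have := Ideal.mul_mem_mul hb hc
        rw [← pow_add] at this
        exact Ideal.pow_le_pow_right (by omega) this) (by
        intro x hx
        obtain ⟨b, hb, hb'⟩ := hker x hx
        apply Subtype.ext
        change ((p : E) : V × (A ⧸ m ^ (n + 2))) * x.1 = 0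
        rw [hb']
        refine Prod.ext (mul_zero _) ?_
        change ((p : E) : V × (A ⧸ m ^ (n + 2))).2 * Ideal.Quotient.mk _ b = 0
        have : ((p : E) : V × (A ⧸ m ^ (n + 2))).2 = Ideal.Quotient.mk _ (p : A) := by
          simp
        rw [this, ← map_mul, Ideal.Quotient.eq_zero_iff_mem, pow_succ' m (n + 1)]
        exact Ideal.mul_mem_mul hpA hb)
    refine ⟨((RingHom.snd V (A ⧸ m ^ (n + 2))).comp E.subtype).comp σ, ?_⟩
    ext v
    have h1 : g (σ v).1.1 = θ (σ v).1.2 := (σ v).2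
    have h2 : (σ v).1.1 = v := hσ v
    rw [h2] at h1
    exact h1.symm
  have hle1 : m ≤ m ^ (0 + 1) := by simp
  have hle2 : m ^ (0 + 1) ≤ m := by simp
  let g₀ : V →+* A ⧸ m ^ (0 + 1) := (Ideal.Quotient.factor hle1).comp ψ
  let f : ∀ n : ℕ, V →+* A ⧸ m ^ (n + 1) := fun n =>
    Nat.rec (motive := fun n => V →+* A ⧸ m ^ (n + 1)) g₀ (fun n g => (hstep n g).choose) n
  have hf : ∀ n, (Ideal.Quotient.factorPow m (Nat.le_succ (n + 1))).comp (f (n + 1)) = f n := fun n =>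
    (hstep n (f n)).choose_spec
  have hmono : StrictMono (fun n : ℕ => n + 1) := fun a b h => Nat.succ_lt_succ h
  refine ⟨IsAdicComplete.StrictMono.liftRingHom m hmono f (fun {n} => hf n), fun v => ?_⟩
  have h := IsAdicComplete.StrictMono.mk_liftRingHom (I := m) hmono f (fun {n} => hf n) (n := 0) v
  have h2 := congrArg (Ideal.Quotient.factor hle2) h
  refine h2.trans ?_
  change Ideal.Quotient.factor hle2 (Ideal.Quotient.factor hle1 (ψ v)) = ψ v
  obtain ⟨a, ha⟩ := Ideal.Quotient.mk_surjective (ψ v)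
  rw [← ha]; rfl

lemma eq_bot_of_isPrime_le_span_singleton {Q : Type*} [CommRing Q] [IsLocalRing Q]
    [IsNoetherianRing Q] {P : Ideal Q} [P.IsPrime] {u : Q} (hu : u ∈ maximalIdeal Q) (huP : u ∉ P)
    (hP : P ≤ Ideal.span {u}) : P = ⊥ := by
  refine Submodule.eq_bot_of_le_smul_of_le_jacobson_bot (Ideal.span {u}) P
    (IsNoetherian.noetherian P) ?_ ?_
  · intro y hy
    obtain ⟨c, rfl⟩ := Ideal.mem_span_singleton'.1 (hP hy)
    have hc : c ∈ P := (‹P.IsPrime›.mem_or_mem hy).resolve_right huP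
    rw [mul_comm]
    exact Submodule.smul_mem_smul (Ideal.mem_span_singleton_self u) hc
  · rw [IsLocalRing.jacobson_eq_maximalIdeal _ bot_ne_top]
    exact (Ideal.span_singleton_le_iff_mem _).2 hu

/-- Regularity of dimension `n`: the maximal ideal of a local ring of dimension `n` has at most
`n` generators. -/
def IsRegularOfDim (Q : Type*) [CommRing Q] [IsLocalRing Q] (n : ℕ) : Prop :=
  ringKrullDim Q = n ∧ ∃ s : Finset Q, s.card ≤ n ∧ Ideal.span (s : Set Q) = maximalIdeal Q

section
variable {Q : Type*} [CommRing Q] [IsLocalRing Q] [IsNoetherianRing Q]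

lemma isLocalRing_quotient_span_singleton {u : Q} (hu : u ∈ maximalIdeal Q) :
    IsLocalRing (Q ⧸ Ideal.span {u}) := by
  have : Nontrivial (Q ⧸ Ideal.span {u}) := Ideal.Quotient.nontrivial_iff.2 fun h =>
    (Ideal.IsPrime.ne_top' : maximalIdeal Q ≠ ⊤)
      (top_le_iff.1 (h ▸ (Ideal.span_singleton_le_iff_mem _).2 hu))
  exact IsLocalRing.of_surjective' (Ideal.Quotient.mk _) Ideal.Quotient.mk_surjective

lemma IsRegularOfDim.quotient {n : ℕ} (h : IsRegularOfDim Q (n + 1)) {u : Q}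
    (hu : u ∈ maximalIdeal Q) (hu2 : u ∉ maximalIdeal Q ^ 2)
    [IsLocalRing (Q ⧸ Ideal.span {u})] : IsRegularOfDim (Q ⧸ Ideal.span {u}) n := by
  classical
  obtain ⟨hd, s, hs, hsm⟩ := h
  obtain ⟨c, hc⟩ : ∃ c : Q → Q, ∑ a ∈ s, c a * a = u := by
    obtain ⟨c, -, hc⟩ := Submodule.mem_span_finset.1 (show u ∈ Ideal.span (s : Set Q) by rwa [hsm])
    exact ⟨c, by simpa using hc⟩
  obtain ⟨y, hy, hyu⟩ : ∃ y ∈ s, IsUnit (c y) := by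
    by_contra! H
    refine hu2 (hc ▸ Ideal.sum_mem _ fun a ha => ?_)
    rw [pow_two]
    exact Ideal.mul_mem_mul ((mem_maximalIdeal _).2 (H a ha)) (hsm ▸ Ideal.subset_span ha)
  have hmax : maximalIdeal (Q ⧸ Ideal.span {u}) =
      (maximalIdeal Q).map (Ideal.Quotient.mk (Ideal.span {u})) :=
    (IsLocalRing.map_maximalIdeal_of_surjective _ Ideal.Quotient.mk_surjective).symm
  set t : Finset (Q ⧸ Ideal.span {u}) := (s.erase y).image (Ideal.Quotient.mk _) with ht
  have htc : t.card ≤ n := by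
    refine Finset.card_image_le.trans ?_
    rw [Finset.card_erase_of_mem hy]; omega
  have hts : Ideal.span (t : Set (Q ⧸ Ideal.span {u})) = maximalIdeal (Q ⧸ Ideal.span {u}) := by
    rw [hmax, ← hsm, Ideal.map_span]
    apply le_antisymm
    · apply Ideal.span_mono
      rw [ht, Finset.coe_image]
      exact Set.image_mono (by simp)
    · rw [Ideal.span_le]
      rintro _ ⟨a, ha, rfl⟩
      by_cases hay : a = y
      · subst hay
        obtain ⟨v, hv⟩ := hyu.exists_left_inv
        have h0 : Ideal.Quotient.mk (Ideal.span {u}) u = 0 :=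
          Ideal.Quotient.eq_zero_iff_mem.2 (Ideal.mem_span_singleton_self u)
        have hc' := hc
        rw [← Finset.add_sum_erase _ _ ha] at hc'
        rw [← congrArg (Ideal.Quotient.mk (Ideal.span {u})) hc', map_add, add_eq_zero_iff_eq_neg] at h0
        have : Ideal.Quotient.mk (Ideal.span {u}) a =
            Ideal.Quotient.mk (Ideal.span {u}) v * -(Ideal.Quotient.mk (Ideal.span {u}) (∑ x ∈ s.erase a, c x * x)) := by
          rw [← h0, ← map_mul, ← mul_assoc, hv, one_mul]
        rw [this, map_sum]
        refine Ideal.mul_mem_left _ _ (neg_mem (Ideal.sum_mem _ fun x hx => ?_))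
        rw [map_mul]
        exact Ideal.mul_mem_left _ _ (Ideal.subset_span (Finset.mem_coe.2 (Finset.mem_image_of_mem _ hx)))
      · exact Ideal.subset_span (Finset.mem_coe.2 (Finset.mem_image_of_mem _ (Finset.mem_erase.2 ⟨hay, ha⟩)))
  refine ⟨le_antisymm ?_ ?_, t, htc, hts⟩
  · refine (ringKrullDim_le_spanFinrank_maximalIdeal _).trans ?_
    rw [← hts]
    have := Submodule.spanFinrank_span_le_ncard_of_finite (R := Q ⧸ Ideal.span {u}) (t.finite_toSet)
    rw [Set.ncard_coe_finset] at this
    exact_mod_cast this.trans htc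
  · have := ringKrullDim_le_ringKrullDim_quotient_add_card ({u} : Finset Q) (by
      rw [IsLocalRing.ringJacobson_eq_maximalIdeal]; simpa using hu)
    rw [hd] at this
    rw [Finset.coe_singleton, Finset.card_singleton] at this
    generalize ringKrullDim (Q ⧸ Ideal.span {u}) = D at this ⊢
    induction D with
    | bot =>
      rw [WithBot.bot_add, le_bot_iff] at this
      exact absurd this (by exact WithBot.coe_ne_bot)
    | coe D =>
      induction D with
      | top => exact_mod_cast le_top
      | coe D =>
        have h2 : ((n + 1 : ℕ) : WithBot ℕ∞) ≤ ((D + 1 : ℕ) : WithBot ℕ∞) := by exact_mod_cast this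
        have h3 : n + 1 ≤ D + 1 := by exact_mod_cast h2
        exact_mod_cast Nat.le_of_succ_le_succ h3

lemma ringKrullDim_quotient_sup_le {I : Ideal Q} {u : Q}
    (h : ∀ p ∈ I.minimalPrimes, u ∉ p) {n : ℕ} (hn : ringKrullDim (Q ⧸ I) ≤ (n + 1 : ℕ)) :
    ringKrullDim (Q ⧸ (I ⊔ Ideal.span {u})) ≤ n := by
  have h1 := Module.supportDim_quotSMulTop_succ_le_of_notMem_minimalPrimes (R := Q) (M := Q ⧸ I) (x := u)
    (by simpa [Ideal.annihilator_quotient] using h)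
  have h2 : Module.supportDim Q (QuotSMulTop u (Q ⧸ I)) = ringKrullDim (Q ⧸ (I ⊔ Ideal.span {u})) := by
    rw [ringKrullDim_quotient, Module.supportDim, Module.support_quotSMulTop,
      Module.support_eq_zeroLocus, Ideal.annihilator_quotient, PrimeSpectrum.zeroLocus_sup,
      PrimeSpectrum.zeroLocus_span]
  rw [h2, Module.supportDim_quotient_eq_ringKrullDim] at h1
  exact withBot_le_of_add_one_le (h1.trans hn)

lemma exists_pow_le_of_ringKrullDim_quotient_le_zero {I : Ideal Q}
    (h : ringKrullDim (Q ⧸ I) ≤ 0) : ∃ n : ℕ, maximalIdeal Q ^ n ≤ I := by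
  rcases eq_or_ne I ⊤ with rfl | hI
  · exact ⟨0, le_top⟩
  have : Nontrivial (Q ⧸ I) := Ideal.Quotient.nontrivial_iff.2 hI
  have : IsLocalRing (Q ⧸ I) := IsLocalRing.of_surjective' (Ideal.Quotient.mk _) Ideal.Quotient.mk_surjective
  have : Ring.KrullDimLE 0 (Q ⧸ I) := by
    rw [Ring.krullDimLE_iff]; exact h
  have : IsArtinianRing (Q ⧸ I) := isArtinianRing_iff_isNoetherianRing_krullDimLE_zero.2 ⟨inferInstance, inferInstance⟩
  obtain ⟨n, hn⟩ := (isArtinianRing_iff_isNilpotent_maximalIdeal (Q ⧸ I)).1 this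
  refine ⟨n, ?_⟩
  rw [← IsLocalRing.map_maximalIdeal_of_surjective (Ideal.Quotient.mk I) Ideal.Quotient.mk_surjective,
    ← Ideal.map_pow, Ideal.zero_eq_bot, Ideal.map_eq_bot_iff_le_ker, Ideal.mk_ker] at hn
  exact hn

lemma ringKrullDim_quotient_le_zero_of_maximalIdeal_mem_minimalPrimes {I : Ideal Q}
    (h : maximalIdeal Q ∈ I.minimalPrimes) : ringKrullDim (Q ⧸ I) ≤ 0 := by
  suffices Ring.KrullDimLE 0 (Q ⧸ I) by
    exact (Ring.krullDimLE_iff.1 this)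
  have hI : Nontrivial (Q ⧸ I) := Ideal.Quotient.nontrivial_iff.2 fun h' =>
    (Ideal.IsPrime.ne_top' : maximalIdeal Q ≠ ⊤) (top_le_iff.1 (h' ▸ h.1.2))
  refine Ring.KrullDimLE.mk₀ fun P hP => ?_
  have h1 : P.comap (Ideal.Quotient.mk I) = maximalIdeal Q := by
    have hPc : (P.comap (Ideal.Quotient.mk I)).IsPrime := hP.comap _
    refine le_antisymm (IsLocalRing.le_maximalIdeal hPc.ne_top) (h.2 ⟨hPc, ?_⟩ (IsLocalRing.le_maximalIdeal hPc.ne_top))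
    intro a ha
    rw [Ideal.mem_comap, Ideal.Quotient.eq_zero_iff_mem.2 ha]
    exact zero_mem _
  have : IsLocalRing (Q ⧸ I) := IsLocalRing.of_surjective' (Ideal.Quotient.mk _) Ideal.Quotient.mk_surjective
  have h2 : P = maximalIdeal _ := by
    rw [← IsLocalRing.map_maximalIdeal_of_surjective (Ideal.Quotient.mk I) Ideal.Quotient.mk_surjective, ← h1,
      Ideal.map_comap_of_surjective _ Ideal.Quotient.mk_surjective]
  rw [h2]; infer_instance

lemma IsRegularOfDim.exists_notMem {d : ℕ} (h : IsRegularOfDim Q (d + 1)) (J : Ideal Q)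
    (hJ : ¬ maximalIdeal Q ≤ J) (s : Set (Ideal Q)) (hs : s.Finite)
    (hsP : ∀ P ∈ s, P.IsPrime ∧ P ≠ maximalIdeal Q) :
    ∃ u ∈ maximalIdeal Q, u ∉ J ∧ ∀ P ∈ s, u ∉ P := by
  classical
  by_contra! H
  have := (Ideal.subset_union_prime (s := insert J hs.toFinset) (f := id) (I := maximalIdeal Q) J J
    (by
      intro i hi hiJ _
      rw [Finset.mem_insert, Set.Finite.mem_toFinset] at hi
      exact (hsP i (hi.resolve_left hiJ)).1)).1 (by
    intro u hu
    simp only [id, Set.mem_iUnion]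
    by_cases hJ' : u ∈ J
    · exact ⟨J, by simp, hJ'⟩
    · obtain ⟨P, hP, huP⟩ := H u hu hJ'
      exact ⟨P, by simp [hP], huP⟩)
  obtain ⟨P, hP, hle⟩ := this
  rw [Finset.mem_insert, Set.Finite.mem_toFinset] at hP
  rcases hP with rfl | hP
  · exact hJ hle
  · exact (hsP P hP).2 (le_antisymm (IsLocalRing.le_maximalIdeal (hsP P hP).1.ne_top) hle)

lemma not_maximalIdeal_le_of_mem_minimalPrimes_span_singleton {d : ℕ}
    (h : IsRegularOfDim Q (d + 1)) {f : Q} {P : Ideal Q} (hd : f = 0 ∨ 0 < d)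
    (hP : P ∈ (Ideal.span {f}).minimalPrimes) : P ≠ maximalIdeal Q := by
  rintro rfl
  have h1 : ringKrullDim (Q ⧸ Ideal.span {f}) ≤ 0 :=
    ringKrullDim_quotient_le_zero_of_maximalIdeal_mem_minimalPrimes hP
  have hf : f ∈ maximalIdeal Q := hP.1.2 (Ideal.mem_span_singleton_self f)
  rcases hd with rfl | hd
  · rw [Ideal.span_singleton_eq_bot.2 rfl, ringKrullDim_eq_of_ringEquiv (RingEquiv.quotientBot Q), h.1] at h1
    have : d + 1 ≤ 0 := by exact_mod_cast h1
    omega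
  · have := ringKrullDim_le_ringKrullDim_quotient_add_card ({f} : Finset Q) (by
      rw [IsLocalRing.ringJacobson_eq_maximalIdeal]; simpa using hf)
    rw [h.1] at this
    rw [Finset.coe_singleton, Finset.card_singleton] at this
    have h3 := this.trans (add_le_add h1 le_rfl)
    have : d + 1 ≤ 1 := by exact_mod_cast h3
    omega

lemma IsRegularOfDim.not_maximalIdeal_le_sq {d : ℕ} (h : IsRegularOfDim Q (d + 1)) (x : Q)
    (hx : x ∈ maximalIdeal Q) (hd : x = 0 ∨ 0 < d) :
    ¬ maximalIdeal Q ≤ maximalIdeal Q ^ 2 ⊔ Ideal.span {x} := by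
  intro H
  have h1 : maximalIdeal Q ≤ Ideal.span {x} := by
    refine Submodule.le_of_le_smul_of_le_jacobson_bot (I := maximalIdeal Q) (IsNoetherian.noetherian _) ?_ ?_
    · rw [IsLocalRing.jacobson_eq_maximalIdeal _ bot_ne_top]
    · rw [smul_eq_mul, ← pow_two, sup_comm]; exact H
  refine not_maximalIdeal_le_of_mem_minimalPrimes_span_singleton h (f := x) (P := maximalIdeal Q) hd ?_ rfl
  refine ⟨⟨inferInstance, (Ideal.span_singleton_le_iff_mem _).2 hx⟩, fun P hP _ => h1.trans hP.2⟩

end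

lemma IsRegularOfDim.isDomain (n : ℕ) : ∀ {Q : Type u} [CommRing Q] [IsLocalRing Q] [IsNoetherianRing Q],
    IsRegularOfDim Q n → IsDomain Q := by
  induction n with
  | zero =>
    intro Q _ _ _ h
    obtain ⟨-, s, hs, hm⟩ := h
    obtain rfl := Finset.card_eq_zero.1 (Nat.le_zero.1 hs)
    rw [Finset.coe_empty, Ideal.span_empty] at hm
    exact (IsLocalRing.isField_iff_maximalIdeal_eq.2 hm.symm).isDomain
  | succ n ih =>
    intro Q _ _ _ h
    obtain ⟨u, hu, hu2, hup⟩ := h.exists_notMem (maximalIdeal Q ^ 2 ⊔ Ideal.span {0})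
      (h.not_maximalIdeal_le_sq 0 (zero_mem _) (Or.inl rfl)) _
      (Ideal.finite_minimalPrimes_of_isNoetherianRing Q (Ideal.span {0}))
      fun P hP => ⟨hP.1.1, not_maximalIdeal_le_of_mem_minimalPrimes_span_singleton h (Or.inl rfl) hP⟩
    have := isLocalRing_quotient_span_singleton hu
    have hdom : IsDomain (Q ⧸ Ideal.span {u}) := ih (h.quotient hu fun h' => hu2 (le_sup_left (a := maximalIdeal Q ^ 2) h'))
    have hpr : (Ideal.span {u}).IsPrime := (Ideal.Quotient.isDomain_iff_prime _).1 hdom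
    obtain ⟨P, hP, hPu⟩ := Ideal.exists_minimalPrimes_le
      (show Ideal.span {(0 : Q)} ≤ Ideal.span {u} from (Ideal.span_singleton_le_iff_mem _).2 (zero_mem _))
    have hPp := hP.1.1
    have hP0 := eq_bot_of_isPrime_le_span_singleton hu (hup P hP) hPu
    rw [hP0] at hPp
    exact (RingEquiv.quotientBot Q).symm.toMulEquiv.isDomain_iff.2 ((Ideal.Quotient.isDomain_iff_prime _).2 hPp)

lemma comap_map_mk_span_singleton {Q : Type*} [CommRing Q] (u : Q) (I : Ideal Q) :
    (I.map (Ideal.Quotient.mk (Ideal.span {u}))).comap (Ideal.Quotient.mk (Ideal.span {u})) =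
      I ⊔ Ideal.span {u} := by
  rw [Ideal.comap_map_of_surjective _ Ideal.Quotient.mk_surjective, ← RingHom.ker_eq_comap_bot, Ideal.mk_ker]

lemma exists_list_map_eq {A B : Type*} {f : A → B} (hf : Function.Surjective f) (l : List B) :
    ∃ l' : List A, l'.map f = l := by
  induction l with
  | nil => exact ⟨[], rfl⟩
  | cons b l ih =>
    obtain ⟨l', rfl⟩ := ih
    obtain ⟨a, rfl⟩ := hf b
    exact ⟨a :: l', rfl⟩

lemma IsRegularOfDim.exists_parameter {d : ℕ} {Q : Type u} [CommRing Q] [IsLocalRing Q]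
    [IsNoetherianRing Q] (h : IsRegularOfDim Q (d + 2)) {x f : Q} (hx : x ∈ maximalIdeal Q)
    (hx2 : x ∉ maximalIdeal Q ^ 2) (hf0 : f ≠ 0) (I : Ideal Q)
    {r : ℕ} (hI : ringKrullDim (Q ⧸ I) ≤ (r + 1 : ℕ)) :
    ∃ u ∈ maximalIdeal Q, u ∉ maximalIdeal Q ^ 2 ∧ x ∉ maximalIdeal Q ^ 2 ⊔ Ideal.span {u} ∧
      f ∉ Ideal.span {u} ∧ ringKrullDim (Q ⧸ (I ⊔ Ideal.span {u})) ≤ r := by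
  obtain ⟨u, hu, huJ, hus⟩ := h.exists_notMem _ (h.not_maximalIdeal_le_sq x hx (Or.inr (by omega)))
    ((Ideal.span {f}).minimalPrimes ∪ (I.minimalPrimes \ {maximalIdeal Q}))
    ((Ideal.finite_minimalPrimes_of_isNoetherianRing Q _).union
      ((Ideal.finite_minimalPrimes_of_isNoetherianRing Q _).subset Set.sdiff_subset)) (by
      rintro P (hP | hP)
      · exact ⟨hP.1.1, not_maximalIdeal_le_of_mem_minimalPrimes_span_singleton h (Or.inr (by omega)) hP⟩
      · exact ⟨hP.1.1.1, hP.2⟩)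
  have hu2 : u ∉ maximalIdeal Q ^ 2 := fun h' => huJ (le_sup_left (a := maximalIdeal Q ^ 2) h')
  refine ⟨u, hu, hu2, ?_, ?_, ?_⟩
  · intro hxu
    obtain ⟨y, hy, z, hz, hyz⟩ := Submodule.mem_sup.1 hxu
    obtain ⟨a, rfl⟩ := Ideal.mem_span_singleton'.1 hz
    by_cases ha : IsUnit a
    · obtain ⟨b, hb⟩ := ha.exists_left_inv
      refine huJ (Submodule.mem_sup.2 ⟨-(b * y), neg_mem (Ideal.mul_mem_left _ _ hy), b * x,
        Ideal.mul_mem_left _ _ (Ideal.mem_span_singleton_self x), ?_⟩)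
      linear_combination (-b) * hyz + u * hb
    · refine hx2 (hyz ▸ add_mem hy ?_)
      rw [pow_two]
      exact Ideal.mul_mem_mul ((mem_maximalIdeal _).2 ha) hu
  · intro hfu
    have := isLocalRing_quotient_span_singleton hu
    have hpr : (Ideal.span {u}).IsPrime :=
      (Ideal.Quotient.isDomain_iff_prime _).1 ((h.quotient hu hu2).isDomain)
    obtain ⟨P, hP, hPu⟩ := Ideal.exists_minimalPrimes_le ((Ideal.span_singleton_le_iff_mem _).2 hfu)
    have hPp := hP.1.1
    have := eq_bot_of_isPrime_le_span_singleton hu (hus P (Or.inl hP)) hPu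
    exact hf0 (by simpa [this] using hP.1.2 (Ideal.mem_span_singleton_self f))
  · by_cases hm : maximalIdeal Q ∈ I.minimalPrimes
    · have h0 := ringKrullDim_quotient_le_zero_of_maximalIdeal_mem_minimalPrimes hm
      refine (ringKrullDim_le_of_surjective (Ideal.Quotient.factor (le_sup_left : I ≤ I ⊔ Ideal.span {u}))
        (Ideal.Quotient.factor_surjective _)).trans (h0.trans (by exact_mod_cast Nat.zero_le r))
    · exact ringKrullDim_quotient_sup_le (fun p hp => hus p (Or.inr ⟨hp, fun h' => hm (h' ▸ hp)⟩)) hI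

lemma IsRegularOfDim.exists_parameters (d : ℕ) : ∀ {Q : Type u} [CommRing Q] [IsLocalRing Q]
    [IsNoetherianRing Q], IsRegularOfDim Q (d + 1) → ∀ {x f : Q}, x ∈ maximalIdeal Q →
    x ∉ maximalIdeal Q ^ 2 → f ∈ maximalIdeal Q → f ≠ 0 → ∀ (I : Ideal Q) (r : ℕ), r ≤ d →
    ringKrullDim (Q ⧸ I) ≤ r →
    ∃ us vs : List Q, us.length = r ∧ r + vs.length = d ∧
      maximalIdeal Q = Ideal.ofList vs ⊔ Ideal.ofList us ⊔ Ideal.span {x} ∧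
      WeaklyRegularMod (Ideal.span {f}) (us ++ vs) ∧
      (∃ n : ℕ, maximalIdeal Q ^ n ≤ I ⊔ Ideal.ofList us) ∧
      (Ideal.ofList us ⊔ Ideal.ofList vs).IsPrime ∧ x ∉ Ideal.ofList us ⊔ Ideal.ofList vs ∧
      ∃ N : ℕ, x ^ N ∈ Ideal.ofList us ⊔ Ideal.ofList vs ⊔ Ideal.span {f} := by
  induction d with
  | zero =>
    intro Q _ _ _ h x f hx hx2 hf hf0 I r hr hI
    obtain rfl := Nat.le_zero.1 hr
    have hdom := h.isDomain
    have hbot : (⊥ : Ideal Q).IsPrime := Ideal.isPrime_bot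
    have hx0 : x ≠ 0 := fun h0 => hx2 (h0 ▸ zero_mem _)
    have hloc := isLocalRing_quotient_span_singleton hx
    have hmax : maximalIdeal Q = Ideal.span {x} := by
      obtain ⟨-, s, hs, hm⟩ := h.quotient hx hx2
      obtain rfl := Finset.card_eq_zero.1 (Nat.le_zero.1 hs)
      rw [Finset.coe_empty, Ideal.span_empty, ← IsLocalRing.map_maximalIdeal_of_surjective (Ideal.Quotient.mk (Ideal.span {x})) Ideal.Quotient.mk_surjective, eq_comm, Ideal.map_eq_bot_iff_le_ker, Ideal.mk_ker] at hm
      exact le_antisymm hm ((Ideal.span_singleton_le_iff_mem _).2 hx)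
    have hf1 : ringKrullDim (Q ⧸ Ideal.span {f}) ≤ (0 : ℕ) := by
      have := ringKrullDim_quotient_sup_le (Q := Q) (I := ⊥) (u := f) (n := 0) (by
        intro p hp
        rw [show p = ⊥ from le_bot_iff.1 (hp.2 ⟨hbot, le_rfl⟩ bot_le)]
        exact hf0) (by rw [ringKrullDim_eq_of_ringEquiv (RingEquiv.quotientBot Q), h.1])
      rwa [bot_sup_eq] at this
    obtain ⟨n, hn⟩ := exists_pow_le_of_ringKrullDim_quotient_le_zero (by exact_mod_cast hI)
    obtain ⟨N, hN⟩ := exists_pow_le_of_ringKrullDim_quotient_le_zero (by exact_mod_cast hf1)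
    refine ⟨[], [], rfl, rfl, by simpa using hmax, trivial, ⟨n, by simpa using hn⟩, by simpa using hbot,
      by simpa using hx0, N, by simpa using hN (Ideal.pow_mem_pow hx N)⟩
  | succ d ih =>
    intro Q _ _ _ h x f hx hx2 hf hf0 I r hr hI
    obtain ⟨u, hu, hu2, hxu, hfu, hIu⟩ := h.exists_parameter (r := r - 1) hx hx2 hf0 I
      (hI.trans (by exact_mod_cast (by omega : r ≤ r - 1 + 1)))
    have hdom := h.isDomain
    have hloc := isLocalRing_quotient_span_singleton hu
    have hq := h.quotient hu hu2
    have hqd := hq.isDomain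
    have hpr : (Ideal.span {u}).IsPrime := (Ideal.Quotient.isDomain_iff_prime _).1 hqd
    set π := Ideal.Quotient.mk (Ideal.span {u}) with hπ
    have hπs : Function.Surjective π := Ideal.Quotient.mk_surjective
    have hmax : (maximalIdeal Q).map π = maximalIdeal _ := IsLocalRing.map_maximalIdeal_of_surjective _ hπs
    have hxb2 : π x ∉ maximalIdeal (Q ⧸ Ideal.span {u}) ^ 2 := by
      rwa [← hmax, ← Ideal.map_pow, ← Ideal.mem_comap, comap_map_mk_span_singleton]
    have hIb : ringKrullDim ((Q ⧸ Ideal.span {u}) ⧸ I.map π) ≤ (r - 1 : ℕ) := by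
      rw [sup_comm] at hIu
      rwa [ringKrullDim_eq_of_ringEquiv (DoubleQuot.quotQuotEquivQuotSup (Ideal.span {u}) I)]
    obtain ⟨us', vs', h1, h2, h3, h4, ⟨n, h5⟩, h6, h7, N, h8⟩ := ih hq (x := π x) (f := π f)
      (hmax ▸ Ideal.mem_map_of_mem _ hx) hxb2 (hmax ▸ Ideal.mem_map_of_mem _ hf)
      (fun h' => hfu (Ideal.Quotient.eq_zero_iff_mem.1 h')) (I.map π) (r - 1) (by omega) hIb
    obtain ⟨us, rfl⟩ := exists_list_map_eq hπs us'
    obtain ⟨vs, rfl⟩ := exists_list_map_eq hπs vs'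
    have key : ∀ J : Ideal Q, (J.map π).comap π = J ⊔ Ideal.span {u} := comap_map_mk_span_singleton u
    have h3' : maximalIdeal Q = Ideal.ofList vs ⊔ Ideal.ofList us ⊔ Ideal.span {x} ⊔ Ideal.span {u} := by
      rw [← key, Ideal.map_sup, Ideal.map_sup, Ideal.map_ofList, Ideal.map_ofList, Ideal.map_span,
        Set.image_singleton, ← h3, ← hmax, key, eq_comm, sup_eq_left]
      exact (Ideal.span_singleton_le_iff_mem _).2 hu
    have h4' : WeaklyRegularMod (Ideal.span {f}) (u :: (us ++ vs)) := by
      refine ⟨fun a ha => ?_, ?_⟩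
      · obtain ⟨b, hb⟩ := Ideal.mem_span_singleton'.1 ha
        have hbu : b ∈ Ideal.span {u} :=
          (hpr.mem_or_mem (hb ▸ Ideal.mul_mem_right a _ (Ideal.mem_span_singleton_self u) : b * f ∈ _)).resolve_right hfu
        obtain ⟨c, rfl⟩ := Ideal.mem_span_singleton'.1 hbu
        have hu0 : u ≠ 0 := fun h0 => hu2 (h0 ▸ zero_mem _)
        refine Ideal.mem_span_singleton'.2 ⟨c, mul_left_cancel₀ hu0 ?_⟩
        rw [← hb]; ring
      · have := WeaklyRegularMod.comap π hπs (Ideal.span {π f}) (us ++ vs) (by simpa using h4)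
        rwa [← Set.image_singleton, ← Ideal.map_span, key] at this
    have h5' : maximalIdeal Q ^ n ≤ I ⊔ Ideal.ofList us ⊔ Ideal.span {u} := by
      rw [← key, ← Ideal.map_le_iff_le_comap, Ideal.map_pow, hmax, Ideal.map_sup, Ideal.map_ofList]
      exact h5
    have h6' : (Ideal.ofList us ⊔ Ideal.ofList vs ⊔ Ideal.span {u}).IsPrime := by
      rw [← key, Ideal.map_sup, Ideal.map_ofList, Ideal.map_ofList]
      exact h6.comap _
    have h7' : x ∉ Ideal.ofList us ⊔ Ideal.ofList vs ⊔ Ideal.span {u} := by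
      rw [← key, Ideal.map_sup, Ideal.map_ofList, Ideal.map_ofList]
      exact h7
    have h8' : x ^ N ∈ Ideal.ofList us ⊔ Ideal.ofList vs ⊔ Ideal.span {f} ⊔ Ideal.span {u} := by
      rw [← key, Ideal.map_sup, Ideal.map_sup, Ideal.map_ofList, Ideal.map_ofList, Ideal.map_span,
        Set.image_singleton, Ideal.mem_comap, map_pow]
      exact h8
    rw [List.length_map] at h1 h2
    rcases Nat.eq_zero_or_pos r with rfl | hr0
    · obtain rfl := List.length_eq_zero_iff.1 h1
      obtain ⟨n', hn'⟩ := exists_pow_le_of_ringKrullDim_quotient_le_zero (by exact_mod_cast hI)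
      simp only [Ideal.ofList_nil, sup_bot_eq, bot_sup_eq] at h3' h6' h7' h8'
      refine ⟨[], u :: vs, rfl, by simp; omega, ?_, h4', ⟨n', by simpa using hn'⟩, ?_, ?_, N, ?_⟩ <;>
        simp only [Ideal.ofList_nil, sup_bot_eq, bot_sup_eq, Ideal.ofList_cons]
      · rw [h3']; ac_rfl
      · rwa [sup_comm]
      · rwa [sup_comm]
      · rwa [sup_comm (Ideal.span {u}), sup_right_comm]
    · refine ⟨u :: us, vs, by simp; omega, by omega, ?_, h4', ⟨n, ?_⟩, ?_, ?_, N, ?_⟩ <;>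
        simp only [Ideal.ofList_cons]
      · rw [h3']; ac_rfl
      · rw [sup_comm (Ideal.span {u}), ← sup_assoc]; exact h5'
      · rw [sup_comm (Ideal.span {u}), sup_right_comm]; exact h6'
      · rw [sup_comm (Ideal.span {u}), sup_right_comm]; exact h7'
      · rw [sup_comm (Ideal.span {u}), sup_right_comm (Ideal.ofList us), sup_right_comm]; exact h8'

section
variable {D : Type*} [CommRing D] [IsLocalRing D] [IsHausdorff (maximalIdeal D) D] {ϖ : D}

lemma exists_associated_pow_of_maximalIdeal_eq_span (hϖ : maximalIdeal D = Ideal.span {ϖ})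
    {a : D} (ha : a ≠ 0) : ∃ n : ℕ, Associated (ϖ ^ n) a := by
  classical
  have hex : ∃ n : ℕ, a ∉ maximalIdeal D ^ n := by
    by_contra! H
    exact ha (IsHausdorff.haus ‹_› a fun n => by
      rw [SModEq.zero, smul_eq_mul, Ideal.mul_top]; exact H n)
  obtain ⟨n, hn, hmin⟩ : ∃ n, a ∉ maximalIdeal D ^ n ∧ ∀ m < n, a ∈ maximalIdeal D ^ m :=
    ⟨Nat.find hex, Nat.find_spec hex, fun m hm => not_not.1 (Nat.find_min hex hm)⟩
  obtain ⟨m, rfl⟩ : ∃ m, n = m + 1 := Nat.exists_eq_succ_of_ne_zero (by rintro rfl; simp at hn)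
  have h1 := hmin m (Nat.lt_succ_self m)
  rw [hϖ, Ideal.span_singleton_pow, Ideal.mem_span_singleton'] at h1
  obtain ⟨c, hc⟩ := h1
  have hcu : IsUnit c := by
    by_contra hcu
    rw [← mem_nonunits_iff, ← mem_maximalIdeal] at hcu
    refine hn (hc ▸ ?_)
    rw [pow_succ']
    refine Ideal.mul_mem_mul hcu (Ideal.pow_mem_pow ?_ m)
    rw [hϖ]; exact Ideal.mem_span_singleton_self ϖ
  exact ⟨m, hcu.unit, by simpa [mul_comm] using hc⟩

lemma isDomain_of_maximalIdeal_eq_span (hϖ : maximalIdeal D = Ideal.span {ϖ})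
    (hϖ0 : ∀ n : ℕ, ϖ ^ n ≠ 0) : IsDomain D := by
  have : NoZeroDivisors D := ⟨fun {a b} hab => by
    by_contra! H
    obtain ⟨n, hn⟩ := exists_associated_pow_of_maximalIdeal_eq_span hϖ H.1
    obtain ⟨m, hm⟩ := exists_associated_pow_of_maximalIdeal_eq_span hϖ H.2
    have := hn.mul_mul hm
    rw [hab, ← pow_add, associated_zero_iff_eq_zero] at this
    exact hϖ0 _ this⟩
  exact NoZeroDivisors.to_isDomain D

lemma isPrincipalIdealRing_of_maximalIdeal_eq_span [IsDomain D]
    (hϖ : maximalIdeal D = Ideal.span {ϖ}) (hϖ0 : ϖ ≠ 0) : IsPrincipalIdealRing D := by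
  have hirr : Irreducible ϖ := by
    refine Prime.irreducible ((Ideal.span_singleton_prime hϖ0).1 ?_)
    rw [← hϖ]; infer_instance
  have := IsDiscreteValuationRing.ofHasUnitMulPowIrreducibleFactorization (R := D)
    ⟨ϖ, hirr, fun h => exists_associated_pow_of_maximalIdeal_eq_span hϖ h⟩
  infer_instance

end

section
variable {A : Type u} [CommRing A] [IsLocalRing A] [IsAdicComplete (maximalIdeal A) A]

lemma exists_coefficient_ring_of_ringChar_eq
    (hchar : ringChar A = ringChar (ResidueField A)) (y : A) (hy : y ∈ maximalIdeal A) :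
    ∃ (D : Type u) (_ : CommRing D) (_ : IsDomain D) (_ : IsPrincipalIdealRing D) (_ : IsLocalRing D)
      (_ : IsAdicComplete (maximalIdeal D) D) (ϖ : D) (φ : D →+* A),
      maximalIdeal D = Ideal.span {ϖ} ∧ ϖ ≠ 0 ∧ φ ϖ = y ∧ ∀ a, ∃ d, a - φ d ∈ maximalIdeal A := by
  obtain ⟨σ, hσ⟩ := exists_coefficient_field hchar
  obtain ⟨Φ, hΦC, hΦX⟩ := exists_mvPowerSeries_hom (maximalIdeal A) σ (fun _ : Fin 1 => y) (fun _ => hy)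
  have hm : maximalIdeal (MvPowerSeries (Fin 1) (ResidueField A)) = Ideal.span (Set.range MvPowerSeries.X) := by
    apply le_antisymm
    · intro f hf
      have h1 := mvPowerSeries_sub_C_constantCoeff_mem f
      have h2 : MvPowerSeries.constantCoeff f = 0 := by
        by_contra h
        exact hf (MvPowerSeries.isUnit_iff_constantCoeff.2 (isUnit_iff_ne_zero.2 h))
      simpa [h2] using h1
    · rw [Ideal.span_le]
      rintro _ ⟨i, rfl⟩
      rw [SetLike.mem_coe, mem_maximalIdeal, mem_nonunits_iff, MvPowerSeries.isUnit_iff_constantCoeff]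
      simp
  have hm' : maximalIdeal (MvPowerSeries (Fin 1) (ResidueField A)) = Ideal.span {MvPowerSeries.X 0} := by
    rw [hm, Set.range_unique]; rfl
  have hX : (MvPowerSeries.X 0 : MvPowerSeries (Fin 1) (ResidueField A)) ≠ 0 := by
    intro h
    have := congrArg (MvPowerSeries.coeff (Finsupp.single (0 : Fin 1) 1)) h
    simp at this
  have hdom : IsDomain (MvPowerSeries (Fin 1) (ResidueField A)) := NoZeroDivisors.to_isDomain _
  have hc : IsAdicComplete (maximalIdeal (MvPowerSeries (Fin 1) (ResidueField A)))
      (MvPowerSeries (Fin 1) (ResidueField A)) := by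
    rw [hm]; infer_instance
  refine ⟨MvPowerSeries (Fin 1) (ResidueField A), inferInstance, hdom,
    isPrincipalIdealRing_of_maximalIdeal_eq_span hm' hX, inferInstance, hc, MvPowerSeries.X 0, Φ, hm', hX,
    hΦX 0, fun a => ⟨MvPowerSeries.C (residue A a), ?_⟩⟩
  rw [← residue_eq_zero_iff, map_sub, hΦC, hσ, sub_self]

lemma exists_coefficient_ring_of_domain {V : Type u} [CommRing V] [IsDomain V] [IsLocalRing V]
    [IsNoetherianRing V] {p : ℕ} (hp : p.Prime) (hV : maximalIdeal V = Ideal.span {(p : V)})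
    (hV0 : (p : V) ≠ 0) (hpA : (p : A) ∈ maximalIdeal A)
    (ψ : ResidueField V →+* ResidueField A) (hψ : Function.Surjective ψ) :
    ∃ (D : Type u) (_ : CommRing D) (_ : IsDomain D) (_ : IsPrincipalIdealRing D) (_ : IsLocalRing D)
      (_ : IsAdicComplete (maximalIdeal D) D) (ϖ : D) (φ : D →+* A),
      maximalIdeal D = Ideal.span {ϖ} ∧ ϖ ≠ 0 ∧ φ ϖ = p ∧ ∀ a, ∃ d, a - φ d ∈ maximalIdeal A := by
  have hmD : maximalIdeal (AdicCompletion (maximalIdeal V) V) =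
      Ideal.span {((p : ℕ) : AdicCompletion (maximalIdeal V) V)} := by
    rw [AdicCompletion.maximalIdeal_eq_map, hV, Ideal.map_span, Set.image_singleton, map_natCast]
  have hinj : Function.Injective (algebraMap V (AdicCompletion (maximalIdeal V) V)) := by
    have : IsHausdorff (maximalIdeal V) V := IsHausdorff.of_isLocalRing _ _ Ideal.IsPrime.ne_top'
    exact AdicCompletion.of_injective (maximalIdeal V) V
  have hpow : ∀ n : ℕ, ((p : ℕ) : AdicCompletion (maximalIdeal V) V) ^ n ≠ 0 := fun n h => by
    rw [← map_natCast (algebraMap V (AdicCompletion (maximalIdeal V) V)), ← map_pow,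
      map_eq_zero_iff _ hinj] at h
    exact pow_ne_zero n hV0 h
  have hdom := isDomain_of_maximalIdeal_eq_span hmD hpow
  have h0 : ((p : ℕ) : AdicCompletion (maximalIdeal V) V) ≠ 0 := by simpa using hpow 1
  let e := RingEquiv.ofBijective _ (AdicCompletion.residueField_map_bijective (R := V))
  obtain ⟨φ, hφ⟩ := exists_lift_residueField hp (V := AdicCompletion (maximalIdeal V) V)
    (fun v hv => (mul_eq_zero.1 hv).resolve_left h0) hmD hpA
    ((ψ.comp e.symm.toRingHom).comp (residue _))
  refine ⟨AdicCompletion (maximalIdeal V) V, inferInstance, hdom,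
    isPrincipalIdealRing_of_maximalIdeal_eq_span hmD h0, inferInstance, inferInstance, p, φ, hmD, h0,
    map_natCast φ p, fun a => ?_⟩
  obtain ⟨w, hw⟩ := hψ (residue A a)
  obtain ⟨d, hd⟩ := residue_surjective (e w)
  refine ⟨d, ?_⟩
  rw [← residue_eq_zero_iff, map_sub, hφ, sub_eq_zero, ← hw]
  simp [hd]

end

lemma WeaklyRegularMod.map {S A : Type*} [CommRing S] [CommRing A] (φ : S →+* A)
    (hφ : Function.Surjective φ) (I : Ideal S) (hI : RingHom.ker φ ≤ I) (ys : List S)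
    (h : WeaklyRegularMod I ys) : WeaklyRegularMod (I.map φ) (ys.map φ) := by
  induction ys generalizing I with
  | nil => trivial
  | cons y ys ih =>
    have hmem : ∀ a, φ a ∈ I.map φ → a ∈ I := fun a ha => by
      have h1 : a ∈ (I.map φ).comap φ := ha
      rwa [Ideal.comap_map_of_surjective φ hφ, ← RingHom.ker_eq_comap_bot, sup_eq_left.2 hI] at h1
    refine ⟨fun a ha => ?_, ?_⟩
    · obtain ⟨a, rfl⟩ := hφ a
      exact Ideal.mem_map_of_mem _ (h.1 a (hmem _ (by rwa [map_mul])))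
    · have := ih _ (hI.trans le_sup_left) h.2
      rwa [Ideal.map_sup, Ideal.map_span, Set.image_singleton] at this

lemma residueField_map_surjective {R S : Type*} [CommRing R] [IsLocalRing R] [CommRing S]
    [IsLocalRing S] (φ : R →+* S) [IsLocalHom φ] (hφ : Function.Surjective φ) :
    Function.Surjective (ResidueField.map φ) := fun y => by
  obtain ⟨a, rfl⟩ := residue_surjective y
  obtain ⟨b, rfl⟩ := hφ a
  exact ⟨residue R b, ResidueField.map_residue φ b⟩

section
variable {Q A : Type u} [CommRing Q] [IsLocalRing Q] [IsNoetherianRing Q]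
  [CommRing A] [IsLocalRing A] [IsNoetherianRing A] [IsAdicComplete (maximalIdeal A) A]

lemma IsRegularOfDim.exists_coefficient_ring {d : ℕ} (hQ : IsRegularOfDim Q (d + 1)) (π : Q →+* A)
    (hπ : Function.Surjective π)
    (hchar : ringChar A = ringChar (ResidueField A) ∨
      ((ringChar (ResidueField A) : A) ∉ maximalIdeal A ^ 2)) :
    ∃ x ∈ maximalIdeal Q, x ∉ maximalIdeal Q ^ 2 ∧ ∀ L : Ideal Q, L.IsPrime → x ∉ L →
      maximalIdeal Q = L ⊔ Ideal.span {x} →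
      ∃ (D : Type u) (_ : CommRing D) (_ : IsDomain D) (_ : IsPrincipalIdealRing D) (_ : IsLocalRing D)
        (_ : IsAdicComplete (maximalIdeal D) D) (ϖ : D) (φ : D →+* A),
        maximalIdeal D = Ideal.span {ϖ} ∧ ϖ ≠ 0 ∧ φ ϖ = π x ∧ ∀ a, ∃ d, a - φ d ∈ maximalIdeal A := by
  have hmax : (maximalIdeal Q).map π = maximalIdeal A :=
    IsLocalRing.map_maximalIdeal_of_surjective _ hπ
  rcases hchar with hchar | hchar
  · obtain ⟨x, hx, hx2⟩ := Set.not_subset.1 (hQ.not_maximalIdeal_le_sq 0 (zero_mem _) (Or.inl rfl))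
    refine ⟨x, hx, fun h => hx2 (le_sup_left (a := maximalIdeal Q ^ 2) h), fun L _ _ _ => ?_⟩
    exact exists_coefficient_ring_of_ringChar_eq hchar (π x) (hmax ▸ Ideal.mem_map_of_mem _ hx)
  · set p := ringChar (ResidueField A) with hpdef
    have hp : p.Prime := (CharP.char_is_prime_or_zero (ResidueField A) p).resolve_right fun h0 =>
      hchar (by rw [h0, Nat.cast_zero]; exact zero_mem _)
    have hpA : (p : A) ∈ maximalIdeal A := by
      rw [← residue_eq_zero_iff, map_natCast]; exact CharP.cast_eq_zero _ _
    have hloc : IsLocalHom π := IsLocalHom.of_surjective π hπ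
    have hpQ : (p : Q) ∈ maximalIdeal Q := by
      rw [← IsLocalRing.maximalIdeal_comap π, Ideal.mem_comap, map_natCast]; exact hpA
    refine ⟨p, hpQ, fun h => hchar ?_, fun L hL hxL hmL => ?_⟩
    · rw [← hmax, ← Ideal.map_pow, ← map_natCast π]
      exact Ideal.mem_map_of_mem _ h
    · have hVs : Function.Surjective (Ideal.Quotient.mk L) := Ideal.Quotient.mk_surjective
      have hVloc : IsLocalRing (Q ⧸ L) := IsLocalRing.of_surjective' _ hVs
      have hloc' : IsLocalHom (Ideal.Quotient.mk L) := IsLocalHom.of_surjective _ hVs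
      have hV : maximalIdeal (Q ⧸ L) = Ideal.span {(p : Q ⧸ L)} := by
        rw [← IsLocalRing.map_maximalIdeal_of_surjective _ hVs, hmL, Ideal.map_sup, Ideal.map_quotient_self,
          bot_sup_eq, Ideal.map_span, Set.image_singleton, map_natCast]
      have hV0 : (p : Q ⧸ L) ≠ 0 := by
        rw [← map_natCast (Ideal.Quotient.mk L)]
        exact fun h => hxL (Ideal.Quotient.eq_zero_iff_mem.1 h)
      let e := RingEquiv.ofBijective (ResidueField.map (Ideal.Quotient.mk L))
        ⟨RingHom.injective _, residueField_map_surjective _ hVs⟩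
      obtain h := exists_coefficient_ring_of_domain hp hV hV0 hpA
        ((ResidueField.map π).comp e.symm.toRingHom)
        ((residueField_map_surjective _ hπ).comp e.symm.surjective)
      rwa [← map_natCast π] at h

/-- The nonvanishing of `Ext^i_A(M, M)` over a complete unramified hypersurface `A = Q ⧸ (f)`, for
`1 ≤ i ≤ dim A - dim M`. -/
theorem IsRegularOfDim.extMod_self_nonzero {d : ℕ} (hQ : IsRegularOfDim Q (d + 1)) (π : Q →+* A)
    (hπ : Function.Surjective π) {f : Q} (hker : RingHom.ker π = Ideal.span {f}) (hf0 : f ≠ 0)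
    (hchar : ringChar A = ringChar (ResidueField A) ∨
      ((ringChar (ResidueField A) : A) ∉ maximalIdeal A ^ 2))
    (M : Type u) [AddCommGroup M] [Module A M] [Module.Finite A M] [Nontrivial M] (r : ℕ)
    (hr : ringKrullDim (A ⧸ Module.annihilator A M) = r) (i : ℕ) (hi : i + r + 1 ≤ d) :
    ¬ Subsingleton (extMod A (i + 1) M M) := by
  obtain ⟨x, hx, hx2, hD⟩ := hQ.exists_coefficient_ring π hπ hchar
  have hmax : (maximalIdeal Q).map π = maximalIdeal A :=
    IsLocalRing.map_maximalIdeal_of_surjective _ hπ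
  have hf : f ∈ maximalIdeal Q := by
    refine (IsLocalRing.le_maximalIdeal (RingHom.ker_ne_top π)) ?_
    rw [hker]; exact Ideal.mem_span_singleton_self f
  have hfA : (Ideal.span {f}).map π = ⊥ := (Ideal.map_eq_bot_iff_le_ker π).2 hker.ge
  -- the key step, for a choice of an ideal `J`
  have main : ∀ (J : Ideal A) (t e : ℕ), t ≤ d → ringKrullDim (A ⧸ J) ≤ t →
      J ≤ Module.annihilator A M ⊔ Ideal.span {π x} →
      ((e = 0 ∧ (t : WithBot ℕ∞) < ringKrullDim (A ⧸ Module.annihilator A M)) ∨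
        (e = 1 ∧ ringKrullDim (A ⧸ Module.annihilator A M) ≤ t ∧
          (t : WithBot ℕ∞) ≤ ringKrullDim (A ⧸ (Module.annihilator A M ⊔ Ideal.span {π x})))) →
      i + 2 + t ≤ e + d → t + 1 ≤ d → ¬ Subsingleton (extMod A (i + 1) M M) := by
    intro J t e htd hJ hJx he hie ht1
    have hJQ : ringKrullDim (Q ⧸ J.comap π) ≤ t := by
      refine le_trans ?_ hJ
      exact (ringKrullDim_eq_of_ringEquiv (RingEquiv.ofBijective (Ideal.quotientMap J π le_rfl)
        ⟨Ideal.quotientMap_injective, Ideal.quotientMap_surjective hπ⟩)).le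
    obtain ⟨us, vs, h1, h2, h3, h4, ⟨n, h5⟩, h6, h7, N, h8⟩ :=
      IsRegularOfDim.exists_parameters d hQ hx hx2 hf hf0 (J.comap π) t htd hJQ
    obtain ⟨D, _, _, _, _, _, ϖ, φ, hϖ, hϖ0, hφx, hφ⟩ := hD _ h6 h7
      (by rw [h3, sup_comm (Ideal.ofList vs)])
    obtain ⟨s, hs⟩ : ∃ s, (vs.map π).length = s + 1 := ⟨vs.length - 1, by rw [List.length_map]; omega⟩
    have hur : (us.map π).length = t := by rw [List.length_map, h1]
    obtain ⟨ua, hua⟩ : ∃ ua : Fin t → A, List.ofFn ua = us.map π := by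
      rw [← hur]; exact ⟨_, List.ofFn_get _⟩
    obtain ⟨va, hva⟩ : ∃ va : Fin (s + 1) → A, List.ofFn va = vs.map π := by
      rw [← hs]; exact ⟨_, List.ofFn_get _⟩
    have hus : (Ideal.ofList us).map π = Ideal.span (Set.range ua) := by
      rw [Ideal.map_ofList, ← hua, ofList_ofFn]
    have hvs : (Ideal.ofList vs).map π = Ideal.span (Set.range va) := by
      rw [Ideal.map_ofList, ← hva, ofList_ofFn]
    have hmaxA : maximalIdeal A =
        Ideal.span (Set.range va) ⊔ Ideal.span (Set.range ua) ⊔ Ideal.span {φ ϖ} := by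
      rw [← hmax, h3, Ideal.map_sup, Ideal.map_sup, hus, hvs, Ideal.map_span, Set.image_singleton, hφx]
    refine extMod_self_nonzero_of_parameters ϖ hϖ hϖ0 φ hφ ua va hmaxA ?_ ⟨N, ?_⟩ M n ?_ e ?_ i ?_
    · rw [hua, hva, ← List.map_append, ← hfA]
      exact h4.map π hπ _ hker.le
    · have := Ideal.mem_map_of_mem π h8
      rwa [Ideal.map_sup, Ideal.map_sup, hus, hvs, hfA, sup_bot_eq, map_pow, ← hφx] at this
    · have := Ideal.map_mono (f := π) h5
      rw [Ideal.map_pow, hmax, Ideal.map_sup, Ideal.map_comap_of_surjective π hπ, hus] at this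
      rw [hφx, sup_right_comm]
      exact this.trans (sup_le_sup_right hJx _)
    · rw [hφx]; exact he
    · rw [List.length_map] at hs; omega
  have hne : Module.annihilator A M ⊔ Ideal.span {π x} ≠ ⊤ := by
    refine ne_top_of_le_ne_top (Ideal.IsPrime.ne_top' : maximalIdeal A ≠ ⊤) (sup_le ?_ ?_)
    · refine IsLocalRing.le_maximalIdeal fun h => ?_
      rw [Module.annihilator_eq_top_iff] at h
      exact not_subsingleton M h
    · rw [Ideal.span_singleton_le_iff_mem, ← hmax]
      exact Ideal.mem_map_of_mem _ hx
  have : Nontrivial (A ⧸ (Module.annihilator A M ⊔ Ideal.span {π x})) := Ideal.Quotient.nontrivial_iff.2 hne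
  have hle : ringKrullDim (A ⧸ (Module.annihilator A M ⊔ Ideal.span {π x})) ≤ r :=
    hr ▸ ringKrullDim_le_of_surjective (Ideal.Quotient.factor le_sup_left) (Ideal.Quotient.factor_surjective _)
  obtain ⟨t, ht⟩ : ∃ t : ℕ, ringKrullDim (A ⧸ (Module.annihilator A M ⊔ Ideal.span {π x})) = t := by
    have h0 := ringKrullDim_nonneg_of_nontrivial (R := A ⧸ (Module.annihilator A M ⊔ Ideal.span {π x}))
    generalize ringKrullDim (A ⧸ (Module.annihilator A M ⊔ Ideal.span {π x})) = z at *
    induction z with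
    | bot => simp at h0
    | coe z =>
      induction z with
      | top => exact absurd (by exact_mod_cast hle : (⊤ : ℕ∞) ≤ r) (by simp)
      | coe z => exact ⟨z, rfl⟩
  have htr : t ≤ r := by rw [ht] at hle; exact_mod_cast hle
  rcases htr.lt_or_eq with htr | rfl
  · exact main _ t 0 (by omega) ht.le le_rfl (Or.inl ⟨rfl, by rw [hr]; exact_mod_cast htr⟩)
      (by omega) (by omega)
  · exact main _ t 1 (by omega) hr.le le_sup_left (Or.inr ⟨rfl, hr.le, ht.ge⟩) (by omega) (by omega)

end

/-- Vanishing of `extMod` implies vanishing of the derived-category Ext. -/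
lemma subsingleton_abelianExt_of_subsingleton_extMod {R : Type u} [CommRing R] [IsNoetherianRing R]
    {M N : Type u} [AddCommGroup M] [Module R M] [Module.Finite R M] [AddCommGroup N] [Module R N]
    (n : ℕ) (h : Subsingleton (extMod R n M N)) :
    Subsingleton (Abelian.Ext (ModuleCat.of R M) (ModuleCat.of R N) n) := by
  cases n with
  | zero =>
    obtain ⟨e⟩ := extMod_zero_equiv_hom (R := R) (M := M) N
    have : Subsingleton (M →ₗ[R] N) := e.symm.toEquiv.subsingleton
    have : Subsingleton (ModuleCat.of R M ⟶ ModuleCat.of R N) :=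
      ModuleCat.homAddEquiv.subsingleton
    exact Abelian.Ext.addEquiv₀.toEquiv.subsingleton
  | succ n =>
    let PR := projectiveResolution (ModuleCat.of R M)
    let K := PR.complex.linearYonedaObj R (ModuleCat.of R N)
    have e1 : extMod R (n+1) M N ≅ K.homology (n+1) := PR.isoExt (n+1) (ModuleCat.of R N)
    have e2 : K.homology (n+1) ≅ (K.sc' n (n+1) (n+2)).homology :=
      ShortComplex.homologyMapIso (K.isoSc' n (n+1) (n+2) (by simp) (by simp))
    obtain ⟨e3⟩ := homology_equiv_midHom (K.sc' n (n+1) (n+2))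
    have hs := ((e1 ≪≫ e2).toLinearEquiv.trans e3).symm.toEquiv.subsingleton
    rw [MidHom.subsingleton_iff] at hs
    refine ⟨fun a b => ?_⟩
    suffices H : ∀ a : Abelian.Ext (ModuleCat.of R M) (ModuleCat.of R N) (n + 1), a = 0 by
      rw [H a, H b]
    intro a
    obtain ⟨f, hf, rfl⟩ := PR.extMk_surjective a (n + 2) rfl
    rw [PR.extMk_eq_zero_iff f (n + 2) rfl hf n rfl]
    obtain ⟨g, hg⟩ := hs f hf
    exact ⟨g, hg⟩

/-- A finite module of grade `n` is annihilated by a regular sequence of length `n`. -/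
lemma exists_isRegular_of_moduleGrade {R : Type u} [CommRing R] [IsLocalRing R]
    [IsNoetherianRing R] (M : Type u) [AddCommGroup M] [Module R M] [Module.Finite R M]
    [Nontrivial M] :
    ∃ rs : List R, rs.length = moduleGrade R M ∧ (∀ r ∈ rs, r ∈ Module.annihilator R M) ∧
      RingTheory.Sequence.IsRegular R rs := by
  have hann : Module.annihilator R M ≠ ⊤ := by
    intro h
    exact not_subsingleton M (Module.annihilator_eq_top_iff.1 h)
  refine ModuleCat.exists_isRegular_of_exists_subsingleton_ext (Module.annihilator R M)
    (moduleGrade R M) (ModuleCat.of R R) ?_ (ModuleCat.of R M) Module.support_eq_zeroLocus ?_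
  · change Module.annihilator R M • (⊤ : Submodule R R) < ⊤
    rw [smul_eq_mul, Ideal.mul_top]
    exact lt_top_iff_ne_top.2 hann
  · intro i hi
    refine subsingleton_abelianExt_of_subsingleton_extMod i ?_
    by_contra h
    exact Nat.notMem_of_lt_sInf hi h

lemma ringChar_eq_of_injective {R S : Type*} [NonAssocSemiring R] [NonAssocSemiring S]
    (f : R →+* S) (hf : Function.Injective f) : ringChar R = ringChar S :=
  ringChar.eq_iff.2 (f.charP hf (ringChar S))

section Flat
variable {R A : Type u} [CommRing R] [IsLocalRing R] [CommRing A] [IsLocalRing A] [Algebra R A]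
  [Module.FaithfullyFlat R A]

lemma IsUnramifiedLocal.of_faithfullyFlat (h : IsUnramifiedLocal R)
    (hm : maximalIdeal A = (maximalIdeal R).map (algebraMap R A)) :
    ringChar A = ringChar (ResidueField A) ∨
      ((ringChar (ResidueField A) : A) ∉ maximalIdeal A ^ 2) := by
  have h1 : ringChar R = ringChar A :=
    ringChar_eq_of_injective (algebraMap R A) (FaithfulSMul.algebraMap_injective R A)
  have h2 : ringChar (ResidueField R) = ringChar (ResidueField A) :=
    ringChar_eq_of_injective (ResidueField.map (algebraMap R A)) (RingHom.injective _)
  rw [← h1, ← h2]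
  refine h.imp_right fun h hp => h.2 ?_
  rw [← Ideal.comap_map_eq_self_of_faithfullyFlat (B := A) (maximalIdeal R ^ 2), Ideal.mem_comap,
    Ideal.map_pow, ← hm, map_natCast]
  exact hp

variable [IsNoetherianRing R] [IsNoetherianRing A]

lemma ringKrullDim_quotient_annihilator_baseChange_add_moduleGrade_le (M : Type u)
    [AddCommGroup M] [Module R M] [Module.Finite R M] [Nontrivial M] :
    ringKrullDim (A ⧸ Module.annihilator A (A ⊗[R] M)) + (moduleGrade R M : ℕ) ≤
      ringKrullDim A := by
  obtain ⟨rs, hlen, hmem, hreg⟩ := exists_isRegular_of_moduleGrade (R := R) M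
  have hreg' := hreg.of_faithfullyFlat (S := A)
  have hdim := ringKrullDim_add_length_eq_ringKrullDim_of_isRegular _ hreg'
  rw [List.length_map, hlen] at hdim
  rw [← hdim]
  gcongr
  have hle : Ideal.ofList (rs.map (algebraMap R A)) ≤ Module.annihilator A (A ⊗[R] M) := by
    refine Ideal.span_le.2 ?_
    intro a ha
    obtain ⟨r, hr, rfl⟩ := List.mem_map.1 ha
    refine Module.mem_annihilator.2 fun z => ?_
    rw [algebraMap_smul]
    induction z with
    | zero => simp
    | add x y hx hy => rw [smul_add, hx, hy, add_zero]
    | tmul x y =>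
      rw [← TensorProduct.tmul_smul, Module.mem_annihilator.1 (hmem r hr) y, tmul_zero]
  exact ringKrullDim_le_of_surjective (Ideal.Quotient.factor hle)
    (Ideal.Quotient.factor_surjective hle)

end Flat

lemma IsRegularLocal.exists_isRegularOfDim_succ {Q : Type u} [CommRing Q] [IsLocalRing Q]
    (h : IsRegularLocal Q) {f : Q} (hf : f ∈ maximalIdeal Q) (hf0 : f ≠ 0) :
    ∃ d : ℕ, IsRegularOfDim Q (d + 1) := by
  obtain ⟨-, s, hs, hd⟩ := h
  have hcard : s.card ≠ 0 := by
    intro h0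
    rw [Finset.card_eq_zero.1 h0, Finset.coe_empty, Ideal.span_empty] at hs
    rw [← hs] at hf
    exact hf0 hf
  obtain ⟨d, hd'⟩ := Nat.exists_eq_succ_of_ne_zero hcard
  refine ⟨d, ?_, s, hd'.le, hs⟩
  rw [← hd, hd']
  rfl

/-- Over an unramified hypersurface, for every nonzero finitely generated module `M`,
`Ext^i(M, M) ≠ 0` for all `0 ≤ i ≤ grade M`. -/
theorem ext_self_nonzero_of_unramified_hypersurface
    (R : Type u) [CommRing R] [IsLocalRing R] [IsNoetherianRing R]
    (hunr : IsUnramifiedLocal R) (hhyp : IsHypersurface R)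
    (M : Type u) [AddCommGroup M] [Module R M] [Module.Finite R M] (hM : Nontrivial M) :
    ∀ i ≤ moduleGrade R M, ¬ Subsingleton (extMod R i M M) := by
  intro i hi hs
  cases i with
  | zero =>
    obtain ⟨e⟩ := extMod_zero_equiv_hom (R := R) (M := M) M
    have : Subsingleton (M →ₗ[R] M) := e.symm.toEquiv.subsingleton
    obtain ⟨m, hm⟩ := exists_ne (0 : M)
    exact hm (LinearMap.congr_fun (Subsingleton.elim (LinearMap.id : M →ₗ[R] M) 0) m)
  | succ i =>
    obtain ⟨-, ⟨P⟩⟩ := hhyp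
    let _ := P.commRing
    let _ := P.localRing
    have _ := P.regular.1
    have hx : P.x ∈ maximalIdeal P.Q := Ideal.pow_le_self two_ne_zero P.mem_sq
    have hx0 : P.x ≠ 0 := nonZeroDivisors.ne_zero P.nonzerodivisor
    obtain ⟨d, hQ⟩ := P.regular.exists_isRegularOfDim_succ hx hx0
    let A := AdicCompletion (maximalIdeal R) R
    have : Module.Flat R A := AdicCompletion.flat_of_isNoetherian _
    have : Module.FaithfullyFlat R A := .of_flat_of_isLocalHom
    let π : P.Q →+* A := P.equiv.symm.toRingHom.comp (Ideal.Quotient.mk _)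
    have hπ : Function.Surjective π :=
      P.equiv.symm.surjective.comp Ideal.Quotient.mk_surjective
    have hker : RingHom.ker π = Ideal.span {P.x} := by
      ext y
      rw [RingHom.mem_ker, ← Ideal.Quotient.eq_zero_iff_mem]
      exact map_eq_zero_iff P.equiv.symm P.equiv.symm.injective
    have : IsNoetherianRing A := isNoetherianRing_of_surjective _ _ π hπ
    have hchar := hunr.of_faithfullyFlat (A := A) AdicCompletion.maximalIdeal_eq_map
    have hdA : ringKrullDim A = d := by
      have h1 := ringKrullDim_quotient_span_singleton_succ_eq_ringKrullDim_of_mem_nonZeroDivisors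
        P.nonzerodivisor hx
      rw [← ringKrullDim_eq_of_ringEquiv P.equiv, hQ.1] at h1
      change ringKrullDim A + 1 = _ at h1
      have h2 : ringKrullDim A + 1 = d + 1 := h1.trans (by push_cast; rfl)
      exact ENat.WithBot.add_one_cancel.1 h2
    have hgrade := ringKrullDim_quotient_annihilator_baseChange_add_moduleGrade_le (R := R) (A := A) M
    rw [hdA] at hgrade
    have : Nontrivial (A ⧸ Module.annihilator A (A ⊗[R] M)) := by
      refine Ideal.Quotient.nontrivial_iff.2 fun h => ?_
      exact not_subsingleton (A ⊗[R] M) (Module.annihilator_eq_top_iff.1 h)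
    obtain ⟨r, hr⟩ : ∃ r : ℕ, ringKrullDim (A ⧸ Module.annihilator A (A ⊗[R] M)) = r := by
      have h0 := ringKrullDim_nonneg_of_nontrivial (R := A ⧸ Module.annihilator A (A ⊗[R] M))
      have hle := (ringKrullDim_quotient_le (Module.annihilator A (A ⊗[R] M))).trans hdA.le
      generalize ringKrullDim (A ⧸ Module.annihilator A (A ⊗[R] M)) = a at h0 hle
      induction a with
      | bot => simp at h0
      | coe a =>
        induction a with
        | top => norm_cast at hle
        | coe a => exact ⟨a, rfl⟩
    rw [hr] at hgrade
    have hle : r + moduleGrade R M ≤ d := by exact_mod_cast hgrade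
    refine hQ.extMod_self_nonzero π hπ hker hx0 hchar (A ⊗[R] M) r hr i (by omega) ?_
    exact extMod_succ_subsingleton_baseChange (TensorProduct.isBaseChange R M A)
      (TensorProduct.isBaseChange R M A) i hs
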